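/- Let R be an order in a number field K, let d ≥ 2, and let g_1, …, g_d ∈ Cl(R) satisfy g_1 + g_2 + ⋯ + g_d = 0 while no proper nonempty subsequence of (g_1, …, g_d) has sum 0. Then there exist elements α, β, π_1, …, π_d of R, each irreducible in R, such that α·β = π_1·π_2⋯π_d. (In particular, the elasticity of R is at least d/2.) -/

import Mathlib

set_option synthInstance.maxHeartbeats 1000000
set_option maxHeartbeats 1000000

open NumberField

/-- The conductor of a subring `R` of the ring of integers `𝓞 K`:
the set of `x ∈ 𝓞 K` such that `x • 𝓞 K ⊆ R`, as an ideal of `𝓞 K`. -/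
noncomputable def conductorIdeal {K : Type*} [Field K] [NumberField K] (R : Subring (𝓞 K)) :
    Ideal (𝓞 K) where
  carrier := {x | ∀ y : 𝓞 K, x * y ∈ R}
  add_mem' := fun {a b} ha hb y => by
    simpa [add_mul] using R.add_mem (ha y) (hb y)
  zero_mem' := fun y => by simpa using R.zero_mem
  smul_mem' := fun c x hx y => by
    simpa [smul_eq_mul, mul_comm, mul_assoc, mul_left_comm] using hx (c * y)

namespace OrdPf
open Filter Topology MeasureTheory Set

section PartA
variable {ι : Type*}

noncomputable def nm (N : ι → ℕ) (m : ι →₀ ℕ) : ℝ := m.prod fun p k => (N p : ℝ) ^ k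

lemma nm_zero (N : ι → ℕ) : nm N 0 = 1 := by simp [nm]

lemma nm_add (N : ι → ℕ) (m n : ι →₀ ℕ) : nm N (m + n) = nm N m * nm N n := by
  classical
  unfold nm
  exact Finsupp.prod_add_index' (by simp) (by intros; rw [pow_add])

lemma nm_single (N : ι → ℕ) (p : ι) (k : ℕ) : nm N (Finsupp.single p k) = (N p : ℝ) ^ k := by
  simp [nm]

lemma one_le_nm {N : ι → ℕ} (hN : ∀ p, 2 ≤ N p) (m : ι →₀ ℕ) : 1 ≤ nm N m := by
  unfold nm Finsupp.prod
  refine Finset.prod_induction _ (fun x => 1 ≤ x) (fun a b => one_le_mul_of_one_le_of_one_le) le_rfl ?_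
  intro p _
  apply one_le_pow₀
  have := hN p
  exact_mod_cast (by omega : 1 ≤ N p)

lemma nm_pos {N : ι → ℕ} (hN : ∀ p, 2 ≤ N p) (m : ι →₀ ℕ) : 0 < nm N m :=
  lt_of_lt_of_le one_pos (one_le_nm hN m)

/-- Admissible test functions. -/
structure TestFn (ψ : ℝ → ℝ) (a b : ℝ) : Prop where
  cont : Continuous ψ
  nonneg : ∀ x, 0 ≤ ψ x
  a_pos : 0 < a
  a_le : a ≤ 1
  zero_a : ∀ x ≤ a, ψ x = 0
  zero_b : ∀ x, b ≤ x → ψ x = 0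
  one_pos : 0 < ψ 1

lemma TestFn.bdd {ψ : ℝ → ℝ} {a b : ℝ} (h : TestFn ψ a b) : ∃ B, 0 ≤ B ∧ ∀ x, ψ x ≤ B := by
  obtain ⟨B, hB⟩ := (isCompact_Icc (a := a) (b := b)).exists_bound_of_continuousOn h.cont.continuousOn
  refine ⟨max B 0, le_max_right _ _, fun x => ?_⟩
  by_cases hx : x ∈ Icc a b
  · exact (le_abs_self _).trans ((hB x hx).trans (le_max_left _ _))
  · rw [mem_Icc, not_and_or, not_le, not_le] at hx
    rcases hx with hx | hx
    · rw [h.zero_a x hx.le]; exact le_max_right _ _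
    · rw [h.zero_b x hx.le]; exact le_max_right _ _

noncomputable def SS (N : ι → ℕ) (ψ : ℝ → ℝ) (w : (ι →₀ ℕ) → ℂ) (x : ℝ) : ℂ :=
  ∑' m, w m * (ψ (x / nm N m) : ℂ)

variable {N : ι → ℕ} (hN : ∀ p, 2 ≤ N p) (hfin : ∀ X : ℝ, {m | nm N m ≤ X}.Finite)
  {ψ : ℝ → ℝ} {a b : ℝ} (hψ : TestFn ψ a b)

include hN hψ in
lemma psi_zero {X x : ℝ} (hx : x ≤ X) {m : ι →₀ ℕ} (hm : ¬ nm N m ≤ X / a) :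
    ψ (x / nm N m) = 0 := by
  apply hψ.zero_a
  rw [div_le_iff₀ (nm_pos hN m)]
  push Not at hm
  rw [div_lt_iff₀ hψ.a_pos] at hm
  linarith

include hN hψ in
lemma SS_eq_sum (w : (ι →₀ ℕ) → ℂ) {X x : ℝ} (hx : x ≤ X) :
    SS N ψ w x = ∑ m ∈ (hfin (X / a)).toFinset, w m * (ψ (x / nm N m) : ℂ) := by
  unfold SS
  apply tsum_eq_sum
  intro m hm
  rw [Set.Finite.mem_toFinset, mem_ofPred_eq] at hm
  rw [psi_zero hN hψ hx hm]; simp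

include hN hfin hψ in
lemma SS_cont (w : (ι →₀ ℕ) → ℂ) : Continuous (SS N ψ w) := by
  rw [continuous_iff_continuousAt]
  intro x
  have : SS N ψ w =ᶠ[𝓝 x] fun y => ∑ m ∈ (hfin ((x + 1) / a)).toFinset, w m * (ψ (y / nm N m) : ℂ) := by
    filter_upwards [Iio_mem_nhds (lt_add_one x)] with y hy
    exact SS_eq_sum hN hfin hψ w (le_of_lt hy)
  refine ContinuousAt.congr ?_ this.symm
  apply Continuous.continuousAt
  have := hψ.cont
  fun_prop

include hN hψ in
lemma SS_zero (w : (ι →₀ ℕ) → ℂ) {x : ℝ} (hx : x ≤ a) : SS N ψ w x = 0 := by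
  unfold SS
  rw [← tsum_zero (α := ℂ) (β := ι →₀ ℕ)]
  congr 1; ext m
  rw [hψ.zero_a]; · simp
  rw [div_le_iff₀ (nm_pos hN m)]
  nlinarith [hψ.a_pos, one_le_nm hN m]

include hN hfin hψ in
lemma SS_bound (w : (ι →₀ ℕ) → ℂ) (X : ℝ) : ∃ C, ∀ x ≤ X, ‖SS N ψ w x‖ ≤ C := by
  obtain ⟨B, hB0, hB⟩ := hψ.bdd
  refine ⟨∑ m ∈ (hfin (X / a)).toFinset, ‖w m‖ * B, fun x hx => ?_⟩
  rw [SS_eq_sum hN hfin hψ w hx]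
  refine (norm_sum_le _ _).trans (Finset.sum_le_sum fun m _ => ?_)
  rw [norm_mul]
  gcongr
  rw [Complex.norm_real, Real.norm_eq_abs, abs_of_nonneg (hψ.nonneg _)]
  exact hB _

/-- the error term -/
noncomputable def EE (N : ι → ℕ) (ψ : ℝ → ℝ) (w : (ι →₀ ℕ) → ℂ) (κ : ℂ) (x : ℝ) : ℂ :=
  SS N ψ w x - (Ioi (1:ℝ)).indicator (fun x => κ * (x : ℂ)) x

include hN hfin hψ in
lemma EE_bound (w : (ι →₀ ℕ) → ℂ) (κ : ℂ)
    (h : ∃ C, ∀ x : ℝ, 1 ≤ x → ‖SS N ψ w x - κ * x‖ ≤ C) : ∃ C, ∀ x, ‖EE N ψ w κ x‖ ≤ C := by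
  obtain ⟨C, hC⟩ := h
  obtain ⟨C', hC'⟩ := SS_bound hN hfin hψ w 1
  refine ⟨max C C', fun x => ?_⟩
  unfold EE
  by_cases hx : 1 < x
  · rw [indicator_of_mem (by exact hx)]
    exact (hC x hx.le).trans (le_max_left _ _)
  · rw [indicator_of_notMem (by exact hx), sub_zero]
    exact (hC' x (not_lt.1 hx)).trans (le_max_right _ _)

include hN hψ in
lemma EE_zero (w : (ι →₀ ℕ) → ℂ) (κ : ℂ) {x : ℝ} (hx : x ≤ a) : EE N ψ w κ x = 0 := by
  unfold EE
  rw [SS_zero hN hψ w hx, indicator_of_notMem, sub_zero]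
  simp only [mem_Ioi, not_lt]; exact hx.trans hψ.a_le

include hN hfin hψ in
lemma EE_meas (w : (ι →₀ ℕ) → ℂ) (κ : ℂ) : Measurable (EE N ψ w κ) := by
  unfold EE
  apply Measurable.sub (SS_cont hN hfin hψ w).measurable
  apply Measurable.indicator _ measurableSet_Ioi
  fun_prop

lemma locInt_of_bdd {f : ℝ → ℂ} (hm : Measurable f) (hb : ∃ C, ∀ x, ‖f x‖ ≤ C) :
    LocallyIntegrable f := by
  obtain ⟨C, hC⟩ := hb
  have : LocallyIntegrable (fun _ : ℝ => (C:ℝ)) := locallyIntegrable_const C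
  exact this.mono hm.aestronglyMeasurable (Eventually.of_forall fun x => (hC x).trans (le_abs_self _))

lemma bigO_zero_of {f : ℝ → ℂ} {a : ℝ} (ha : 0 < a) (h0 : ∀ x ≤ a, f x = 0) (r : ℝ) :
    f =O[𝓝[>] 0] (fun x : ℝ => x ^ (-r)) := by
  have : f =ᶠ[𝓝[>] 0] 0 := by
    filter_upwards [nhdsWithin_le_nhds (Iio_mem_nhds ha)] with x hx
    exact h0 x (le_of_lt hx)
  exact this.trans_isBigO (Asymptotics.isBigO_zero _ _)

lemma bigO_top_of {f : ℝ → ℂ} (hb : ∃ C, ∀ x, ‖f x‖ ≤ C) :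
    f =O[atTop] (fun x : ℝ => x ^ (-(0:ℝ))) := by
  obtain ⟨C, hC⟩ := hb
  apply Asymptotics.IsBigO.of_bound C
  filter_upwards with x
  simpa using hC x

include hN hfin hψ in
lemma EE_mellin (w : (ι →₀ ℕ) → ℂ) (κ : ℂ)
    (h : ∃ C, ∀ x : ℝ, 1 ≤ x → ‖SS N ψ w x - κ * x‖ ≤ C) {s : ℂ} (hs : 0 < s.re) :
    MellinConvergent (EE N ψ w κ) (-s) ∧ DifferentiableAt ℂ (mellin (EE N ψ w κ)) (-s) := by
  have hb := EE_bound hN hfin hψ w κ h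
  have h1 := (locInt_of_bdd (EE_meas hN hfin hψ w κ) hb)
  have h2 := bigO_top_of hb
  have h3 := bigO_zero_of hψ.a_pos (fun x hx => EE_zero hN hψ w κ hx) (-s.re - 1)
  refine ⟨mellinConvergent_of_isBigO_rpow (h1.locallyIntegrableOn _) h2 (by simpa using hs) h3 (by simp),
    mellin_differentiableAt_of_isBigO_rpow (h1.locallyIntegrableOn _) h2 (by simpa using hs) h3 (by simp)⟩

lemma mellin_main (κ : ℂ) {s : ℂ} (hs : 1 < s.re) :
    HasMellin ((Ioi (1:ℝ)).indicator (fun x : ℝ => κ * (x : ℂ))) (-s) (κ / (s - 1)) := by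
  have hs' : s - 1 ≠ 0 := fun h => by
    have := congrArg Complex.re h; simp at this; linarith
  have hinteg : IntegrableOn (fun t : ℝ => (t : ℂ) ^ (-s)) (Ioi 1) :=
    integrableOn_Ioi_cpow_of_lt (by simpa using hs) one_pos
  have heq : (fun t : ℝ => (t:ℂ) ^ (-s - 1) • (Ioi (1:ℝ)).indicator (fun x : ℝ => κ * (x : ℂ)) t)
      = (Ioi (1:ℝ)).indicator (fun t : ℝ => κ * (t:ℂ) ^ (-s)) := by
    ext t
    by_cases ht : t ∈ Ioi (1:ℝ)
    · rw [indicator_of_mem ht, indicator_of_mem ht, smul_eq_mul]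
      have ht0 : (t:ℂ) ≠ 0 := by
        have : (1:ℝ) < t := ht
        exact_mod_cast (by linarith : t ≠ 0)
      rw [Complex.cpow_sub _ _ ht0, Complex.cpow_one]; field_simp
    · rw [indicator_of_notMem ht, indicator_of_notMem ht, smul_zero]
  constructor
  · unfold MellinConvergent
    rw [heq]
    apply Integrable.integrableOn
    rw [integrable_indicator_iff measurableSet_Ioi]
    exact hinteg.const_mul κ
  · unfold mellin
    rw [heq, setIntegral_indicator measurableSet_Ioi, inter_eq_right.2 (Ioi_subset_Ioi zero_le_one),
      integral_const_mul, integral_Ioi_cpow_of_lt (by simpa using hs) one_pos]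
    simp only [Complex.ofReal_one, Complex.one_cpow]
    have : -s + 1 ≠ 0 := by intro h; apply hs'; linear_combination -h
    field_simp
    ring

/-- the mellin transform of the test function -/
noncomputable def PP (ψ : ℝ → ℝ) (s : ℂ) : ℂ := mellin (fun x => (ψ x : ℂ)) (-s)

include hψ in
lemma PP_conv (s : ℂ) : MellinConvergent (fun x => (ψ x : ℂ)) (-s) ∧ DifferentiableAt ℂ (PP ψ) s := by
  obtain ⟨B, hB0, hB⟩ := hψ.bdd
  have h1 : LocallyIntegrable (fun x => (ψ x : ℂ)) :=
    (Complex.continuous_ofReal.comp hψ.cont).locallyIntegrable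
  have h2 : (fun x => (ψ x : ℂ)) =O[atTop] (fun x : ℝ => x ^ (-(-s.re + 1))) := by
    have : (fun x => (ψ x : ℂ)) =ᶠ[atTop] 0 := by
      filter_upwards [Ici_mem_atTop b] with x hx
      simp [hψ.zero_b x hx]
    exact this.trans_isBigO (Asymptotics.isBigO_zero _ _)
  have h3 := bigO_zero_of (f := fun x => (ψ x : ℂ)) hψ.a_pos (fun x hx => by simp [hψ.zero_a x hx]) (-s.re - 1)
  refine ⟨mellinConvergent_of_isBigO_rpow (h1.locallyIntegrableOn _) h2 (by simp) h3 (by simp), ?_⟩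
  have := mellin_differentiableAt_of_isBigO_rpow (s := -s) (h1.locallyIntegrableOn _) h2 (by simp) h3 (by simp)
  exact this.comp (f := fun s : ℂ => -s) s differentiableAt_id.neg

include hN hψ in
lemma mellin_term (m : ι →₀ ℕ) (s : ℂ) :
    HasMellin (fun x : ℝ => (ψ (x / nm N m) : ℂ)) (-s) ((nm N m : ℂ) ^ (-s) * PP ψ s) := by
  have hp : 0 < (nm N m)⁻¹ := inv_pos.2 (nm_pos hN m)
  have heq : (fun x : ℝ => (ψ (x / nm N m) : ℂ)) = fun x : ℝ => (fun y : ℝ => (ψ y : ℂ)) ((nm N m)⁻¹ * x) := by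
    ext x; simp [div_eq_inv_mul]
  constructor
  · rw [heq]
    refine (MellinConvergent.comp_mul_left (f := fun y : ℝ => (ψ y : ℂ)) hp).2 ?_
    exact (PP_conv hψ s).1
  · rw [heq, mellin_comp_mul_left (fun y : ℝ => (ψ y : ℂ)) _ hp, neg_neg, smul_eq_mul, PP]
    congr 1
    rw [Complex.ofReal_inv, Complex.inv_cpow, Complex.cpow_neg]
    rw [Complex.arg_ofReal_of_nonneg (nm_pos hN m).le]; exact Real.pi_pos.ne

include hψ in
lemma PP_real (σ : ℝ) : ∃ r : ℝ, 0 < r ∧ PP ψ (σ : ℂ) = r ∧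
    r = ∫ t in Ioi (0:ℝ), t ^ (-σ - 1) * ψ t := by
  have h1 : ∀ t ∈ Ioi (0:ℝ), (t:ℂ) ^ (-(σ:ℂ) - 1) • (ψ t : ℂ) = ((t ^ (-σ - 1) * ψ t : ℝ) : ℂ) := by
    intro t ht
    rw [smul_eq_mul, Complex.ofReal_mul, Complex.ofReal_cpow (le_of_lt ht)]; push_cast; rfl
  have hPP : PP ψ (σ : ℂ) = ((∫ t in Ioi (0:ℝ), t ^ (-σ - 1) * ψ t : ℝ) : ℂ) := by
    unfold PP mellin
    rw [setIntegral_congr_fun measurableSet_Ioi h1, ← integral_complex_ofReal]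
  refine ⟨_, ?_, hPP, rfl⟩
  have hinteg : IntegrableOn (fun t : ℝ => t ^ (-σ - 1) * ψ t) (Ioi 0) := by
    have := (PP_conv hψ σ).1
    unfold MellinConvergent at this
    have h2 := (integrableOn_congr_fun h1 measurableSet_Ioi).1 this
    exact h2.re
  rw [integral_pos_iff_support_of_nonneg_ae _ hinteg]
  · have hsub : Ioi (0:ℝ) ∩ {t | 0 < ψ t} ⊆ Function.support (fun t : ℝ => t ^ (-σ - 1) * ψ t) ∩ Ioi 0 := by
      rintro t ⟨ht, ht'⟩
      refine ⟨?_, ht⟩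
      have := mul_pos (Real.rpow_pos_of_pos ht (-σ-1)) ht'
      exact this.ne'
    rw [Measure.restrict_apply' measurableSet_Ioi]
    refine lt_of_lt_of_le ?_ (measure_mono hsub)
    apply IsOpen.measure_pos
    · exact isOpen_Ioi.inter (isOpen_lt continuous_const hψ.cont)
    · exact ⟨1, mem_Ioi.2 one_pos, hψ.one_pos⟩
  · filter_upwards [ae_restrict_mem measurableSet_Ioi] with t ht
    exact mul_nonneg (Real.rpow_nonneg (le_of_lt ht) _) (hψ.nonneg t)

end PartA
end OrdPf

namespace OrdPf
open Filter Topology MeasureTheory Set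

section PartA2
variable {ι : Type*}
variable {N : ι → ℕ} (hN : ∀ p, 2 ≤ N p) (hfin : ∀ X : ℝ, {m | nm N m ≤ X}.Finite)
  {ψ : ℝ → ℝ} {a b : ℝ} (hψ : TestFn ψ a b)

include hN hψ in
lemma real_term (σ : ℝ) (m : ι →₀ ℕ) :
    IntegrableOn (fun t : ℝ => t ^ (-σ - 1) * ψ (t / nm N m)) (Ioi 0) ∧
    ∫ t in Ioi (0:ℝ), t ^ (-σ - 1) * ψ (t / nm N m) =
      (nm N m) ^ (-σ) * ∫ t in Ioi (0:ℝ), t ^ (-σ - 1) * ψ t := by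
  have h1 : ∀ t ∈ Ioi (0:ℝ), (t:ℂ) ^ (-(σ:ℂ) - 1) • (ψ (t / nm N m) : ℂ)
      = ((t ^ (-σ - 1) * ψ (t / nm N m) : ℝ) : ℂ) := by
    intro t ht
    rw [smul_eq_mul, Complex.ofReal_mul, Complex.ofReal_cpow (le_of_lt ht)]; push_cast; rfl
  obtain ⟨hc, he⟩ := mellin_term hN hψ m (σ : ℂ)
  constructor
  · unfold MellinConvergent at hc
    have h2 := (integrableOn_congr_fun h1 measurableSet_Ioi).1 hc
    exact h2.re
  · obtain ⟨r, -, hr, hr'⟩ := PP_real hψ σ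
    rw [hr, hr'] at he
    unfold mellin at he
    rw [setIntegral_congr_fun measurableSet_Ioi h1, integral_complex_ofReal] at he
    have : ((nm N m : ℝ) : ℂ) ^ (-(σ:ℂ)) = (((nm N m) ^ (-σ) : ℝ) : ℂ) := by
      rw [Complex.ofReal_cpow (nm_pos hN m).le]; push_cast; rfl
    rw [this] at he
    exact_mod_cast he

include hN hfin hψ in
lemma SS_mellin (w : (ι →₀ ℕ) → ℂ) (κ : ℂ)
    (h : ∃ C, ∀ x : ℝ, 1 ≤ x → ‖SS N ψ w x - κ * x‖ ≤ C) {s : ℂ} (hs : 1 < s.re) :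
    HasMellin (SS N ψ w) (-s) (κ / (s - 1) + mellin (EE N ψ w κ) (-s)) := by
  have h1 := mellin_main κ hs
  have h2 := EE_mellin hN hfin hψ w κ h (s := s) (by linarith)
  have h3 := hasMellin_add h1.1 h2.1
  rw [h1.2] at h3
  convert h3 using 2
  simp [EE]

include hN hfin hψ in
lemma nm_summable (κ : ℂ)
    (h : ∃ C, ∀ x : ℝ, 1 ≤ x → ‖SS N ψ (fun _ => 1) x - κ * x‖ ≤ C) {σ : ℝ} (hσ : 1 < σ) :
    Summable fun m => (nm N m) ^ (-σ) := by
  obtain ⟨r, hr0, -, hr⟩ := PP_real hψ σ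
  have hm := (SS_mellin hN hfin hψ _ κ h (s := (σ:ℂ)) (by simpa using hσ)).1
  unfold MellinConvergent at hm
  have h1 : ∀ t ∈ Ioi (0:ℝ), (t:ℂ) ^ (-(σ:ℂ) - 1) • SS N ψ (fun _ => 1) t
      = ((t ^ (-σ - 1) * (∑' m, ψ (t / nm N m)) : ℝ) : ℂ) := by
    intro t ht
    rw [smul_eq_mul, Complex.ofReal_mul, Complex.ofReal_cpow (le_of_lt ht), SS]; push_cast
    simp
  have hI := ((integrableOn_congr_fun h1 measurableSet_Ioi).1 hm).re
  simp only [RCLike.re_to_complex, Complex.ofReal_re] at hI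
  apply summable_of_sum_le (c := (∫ t in Ioi (0:ℝ), t ^ (-σ - 1) * (∑' m, ψ (t / nm N m))) / r)
  · intro m; exact Real.rpow_nonneg (nm_pos hN m).le _
  · intro T
    rw [le_div_iff₀ hr0, Finset.sum_mul]
    rw [hr]
    simp_rw [← (real_term hN hψ σ _).2]
    rw [← integral_finsetSum _ (fun m _ => (real_term hN hψ σ m).1)]
    apply setIntegral_mono_on _ hI measurableSet_Ioi
    · intro t ht
      rw [← Finset.mul_sum]
      apply mul_le_mul_of_nonneg_left _ (Real.rpow_nonneg (le_of_lt ht) _)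
      refine Summable.sum_le_tsum T (fun m _ => hψ.nonneg _) ?_
      refine summable_of_hasFiniteSupport ((hfin (t / a)).subset ?_)
      intro m hm
      by_contra hc
      exact hm (psi_zero hN hψ le_rfl hc)
    · exact integrable_finsetSum _ fun m _ => (real_term hN hψ σ m).1

noncomputable def LL (N : ι → ℕ) (w : (ι →₀ ℕ) → ℂ) (s : ℂ) : ℂ :=
  ∑' m, w m * (nm N m : ℂ) ^ (-s)

include hN in
lemma norm_nm_cpow (m : ι →₀ ℕ) (s : ℂ) : ‖(nm N m : ℂ) ^ (-s)‖ = (nm N m) ^ (-s.re) := by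
  rw [Complex.norm_cpow_eq_rpow_re_of_pos (nm_pos hN m)]; simp

include hfin in
lemma countM : Countable (ι →₀ ℕ) := by
  have : (Set.univ : Set (ι →₀ ℕ)) ⊆ ⋃ n : ℕ, {m | nm N m ≤ (n : ℝ)} := by
    intro m _
    obtain ⟨n, hn⟩ := exists_nat_ge (nm N m)
    exact mem_iUnion.2 ⟨n, hn⟩
  rw [← Set.countable_univ_iff]
  exact (Set.countable_iUnion fun n : ℕ => (hfin (n : ℝ)).countable).mono this

include hN hfin hψ in
lemma LL_mellin (hsum : ∀ σ : ℝ, 1 < σ → Summable fun m => (nm N m) ^ (-σ))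
    (w : (ι →₀ ℕ) → ℂ) (hw : ∀ m, ‖w m‖ ≤ 1) (κ : ℂ)
    (h : ∃ C, ∀ x : ℝ, 1 ≤ x → ‖SS N ψ w x - κ * x‖ ≤ C) {s : ℂ} (hs : 1 < s.re) :
    LL N w s * PP ψ s = κ / (s - 1) + mellin (EE N ψ w κ) (-s) := by
  have := countM hfin
  rw [← (SS_mellin hN hfin hψ w κ h hs).2]
  set F : (ι →₀ ℕ) → ℝ → ℂ := fun m t => (t:ℂ) ^ (-s - 1) • (w m * (ψ (t / nm N m) : ℂ)) with hF
  have hFeq : ∀ m, F m = fun t : ℝ => w m * ((t:ℂ) ^ (-s - 1) • (ψ (t / nm N m) : ℂ)) := by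
    intro m; ext t; simp only [hF, smul_eq_mul]; ring
  have hinteg : ∀ m, Integrable (F m) (volume.restrict (Ioi 0)) := by
    intro m
    rw [hFeq]
    exact Integrable.const_mul (mellin_term hN hψ m s).1 _
  obtain ⟨r, hr0, -, hr⟩ := PP_real hψ s.re
  have hnorm : ∀ m, ∫ t in Ioi (0:ℝ), ‖F m t‖ = ‖w m‖ * ((nm N m) ^ (-s.re) * r) := by
    intro m
    rw [hr, ← (real_term hN hψ s.re m).2, ← integral_const_mul]
    apply setIntegral_congr_fun measurableSet_Ioi
    intro t ht
    simp only [hFeq, norm_mul, smul_eq_mul]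
    rw [Complex.norm_cpow_eq_rpow_re_of_pos ht, Complex.norm_real, Real.norm_eq_abs,
      abs_of_nonneg (hψ.nonneg _)]
    simp
  have hs1 : Summable fun m => ∫ t in Ioi (0:ℝ), ‖F m t‖ := by
    simp_rw [hnorm]
    refine Summable.of_nonneg_of_le (fun m => ?_) (fun m => ?_) ((hsum s.re hs).mul_right r)
    · have := Real.rpow_nonneg (nm_pos hN m).le (-s.re); positivity
    · have := Real.rpow_nonneg (nm_pos hN m).le (-s.re)
      exact mul_le_of_le_one_left (by positivity) (hw m)
  have hh := (hasSum_integral_of_summable_integral_norm hinteg hs1).tsum_eq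
  unfold mellin LL
  rw [← tsum_mul_right]
  have e1 : ∀ m, ∫ t in Ioi (0:ℝ), F m t = w m * (nm N m : ℂ) ^ (-s) * PP ψ s := by
    intro m
    rw [hFeq, integral_const_mul, mul_assoc]
    congr 1
    exact (mellin_term hN hψ m s).2
  simp_rw [e1] at hh
  rw [hh]
  apply integral_congr_ae
  filter_upwards with t
  simp only [hF, smul_eq_mul, SS]
  rw [tsum_mul_left]

/-! ### The derivative identity -/

include hN in
lemma log_nm_nonneg (m : ι →₀ ℕ) : 0 ≤ Real.log (nm N m) := Real.log_nonneg (one_le_nm hN m)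

include hN in
lemma log_summable (hsum : ∀ σ : ℝ, 1 < σ → Summable fun m => (nm N m) ^ (-σ)) {σ : ℝ} (hσ : 1 < σ) :
    Summable fun m => Real.log (nm N m) * (nm N m) ^ (-σ) := by
  set ε := (σ - 1) / 2 with hε
  have hε0 : 0 < ε := by rw [hε]; linarith
  refine Summable.of_nonneg_of_le (fun m => ?_) (fun m => ?_) ((hsum (σ - ε) (by rw [hε]; linarith)).mul_left (1/ε))
  · exact mul_nonneg (log_nm_nonneg hN m) (Real.rpow_nonneg (nm_pos hN m).le _)
  · have h1 := Real.log_le_rpow_div (nm_pos hN m).le hε0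
    have h2 : (nm N m) ^ (-(σ - ε)) = (nm N m) ^ ε * (nm N m) ^ (-σ) := by
      rw [← Real.rpow_add (nm_pos hN m)]; congr 1; ring
    rw [h2]
    calc _ ≤ ((nm N m) ^ ε / ε) * (nm N m) ^ (-σ) :=
        mul_le_mul_of_nonneg_right h1 (Real.rpow_nonneg (nm_pos hN m).le _)
      _ = _ := by ring

include hN in
lemma LL_deriv (hsum : ∀ σ : ℝ, 1 < σ → Summable fun m => (nm N m) ^ (-σ))
    (w : (ι →₀ ℕ) → ℂ) (hw : ∀ m, ‖w m‖ ≤ 1) {s : ℂ} (hs : 1 < s.re) :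
    DifferentiableAt ℂ (LL N w) s ∧
    deriv (LL N w) s = - ∑' m, (Real.log (nm N m) : ℂ) * (w m * (nm N m : ℂ) ^ (-s)) := by
  set σ := (1 + s.re) / 2 with hσ
  have hU : IsOpen {z : ℂ | σ < z.re} := isOpen_lt continuous_const Complex.continuous_re
  have hsU : s ∈ {z : ℂ | σ < z.re} := by simp only [mem_ofPred_eq, hσ]; linarith
  have hne : ∀ m, (nm N m : ℂ) ≠ 0 := fun m => by exact_mod_cast (nm_pos hN m).ne'
  have hder : ∀ m (z : ℂ), HasDerivAt (fun z => w m * (nm N m : ℂ) ^ (-z))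
      (-((Real.log (nm N m) : ℂ) * (w m * (nm N m : ℂ) ^ (-z)))) z := by
    intro m z
    have := ((hasDerivAt_id z).neg.const_cpow (c := (nm N m : ℂ)) (Or.inl (hne m))).const_mul (w m)
    refine this.congr_deriv ?_
    rw [Complex.ofReal_log (nm_pos hN m).le]; simp; ring
  have hb : ∀ m (z : ℂ), z ∈ {z : ℂ | σ < z.re} → ‖w m * (nm N m : ℂ) ^ (-z)‖ ≤ (nm N m) ^ (-σ) := by
    intro m z hz
    rw [norm_mul, norm_nm_cpow hN]
    have h1 : (nm N m) ^ (-z.re) ≤ (nm N m) ^ (-σ) :=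
      Real.rpow_le_rpow_of_exponent_le (one_le_nm hN m) (by simp only [mem_ofPred_eq] at hz; linarith)
    have := Real.rpow_nonneg (nm_pos hN m).le (-z.re)
    exact (mul_le_of_le_one_left this (hw m)).trans h1
  have hσ1 : 1 < σ := by rw [hσ]; linarith
  constructor
  · exact (Complex.differentiableOn_tsum_of_summable_norm (hsum σ hσ1)
      (fun m z _ => (hder m z).differentiableAt.differentiableWithinAt) hU hb).differentiableAt (hU.mem_nhds hsU)
  · have := (Complex.hasSum_deriv_of_summable_norm (hsum σ hσ1)
      (fun m z _ => (hder m z).differentiableAt.differentiableWithinAt) hU hb hsU).tsum_eq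
    unfold LL
    rw [← this, ← tsum_neg]
    congr 1; ext m
    exact (hder m s).deriv

/-- the prime power with exponent `k + 1` -/
noncomputable def pp (q : ι × ℕ) : ι →₀ ℕ := Finsupp.single q.1 (q.2 + 1)

noncomputable def Lam (N : ι → ℕ) (w : (ι →₀ ℕ) → ℂ) (s : ℂ) : ℂ :=
  ∑' q : ι × ℕ, (Real.log (N q.1) : ℂ) * (w (pp q) * (nm N (pp q) : ℂ) ^ (-s))

include hN in
lemma log_sum (K : ι →₀ ℕ) :
    HasSum (fun q : ι × ℕ => if pp q ≤ K then Real.log (N q.1) else 0) (Real.log (nm N K)) := by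
  classical
  set T : Finset (ι × ℕ) := K.support.biUnion fun p => (Finset.range (K p)).image (Prod.mk p) with hT
  have hmem : ∀ q : ι × ℕ, q ∈ T ↔ q.2 < K q.1 := by
    rintro ⟨p, k⟩
    simp only [hT, Finset.mem_biUnion, Finset.mem_image, Finset.mem_range,
      Prod.mk.injEq, Finsupp.mem_support_iff]
    constructor
    · rintro ⟨p', h, k', h1, rfl, rfl⟩; exact h1
    · intro h; exact ⟨p, by omega, k, h, rfl, rfl⟩
  have hle : ∀ q : ι × ℕ, pp q ≤ K ↔ q.2 < K q.1 := by
    rintro ⟨p, k⟩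
    simp only [pp]
    rw [Finsupp.single_le_iff]; omega
  have hval : Real.log (nm N K) = ∑ q ∈ T, if pp q ≤ K then Real.log (N q.1) else 0 := by
    rw [Finset.sum_congr rfl (fun q hq => if_pos ((hle q).2 ((hmem q).1 hq)))]
    rw [hT, Finset.sum_biUnion]
    · unfold nm Finsupp.prod
      rw [Real.log_prod]
      · apply Finset.sum_congr rfl
        intro p _
        rw [Finset.sum_image (fun a _ b _ h => by simpa using h)]
        simp
      · intro p _
        have := hN p
        have : (N p : ℝ) ≠ 0 := by exact_mod_cast (by omega)
        positivity
    · intro p _ p' _ hne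
      simp only [Function.onFun]
      rw [Finset.disjoint_left]
      rintro ⟨x, y⟩ h1 h2
      simp only [Finset.mem_image, Prod.mk.injEq] at h1 h2
      obtain ⟨_, _, h1, _⟩ := h1
      obtain ⟨_, _, h2, _⟩ := h2
      exact hne (h1.trans h2.symm)
  rw [hval]
  apply hasSum_sum_of_ne_finset_zero
  intro q hq
  rw [if_neg]
  rw [hle, ← hmem]; exact hq

include hN in
lemma Lam_mul (hsum : ∀ σ : ℝ, 1 < σ → Summable fun m => (nm N m) ^ (-σ))
    (w : (ι →₀ ℕ) → ℂ) (hw : ∀ m, ‖w m‖ ≤ 1) (hmul : ∀ m n, w (m + n) = w m * w n)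
    {s : ℂ} (hs : 1 < s.re) :
    Lam N w s * LL N w s = - deriv (LL N w) s := by
  classical
  rw [(LL_deriv hN hsum w hw hs).2, neg_neg]
  set g : (ι →₀ ℕ) → ℂ := fun m => w m * (nm N m : ℂ) ^ (-s) with hg
  have hgadd : ∀ m n, g (m + n) = g m * g n := by
    intro m n
    simp only [hg, hmul, nm_add]
    rw [Complex.ofReal_mul, Complex.mul_cpow_ofReal_nonneg (nm_pos hN m).le (nm_pos hN n).le]; ring
  have hgn : ∀ m, ‖g m‖ ≤ (nm N m) ^ (-s.re) := by
    intro m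
    simp only [hg, norm_mul, norm_nm_cpow hN]
    exact mul_le_of_le_one_left (Real.rpow_nonneg (nm_pos hN m).le _) (hw m)
  set f : (ι →₀ ℕ) × (ι × ℕ) → ℂ := fun x => ((if pp x.2 ≤ x.1 then Real.log (N x.2.1) else 0 : ℝ) : ℂ) * g x.1 with hf
  have hlog0 : ∀ p, 0 ≤ Real.log (N p) := fun p => Real.log_natCast_nonneg _
  have hfs : Summable f := by
    apply Summable.of_norm
    have hn : ∀ x, ‖f x‖ = (if pp x.2 ≤ x.1 then Real.log (N x.2.1) else 0) * ‖g x.1‖ := by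
      intro x
      simp only [hf, norm_mul, Complex.norm_real]
      congr 1
      split_ifs
      · rw [Real.norm_eq_abs, abs_of_nonneg (hlog0 _)]
      · simp
    rw [summable_prod_of_nonneg (fun x => norm_nonneg _)]
    simp_rw [hn]
    constructor
    · intro K
      exact (log_sum hN K).summable.mul_right _
    · simp_rw [tsum_mul_right, (log_sum hN _).tsum_eq]
      refine Summable.of_nonneg_of_le (fun m => mul_nonneg (log_nm_nonneg hN m) (norm_nonneg _))
        (fun m => mul_le_mul_of_nonneg_left (hgn m) (log_nm_nonneg hN m)) (log_summable hN hsum hs)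
  have e1 : ∑' m, (Real.log (nm N m) : ℂ) * g m = ∑' m, ∑' q, f (m, q) := by
    congr 1; ext m
    simp only [hf]
    rw [tsum_mul_right, ← Complex.ofReal_tsum, (log_sum hN m).tsum_eq]
  have e2 : Lam N w s * LL N w s = ∑' q, ∑' m, f (m, q) := by
    unfold Lam LL
    rw [← tsum_mul_right]
    congr 1; ext q
    have hinj : Function.Injective (fun m : ι →₀ ℕ => pp q + m) := add_right_injective _
    rw [← hinj.tsum_eq (f := fun m => f (m, q))]
    · rw [← tsum_mul_left]
      congr 1; ext m
      simp only [hf]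
      rw [if_pos (by simp), hgadd]
      simp only [hg]; ring
    · intro m hm
      have : pp q ≤ m := by
        by_contra hc
        apply hm; simp only [hf]; rw [if_neg hc]; simp
      exact ⟨m - pp q, by simpa using add_tsub_cancel_of_le this⟩
  rw [e2]
  show _ = ∑' m, (Real.log (nm N m) : ℂ) * g m
  rw [e1]
  exact (Summable.tsum_comm (f := fun q m => f (m, q)) (by
    rw [← (Equiv.prodComm _ _).summable_iff]; exact hfs)).symm

end PartA2
end OrdPf

namespace OrdPf
open Filter Topology MeasureTheory Set

section PartA3
variable {ι : Type*}
variable {N : ι → ℕ} (hN : ∀ p, 2 ≤ N p) (hfin : ∀ X : ℝ, {m | nm N m ≤ X}.Finite)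
  {ψ : ℝ → ℝ} {a b : ℝ} (hψ : TestFn ψ a b)

include hN in
lemma one_lt_nm {m : ι →₀ ℕ} (hm : m ≠ 0) : 1 < nm N m := by
  obtain ⟨p, hp⟩ := Finsupp.ne_iff.1 hm
  have hp' : 1 ≤ m p := Nat.one_le_iff_ne_zero.2 hp
  have hle : Finsupp.single p 1 ≤ m := by rwa [Finsupp.single_le_iff]
  obtain ⟨m', rfl⟩ := exists_add_of_le hle
  rw [nm_add, nm_single, pow_one]
  have h1 : (2:ℝ) ≤ N p := by exact_mod_cast hN p
  nlinarith [one_le_nm hN m']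

include hN in
lemma LL_tendsto (hsum : ∀ σ : ℝ, 1 < σ → Summable fun m => (nm N m) ^ (-σ))
    (w : (ι →₀ ℕ) → ℂ) (hw : ∀ m, ‖w m‖ ≤ 1) (hw0 : w 0 = 1) :
    Tendsto (fun x : ℝ => LL N w x) atTop (𝓝 1) := by
  classical
  have h1 : (1:ℂ) = ∑' m : ι →₀ ℕ, if m = 0 then (1:ℂ) else 0 := by simp
  rw [h1]
  unfold LL
  refine tendsto_tsum_of_dominated_convergence (hsum 2 (by norm_num)) ?_ ?_
  · intro m
    split_ifs with hm
    · subst hm; simp [hw0, nm_zero]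
    · have h2 : Tendsto (fun x : ℝ => (nm N m) ^ (-x)) atTop (𝓝 0) := by
        have h3 : Tendsto (fun x : ℝ => ((nm N m)⁻¹) ^ x) atTop (𝓝 0) :=
          tendsto_rpow_atTop_of_base_lt_one _ (by linarith [inv_pos.2 (nm_pos hN m)])
            (inv_lt_one_of_one_lt₀ (one_lt_nm hN hm))
        refine h3.congr fun x => ?_
        rw [Real.inv_rpow (nm_pos hN m).le, Real.rpow_neg (nm_pos hN m).le]
      rw [tendsto_zero_iff_norm_tendsto_zero]
      refine squeeze_zero (fun _ => norm_nonneg _) (fun x => ?_) h2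
      rw [norm_mul, norm_nm_cpow hN]
      simpa using mul_le_of_le_one_left (Real.rpow_nonneg (nm_pos hN m).le _) (hw m)
  · filter_upwards [Ici_mem_atTop (2:ℝ)] with x hx m
    rw [norm_mul, norm_nm_cpow hN]
    refine (mul_le_of_le_one_left (Real.rpow_nonneg (nm_pos hN m).le _) (hw m)).trans ?_
    exact Real.rpow_le_rpow_of_exponent_le (one_le_nm hN m) (by simpa using hx)

include hN hfin hψ in
lemma Lam_lim (hsum : ∀ σ : ℝ, 1 < σ → Summable fun m => (nm N m) ^ (-σ))
    (w : (ι →₀ ℕ) → ℂ) (hw : ∀ m, ‖w m‖ ≤ 1) (hw0 : w 0 = 1) (hmul : ∀ m n, w (m + n) = w m * w n)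
    (κ : ℂ) (h : ∃ C, ∀ x : ℝ, 1 ≤ x → ‖SS N ψ w x - κ * x‖ ≤ C) :
    ∃ k : ℕ, Tendsto (fun x : ℝ => ((x:ℂ) - 1) * Lam N w x) (𝓝[>] 1) (𝓝 (1 - (k:ℂ))) ∧
      (κ ≠ 0 → k = 0) ∧ (κ = 0 → 1 ≤ k) ∧ (κ = 0 → mellin (EE N ψ w κ) (-1) ≠ 0 → k = 1) := by
  set e : ℂ → ℂ := fun s => mellin (EE N ψ w κ) (-s) with he
  have hed : ∀ s : ℂ, 0 < s.re → DifferentiableAt ℂ e s := fun s hs =>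
    (EE_mellin hN hfin hψ w κ h hs).2.comp (f := fun s : ℂ => -s) s differentiableAt_id.neg
  obtain ⟨r, hr0, hr, -⟩ := PP_real hψ 1
  rw [Complex.ofReal_one] at hr
  have hP1 : PP ψ 1 ≠ 0 := by rw [hr]; exact_mod_cast hr0.ne'
  have hPd : Differentiable ℂ (PP ψ) := fun s => (PP_conv hψ s).2
  have hPne : ∀ᶠ s in 𝓝 (1:ℂ), PP ψ s ≠ 0 := hPd.continuous.continuousAt.eventually_ne hP1
  have hre : ∀ᶠ s in 𝓝 (1:ℂ), 0 < s.re :=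
    (isOpen_lt continuous_const Complex.continuous_re).mem_nhds (by simp)
  set H : ℂ → ℂ := fun s => (κ + (s - 1) * e s) / PP ψ s with hH
  have hHan : AnalyticAt ℂ H 1 := by
    rw [Complex.analyticAt_iff_eventually_differentiableAt]
    filter_upwards [hPne, hre] with s h1 h2
    have := hed s h2
    have := hPd s
    simp only [hH]
    fun_prop (disch := assumption)
  have hHL : ∀ s : ℂ, PP ψ s ≠ 0 → 1 < s.re → H s = (s - 1) * LL N w s := by
    intro s h1 h2
    have h3 := LL_mellin hN hfin hψ hsum w hw κ h h2
    have hs1 : s - 1 ≠ 0 := fun h => by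
      have := congrArg Complex.re h; simp at this; linarith
    simp only [hH]
    rw [div_eq_iff h1, mul_assoc, h3]
    field_simp
    rfl
  have hLan : AnalyticOnNhd ℂ (LL N w) {s | 1 < s.re} :=
    DifferentiableOn.analyticOnNhd (fun s hs => (LL_deriv hN hsum w hw hs).1.differentiableWithinAt)
      (isOpen_lt continuous_const Complex.continuous_re)
  have hcast : Tendsto (fun x : ℝ => (x:ℂ)) (𝓝[>] 1) (𝓝 (1:ℂ)) := by
    have : Tendsto (fun x : ℝ => (x:ℂ)) (𝓝 1) (𝓝 (((1:ℝ):ℂ))) := Complex.continuous_ofReal.continuousAt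
    rw [Complex.ofReal_one] at this
    exact this.mono_left nhdsWithin_le_nhds
  have hH0 : ¬ ∀ᶠ z in 𝓝 (1:ℂ), H z = 0 := by
    intro hz
    -- find a point
    have h1 := hcast.eventually (hz.eventually_nhds.and hPne.eventually_nhds)
    obtain ⟨x, ⟨hx1, hx2⟩, hx3⟩ := (h1.and self_mem_nhdsWithin).exists
    have hx3 : 1 < x := hx3
    have hx4 : ∀ᶠ s in 𝓝 (x:ℂ), 1 < s.re :=
      (isOpen_lt continuous_const Complex.continuous_re).mem_nhds (by simpa using hx3)
    have h0 : LL N w =ᶠ[𝓝 (x:ℂ)] 0 := by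
      filter_upwards [hx1, hx2, hx4] with s h1 h2 h3
      rw [hHL s h2 h3] at h1
      have hs1 : s - 1 ≠ 0 := fun h => by
        have := congrArg Complex.re h; simp at this; linarith
      simpa [hs1] using h1
    have hconn : IsPreconnected {s : ℂ | 1 < s.re} := (convex_halfSpace_re_gt 1).isPreconnected
    have := hLan.eqOn_zero_of_preconnected_of_eventuallyEq_zero hconn
      (show (x:ℂ) ∈ {s : ℂ | 1 < s.re} by simpa using hx3) h0
    have ht := LL_tendsto hN hsum w hw hw0
    have ht2 : Tendsto (fun x : ℝ => LL N w x) atTop (𝓝 0) := by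
      refine tendsto_const_nhds.congr' ?_
      filter_upwards [Ioi_mem_atTop (1:ℝ)] with y hy
      exact (this (show (y:ℂ) ∈ {s : ℂ | 1 < s.re} by simpa using hy)).symm
    exact one_ne_zero (tendsto_nhds_unique ht ht2)
  obtain ⟨k, g, hg, hg1, hgH⟩ := hHan.exists_eventuallyEq_pow_smul_nonzero_iff.2 hH0
  simp only [smul_eq_mul] at hgH
  refine ⟨k, ?_, ?_, ?_, ?_⟩
  · have hgne : ∀ᶠ s in 𝓝 (1:ℂ), g s ≠ 0 := hg.continuousAt.eventually_ne hg1
    have hgd : ∀ᶠ s in 𝓝 (1:ℂ), DifferentiableAt ℂ g s :=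
      hg.eventually_analyticAt.mono fun s hs => hs.differentiableAt
    have key : ∀ᶠ x : ℝ in 𝓝[>] 1, ((x:ℂ) - 1) * Lam N w x =
        1 - (k:ℂ) - ((x:ℂ) - 1) * (deriv g x / g x) := by
      have h1 := hcast.eventually (hgH.eventually_nhds.and (hPne.eventually_nhds.and (hgne.and hgd)))
      filter_upwards [h1, self_mem_nhdsWithin] with x hx hx3
      obtain ⟨hx1, hx2, hx5, hx6⟩ := hx
      have hx3 : 1 < x := hx3
      have hx4 : ∀ᶠ s in 𝓝 (x:ℂ), 1 < s.re :=
        (isOpen_lt continuous_const Complex.continuous_re).mem_nhds (by simpa using hx3)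
      have hxne : (x:ℂ) - 1 ≠ 0 := by
        rw [sub_ne_zero]; exact_mod_cast hx3.ne'
      have heq : LL N w =ᶠ[𝓝 (x:ℂ)] fun s => ((s - 1) ^ k * g s) / (s - 1) := by
        filter_upwards [hx1, hx2, hx4] with s h1 h2 h3
        have hs1 : s - 1 ≠ 0 := fun h => by
          have := congrArg Complex.re h; simp at this; linarith
        rw [eq_div_iff hs1, ← h1, hHL s h2 h3]; ring
      have hLne : LL N w x ≠ 0 := by
        rw [heq.eq_of_nhds]
        exact div_ne_zero (mul_ne_zero (pow_ne_zero _ hxne) hx5) hxne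
      have hder : deriv (LL N w) x / LL N w x = k / ((x:ℂ) - 1) + deriv g x / g x - 1 / ((x:ℂ) - 1) := by
        rw [heq.deriv_eq, heq.eq_of_nhds]
        have d1 : HasDerivAt (fun s : ℂ => s - 1) 1 (x:ℂ) := (hasDerivAt_id _).sub_const 1
        have d2 := ((d1.pow k).mul hx6.hasDerivAt).div d1 hxne
        have d3 : deriv (fun s => ((s - 1) ^ k * g s) / (s - 1)) (x:ℂ) = _ := d2.deriv
        rw [d3]
        simp only [Pi.pow_apply, Pi.mul_apply]
        rcases k with _ | k
        · simp only [CharP.cast_eq_zero, pow_zero]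
          field_simp
          simp
        · simp only [Nat.add_sub_cancel]
          field_simp
          ring
      have hL := Lam_mul hN hsum w hw hmul (s := (x:ℂ)) (by simpa using hx3)
      have : Lam N w x = - (deriv (LL N w) x / LL N w x) := by
        rw [← neg_div, ← hL]; field_simp
      rw [this, hder]
      field_simp
      ring
    refine Tendsto.congr' (key.mono fun x hx => hx.symm) ?_
    have hc : Tendsto (fun s : ℂ => deriv g s / g s) (𝓝 1) (𝓝 (deriv g 1 / g 1)) :=
      (hg.deriv.continuousAt.div hg.continuousAt hg1)
    have h2 : Tendsto (fun s : ℂ => 1 - (k:ℂ) - (s - 1) * (deriv g s / g s)) (𝓝 1)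
        (𝓝 (1 - (k:ℂ) - (1 - 1) * (deriv g 1 / g 1))) :=
      tendsto_const_nhds.sub ((tendsto_id.sub tendsto_const_nhds).mul hc)
    simp only [sub_self, zero_mul, sub_zero] at h2
    exact h2.comp hcast
  · intro hκ
    by_contra hk
    have h1 := hgH.self_of_nhds
    simp only [sub_self, zero_pow hk, zero_mul, hH, add_zero] at h1
    exact (div_ne_zero hκ hP1) h1
  · intro hκ
    by_contra hk
    have hk : k = 0 := by omega
    have h1 := hgH.self_of_nhds
    simp only [hH, hκ, hk, sub_self, zero_mul, add_zero, zero_div, pow_zero, one_mul] at h1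
    exact hg1 h1.symm
  · intro hκ he1
    have hk1 : k ≠ 0 := by
      rintro rfl
      have h1 := hgH.self_of_nhds
      simp only [hH, hκ, sub_self, zero_mul, add_zero, zero_div, pow_zero, one_mul] at h1
      exact hg1 h1.symm
    by_contra hk
    obtain ⟨j, rfl⟩ : ∃ j, k = j + 2 := ⟨k - 2, by omega⟩
    have hl : Tendsto (fun s => e s / PP ψ s) (𝓝[≠] 1) (𝓝 (e 1 / PP ψ 1)) :=
      (((hed 1 (by simp)).continuousAt).div hPd.continuous.continuousAt hP1).tendsto.mono_left nhdsWithin_le_nhds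
    have hl2 : Tendsto (fun s : ℂ => (s - 1) ^ (j + 1) * g s) (𝓝[≠] 1) (𝓝 ((1 - 1) ^ (j + 1) * g 1)) :=
      (((tendsto_id.sub tendsto_const_nhds).pow _).mul hg.continuousAt.tendsto).mono_left nhdsWithin_le_nhds
    have heq : (fun s => e s / PP ψ s) =ᶠ[𝓝[≠] 1] fun s : ℂ => (s - 1) ^ (j + 1) * g s := by
      filter_upwards [nhdsWithin_le_nhds hgH, self_mem_nhdsWithin] with s hs hs1
      have hs1 : s - 1 ≠ 0 := sub_ne_zero.2 hs1
      have hs' : H s = (s - 1) ^ (j + 2) * g s := hs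
      simp only [hH, hκ, zero_add, mul_div_assoc] at hs'
      apply mul_left_cancel₀ hs1
      rw [hs']; ring
    have := tendsto_nhds_unique (hl.congr' heq) hl2
    simp only [sub_self, ne_eq, Nat.add_eq_zero_iff, one_ne_zero, and_false, not_false_eq_true, zero_pow, zero_mul] at this
    exact (div_ne_zero he1 hP1) this

end PartA3
end OrdPf

namespace OrdPf
open Filter Topology MeasureTheory Set

section PartA5
variable {ι : Type*}
variable {N : ι → ℕ} (hN : ∀ p, 2 ≤ N p) (hfin : ∀ X : ℝ, {m | nm N m ≤ X}.Finite)
  {ψ : ℝ → ℝ} {a b : ℝ} (hψ : TestFn ψ a b)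

lemma geom_pm {ε : ℝ} (hε : ε = 1 ∨ ε = -1) (k : ℕ) :
    0 ≤ ∑ j ∈ Finset.range (k + 1), ε ^ j ∧ (Even k → 1 ≤ ∑ j ∈ Finset.range (k + 1), ε ^ j) := by
  rcases hε with rfl | rfl
  · simp; positivity
  · rw [neg_one_geom_sum]
    split_ifs with h
    · simp only [le_refl, true_and]
      intro h2; rw [Nat.even_add_one] at h; exact absurd h2 h
    · simp

lemma conv_pos [DecidableEq ι] (w : (ι →₀ ℕ) → ℝ) (hpm : ∀ m, w m = 1 ∨ w m = -1) (hw0 : w 0 = 1)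
    (hmul : ∀ m n, w (m + n) = w m * w n) (K : ι →₀ ℕ) :
    0 ≤ ∑ J ∈ Finset.Icc 0 K, w J ∧ ((∀ p, Even (K p)) → 1 ≤ ∑ J ∈ Finset.Icc 0 K, w J) := by
  induction K using Finsupp.induction with
  | zero => simp [hw0]
  | single_add p k f hp hk ih =>
    have hfp : f p = 0 := by simpa using hp
    have hpow : ∀ j, w (Finsupp.single p j) = w (Finsupp.single p 1) ^ j := by
      intro j
      induction j with
      | zero => simp [hw0]
      | succ j ih => rw [Finsupp.single_add, hmul, ih, pow_succ]
    have key : ∑ J ∈ Finset.Icc 0 (Finsupp.single p k + f), w J =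
        (∑ j ∈ Finset.range (k + 1), w (Finsupp.single p 1) ^ j) * ∑ J ∈ Finset.Icc 0 f, w J := by
      rw [Finset.sum_mul_sum, ← Finset.sum_product']
      refine Finset.sum_nbij' (fun J => (J p, J.erase p)) (fun q => Finsupp.single p q.1 + q.2) ?_ ?_ ?_ ?_ ?_
      · intro J hJ
        simp only [Finset.mem_Icc, zero_le, true_and] at hJ
        simp only [Finset.mem_product, Finset.mem_range, Finset.mem_Icc, zero_le, true_and]
        refine ⟨?_, ?_⟩
        · have := hJ p; simp [hfp] at this; omega
        · intro r
          by_cases hr : r = p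
          · subst hr; simp
          · have := hJ r
            rw [Finsupp.erase_ne hr]
            simpa [Finsupp.single_apply, Ne.symm hr] using this
      · rintro ⟨j, J⟩ hJ
        simp only [Finset.mem_product, Finset.mem_range, Finset.mem_Icc, zero_le, true_and] at hJ ⊢
        exact add_le_add (Finsupp.single_mono (by omega)) hJ.2
      · intro J _; exact Finsupp.single_add_erase p J
      · rintro ⟨j, J⟩ hJ
        simp only [Finset.mem_product, Finset.mem_range, Finset.mem_Icc, zero_le, true_and] at hJ ⊢
        have hJp : J p = 0 := by have := hJ.2 p; omega
        simp only [Finsupp.add_apply, Finsupp.single_eq_same, hJp, add_zero, Finsupp.erase_add, Finsupp.erase_single, zero_add]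
        rw [Finsupp.erase_of_notMem_support]; simpa using hJp
      · intro J _
        rw [← hpow, ← hmul, Finsupp.single_add_erase]
    rw [key]
    have h1 := geom_pm (hpm (Finsupp.single p 1)) k
    refine ⟨mul_nonneg h1.1 ih.1, fun he => ?_⟩
    have hek : Even k := by have := he p; simpa [hfp] using this
    have hef : ∀ r, Even (f r) := by
      intro r
      by_cases hr : r = p
      · subst hr; simp [hfp]
      · have := he r; simpa [Finsupp.single_apply, Ne.symm hr] using this
    exact one_le_mul_of_one_le_of_one_le (h1.2 hek) (ih.2 hef)

noncomputable def Phi (ψ : ℝ → ℝ) (y : ℝ) : ℝ := ∫ v in Ioi (0:ℝ), ψ (y / v) * ψ v / v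

include hψ in
lemma Phi_nonneg (y : ℝ) : 0 ≤ Phi ψ y := by
  unfold Phi
  apply setIntegral_nonneg measurableSet_Ioi
  intro v hv
  have : 0 < v := hv
  have := hψ.nonneg (y / v); have := hψ.nonneg v
  positivity

include hψ in
lemma Phi_zero {y : ℝ} (hy : y ≤ a * a) : Phi ψ y = 0 := by
  unfold Phi
  apply setIntegral_eq_zero_of_forall_eq_zero
  intro v hv
  have hv : 0 < v := hv
  have ha := hψ.a_pos
  show ψ (y / v) * ψ v / v = 0
  by_cases h : v ≤ a
  · rw [hψ.zero_a v h]; simp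
  · rw [hψ.zero_a (y / v)]; · simp
    rw [div_le_iff₀ hv]
    push Not at h; nlinarith

include hψ in
lemma conv_int (y : ℝ) (A B : ℝ) (hA : 0 < A) (hB : 0 < B) :
    IntegrableOn (fun v => ψ (y / v / A) * ψ (v / B) / v) (Ioi 0) ∧
    ∫ v in Ioi (0:ℝ), ψ (y / v / A) * ψ (v / B) / v = Phi ψ (y / (A * B)) := by
  have ha := hψ.a_pos
  constructor
  · obtain ⟨C, hC0, hC⟩ := hψ.bdd
    have hsup : ∀ v ∈ Ioi (0:ℝ), v ∉ Icc (a * B) (max (b * B) (a * B)) → ψ (y / v / A) * ψ (v / B) / v = 0 := by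
      intro v hv hv2
      have : ψ (v / B) = 0 := by
        by_cases h : v ≤ a * B
        · exact hψ.zero_a _ (by rwa [div_le_iff₀ hB])
        · apply hψ.zero_b
          rw [le_div_iff₀ hB]
          by_contra h2
          apply hv2
          push Not at h h2
          exact ⟨h.le, h2.le.trans (le_max_left _ _)⟩
      simp [this]
    have hsub : Icc (a * B) (max (b * B) (a * B)) ⊆ Ioi 0 := fun v hv =>
      lt_of_lt_of_le (by positivity : 0 < a * B) hv.1
    refine (IntegrableOn.of_forall_sdiff_eq_zero (s := Icc (a * B) (max (b * B) (a * B))) ?_ measurableSet_Ioi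
      fun v hv => hsup v hv.1 hv.2)
    apply ContinuousOn.integrableOn_compact isCompact_Icc
    have hne : ∀ v ∈ Icc (a * B) (max (b * B) (a * B)), v ≠ 0 := fun v hv => (hsub hv).ne'
    have hc := hψ.cont
    refine ContinuousOn.div (ContinuousOn.mul (hc.comp_continuousOn ?_) (hc.comp_continuousOn ?_)) continuousOn_id hne
    · exact (continuousOn_const.div continuousOn_id hne).div_const _
    · exact continuousOn_id.div_const _
  · have := integral_comp_mul_left_Ioi (fun v => ψ (y / v / A) * ψ (v / B) / v) 0 hB
    rw [mul_zero] at this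
    rw [smul_eq_mul, inv_mul_eq_div, eq_div_iff hB.ne'] at this
    rw [← this, mul_comm, ← integral_const_mul]
    unfold Phi
    apply setIntegral_congr_fun measurableSet_Ioi
    intro v hv
    have hv : 0 < v := hv
    simp only
    have e1 : y / (B * v) / A = y / (A * B) / v := by field_simp
    have e2 : B * v / B = v := by field_simp
    rw [e1, e2]; field_simp

noncomputable def TT (N : ι → ℕ) (ψ : ℝ → ℝ) (w : (ι →₀ ℕ) → ℝ) (x : ℝ) : ℂ :=
  ∫ v in Ioi (0:ℝ), SS N ψ (fun _ => 1) (x / v) * SS N ψ (fun m => (w m : ℂ)) v / v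

include hN hψ in
lemma TT_eq [DecidableEq ι] (w : (ι →₀ ℕ) → ℝ) {x : ℝ} (hx : 0 < x) :
    TT N ψ w x = ((∑ K ∈ (hfin (x / a / a)).toFinset, Phi ψ (x / nm N K) * ∑ J ∈ Finset.Icc 0 K, w J : ℝ) : ℂ) := by
  set F := (hfin (x / a / a)).toFinset with hF
  have ha := hψ.a_pos
  have h1 : ∀ v ∈ Ioi (0:ℝ), SS N ψ (fun _ => 1) (x / v) * SS N ψ (fun m => (w m : ℂ)) v / v =
      ((∑ I ∈ F, ∑ J ∈ F, w J * (ψ (x / v / nm N I) * ψ (v / nm N J) / v) : ℝ) : ℂ) := by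
    intro v hv
    have hv : 0 < v := hv
    have hgen : ((∑ I ∈ F, ∑ J ∈ F, w J * (ψ (x / v / nm N I) * ψ (v / nm N J) / v) : ℝ) : ℂ) =
      (∑ I ∈ F, 1 * (ψ (x / v / nm N I) : ℂ)) * (∑ J ∈ F, (w J : ℂ) * (ψ (v / nm N J) : ℂ)) / v := by
      rw [Finset.sum_mul_sum, Finset.sum_div]
      push_cast
      refine Finset.sum_congr rfl fun I _ => ?_
      rw [Finset.sum_div]
      refine Finset.sum_congr rfl fun J _ => ?_
      ring
    rw [hgen]
    by_cases h2 : v ≤ a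
    · rw [SS_zero hN hψ _ h2, Finset.sum_eq_zero (s := F) (f := fun J => (w J : ℂ) * (ψ (v / nm N J) : ℂ))]
      · simp
      intro J _
      rw [hψ.zero_a]; · simp
      rw [div_le_iff₀ (nm_pos hN J)]
      nlinarith [one_le_nm hN J]
    · push Not at h2
      rw [SS_eq_sum hN hfin hψ _ (X := x / a) (by gcongr)]
      by_cases h3 : v ≤ x / a
      · rw [SS_eq_sum hN hfin hψ _ h3]
      · push Not at h3
        have h4 : x / v ≤ a := by
          rw [div_le_iff₀ hv]; rw [div_lt_iff₀ ha] at h3; linarith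
        rw [← hF, Finset.sum_eq_zero (s := F) (f := fun J => 1 * (ψ (x / v / nm N J) : ℂ))]; · simp
        intro J _
        rw [hψ.zero_a]; · simp
        rw [div_le_iff₀ (nm_pos hN J)]
        nlinarith [one_le_nm hN J]
  unfold TT
  rw [setIntegral_congr_fun measurableSet_Ioi h1, integral_complex_ofReal]
  congr 1
  have hi := fun I J : ι →₀ ℕ => conv_int hψ x (nm N I) (nm N J) (nm_pos hN I) (nm_pos hN J)
  rw [integral_finsetSum _ (fun I _ => integrable_finsetSum _ fun J _ => (hi I J).1.const_mul _)]
  have h2 : ∀ I ∈ F, ∫ v in Ioi (0:ℝ), ∑ J ∈ F, w J * (ψ (x / v / nm N I) * ψ (v / nm N J) / v) =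
      ∑ J ∈ F, w J * Phi ψ (x / nm N (I + J)) := by
    intro I _
    rw [integral_finsetSum _ (fun J _ => (hi I J).1.const_mul _)]
    refine Finset.sum_congr rfl fun J _ => ?_
    rw [integral_const_mul, (hi I J).2, nm_add]
  rw [Finset.sum_congr rfl h2]
  simp_rw [Finset.mul_sum]
  rw [← Finset.sum_product', Finset.sum_sigma']
  have h3 : ∑ q ∈ F ×ˢ F, w q.2 * Phi ψ (x / nm N (q.1 + q.2)) =
      ∑ q ∈ (F ×ˢ F).filter (fun q => q.1 + q.2 ∈ F), w q.2 * Phi ψ (x / nm N (q.1 + q.2)) := by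
    refine (Finset.sum_filter_of_ne ?_).symm
    intro q _ hq
    by_contra hn
    apply hq
    rw [hF, Set.Finite.mem_toFinset, mem_ofPred_eq] at hn
    push Not at hn
    rw [Phi_zero hψ, mul_zero]
    rw [div_le_iff₀ (nm_pos hN _)]
    rw [div_div, div_lt_iff₀ (by positivity)] at hn
    linarith
  rw [h3]
  refine Finset.sum_nbij' (fun q => ⟨q.1 + q.2, q.2⟩) (fun q => (q.1 - q.2, q.2)) ?_ ?_ ?_ ?_ ?_
  · rintro ⟨I, J⟩ h
    simp only [Finset.mem_filter, Finset.mem_product, Finset.mem_sigma, Finset.mem_Icc, zero_le, true_and] at h ⊢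
    exact ⟨h.2, by simp⟩
  · rintro ⟨K, J⟩ h
    simp only [Finset.mem_filter, Finset.mem_product, Finset.mem_sigma, Finset.mem_Icc, zero_le, true_and] at h ⊢
    have hKJ : K - J + J = K := tsub_add_cancel_of_le h.2
    have hK := h.1
    rw [hF, Set.Finite.mem_toFinset, mem_ofPred_eq] at hK
    have hn := nm_add N (K - J) J
    rw [hKJ] at hn
    have := one_le_nm hN (K - J)
    have := one_le_nm hN J
    refine ⟨⟨?_, ?_⟩, by rw [hKJ]; exact h.1⟩ <;>
    · rw [hF, Set.Finite.mem_toFinset, mem_ofPred_eq]; nlinarith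
  · rintro ⟨I, J⟩ h; simp
  · rintro ⟨K, J⟩ h
    simp only [Finset.mem_sigma, Finset.mem_Icc, zero_le, true_and] at h
    simp only [tsub_add_cancel_of_le h.2]
  · rintro ⟨I, J⟩ h; simp only; ring

end PartA5
end OrdPf

namespace OrdPf
open Filter Topology MeasureTheory Set

section PartA6
variable {ι : Type*}
variable {N : ι → ℕ} (hN : ∀ p, 2 ≤ N p) (hfin : ∀ X : ℝ, {m | nm N m ≤ X}.Finite)
  {ψ : ℝ → ℝ} {a b : ℝ} (hψ : TestFn ψ a b)

include hN hfin hψ in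
lemma TT_upper (w : (ι →₀ ℕ) → ℝ) (κ : ℂ)
    (h1 : ∃ C, ∀ x : ℝ, 1 ≤ x → ‖SS N ψ (fun _ => 1) x - κ * x‖ ≤ C)
    (hχ : ∃ C, ∀ x : ℝ, 1 ≤ x → ‖SS N ψ (fun m => (w m : ℂ)) x - 0 * x‖ ≤ C)
    (hz : mellin (EE N ψ (fun m => (w m : ℂ)) 0) (-1) = 0) :
    ∃ A B : ℝ, 0 ≤ A ∧ 0 ≤ B ∧ ∀ x : ℝ, 1 ≤ x → ‖TT N ψ w x‖ ≤ A + B * Real.log x := by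
  have ha := hψ.a_pos
  have hEE : EE N ψ (fun m => (w m : ℂ)) 0 = SS N ψ (fun m => (w m : ℂ)) := by
    ext x; simp [EE, indicator]
  obtain ⟨Cχ, hCχ⟩ := EE_bound hN hfin hψ _ 0 hχ
  have hconv := (EE_mellin hN hfin hψ _ 0 hχ (s := 1) (by simp)).1
  rw [hEE] at hz hCχ hconv
  set S1 := SS N ψ (fun _ => (1:ℂ)) with hS1
  set Sχ := SS N ψ (fun m => (w m : ℂ)) with hSχ
  have hS1c : Continuous S1 := SS_cont hN hfin hψ _
  have hSχc : Continuous Sχ := SS_cont hN hfin hψ _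
  have hCχ0 : 0 ≤ Cχ := (norm_nonneg _).trans (hCχ 0)
  have he : ∃ C1, 0 ≤ C1 ∧ ∀ y : ℝ, 0 ≤ y → ‖S1 y - κ * y‖ ≤ C1 := by
    obtain ⟨C, hC⟩ := h1
    obtain ⟨C', hC'⟩ := SS_bound hN hfin hψ (fun _ => 1) 1
    refine ⟨max C (C' + ‖κ‖), le_max_of_le_left ((norm_nonneg _).trans (hC 1 le_rfl)), fun y hy => ?_⟩
    by_cases hy1 : 1 ≤ y
    · exact (hC y hy1).trans (le_max_left _ _)
    · push Not at hy1
      refine le_trans ?_ (le_max_right _ _)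
      refine (norm_sub_le _ _).trans (add_le_add (hC' y hy1.le) ?_)
      rw [norm_mul, Complex.norm_real, Real.norm_eq_abs, abs_of_nonneg hy]
      exact mul_le_of_le_one_right (norm_nonneg _) hy1.le
  obtain ⟨C1, hC10, hC1⟩ := he
  have hm : ∀ t : ℝ, (t:ℂ) ^ ((-1:ℂ) - 1) • Sχ t = Sχ t / (t:ℂ)^2 := by
    intro t
    have : (-1:ℂ) - 1 = ((-2:ℤ):ℂ) := by norm_num
    rw [this, Complex.cpow_intCast, smul_eq_mul, zpow_neg, mul_comm, div_eq_mul_inv]; norm_cast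
  have hinteg : IntegrableOn (fun t : ℝ => Sχ t / (t:ℂ)^2) (Ioi 0) := by
    refine (integrableOn_congr_fun (fun t _ => hm t) measurableSet_Ioi).1 hconv
  have hz' : ∫ t in Ioi (0:ℝ), Sχ t / (t:ℂ)^2 = 0 := by
    rw [← hz]; unfold mellin; exact setIntegral_congr_fun measurableSet_Ioi (fun t _ => (hm t).symm)
  refine ⟨‖κ‖ * Cχ * a + C1 * Cχ * Real.log (1 / a / a), C1 * Cχ, ?_, by positivity, fun x hx => ?_⟩
  · have : 0 ≤ Real.log (1 / a / a) := by
      apply Real.log_nonneg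
      have := hψ.a_le
      rw [div_div, le_div_iff₀ (by positivity)]; nlinarith
    positivity
  have hx0 : 0 < x := by linarith
  set X := x / a with hX
  have hXa : a ≤ X := by
    rw [hX, le_div_iff₀ ha]; have := hψ.a_le; nlinarith
  have hX0 : 0 < X := by positivity
  have hsplit : TT N ψ w x = ∫ v in Ioc a X, (κ * x * (Sχ v / (v:ℂ)^2) + (S1 (x / v) - κ * ((x / v : ℝ) : ℂ)) * (Sχ v / v)) := by
    unfold TT
    rw [← hS1, ← hSχ, setIntegral_eq_of_subset_of_forall_diff_eq_zero (s := Ioc a X) measurableSet_Ioi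
      (fun v hv => lt_trans ha hv.1)]
    · apply setIntegral_congr_fun measurableSet_Ioc
      intro v hv
      have hv0 : (v:ℂ) ≠ 0 := by exact_mod_cast (ha.trans hv.1).ne'
      simp only
      push_cast
      field_simp
      ring
    · rintro v ⟨hv0, hv⟩
      have hv0 : 0 < v := hv0
      rw [mem_Ioc, not_and_or, not_lt, not_le] at hv
      rcases hv with hv | hv
      · rw [hSχ, SS_zero hN hψ _ hv]; simp
      · rw [hS1, SS_zero hN hψ (fun _ => 1) (x := x / v)]; · simp
        rw [div_le_iff₀ hv0]; rw [hX, div_lt_iff₀ ha] at hv; linarith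
  have hsub : Ioc a X ⊆ Ioi 0 := fun v hv => lt_trans ha hv.1
  have hi1 : IntegrableOn (fun v : ℝ => κ * x * (Sχ v / (v:ℂ)^2)) (Ioc a X) := (hinteg.mono_set hsub).const_mul _
  have hi2 : IntegrableOn (fun v : ℝ => (S1 (x / v) - κ * ((x / v : ℝ) : ℂ)) * (Sχ v / v)) (Ioc a X) := by
    apply IntegrableOn.mono_set _ Ioc_subset_Icc_self
    apply ContinuousOn.integrableOn_compact isCompact_Icc
    have hne : ∀ v ∈ Icc a X, v ≠ 0 := fun v hv => (lt_of_lt_of_le ha hv.1).ne'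
    have hd : ContinuousOn (fun v : ℝ => x / v) (Icc a X) := continuousOn_const.div continuousOn_id hne
    refine ContinuousOn.mul (ContinuousOn.sub (hS1c.comp_continuousOn hd) (continuousOn_const.mul (Complex.continuous_ofReal.comp_continuousOn hd)))
      (ContinuousOn.div hSχc.continuousOn Complex.continuous_ofReal.continuousOn fun v hv => by exact_mod_cast hne v hv)
  rw [hsplit, integral_add hi1 hi2]
  have hb1 : ‖∫ v in Ioc a X, κ * x * (Sχ v / (v:ℂ)^2)‖ ≤ ‖κ‖ * Cχ * a := by
    rw [integral_const_mul]
    have e1 : ∫ v in Ioc a X, (Sχ v / (v:ℂ)^2) = - ∫ v in Ioi X, Sχ v / (v:ℂ)^2 := by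
      have e2 : ∫ t in Ioi (0:ℝ), Sχ t / (t:ℂ)^2 = ∫ t in Ioi a, Sχ t / (t:ℂ)^2 := by
        apply setIntegral_eq_of_subset_of_forall_diff_eq_zero measurableSet_Ioi (Ioi_subset_Ioi ha.le)
        rintro v ⟨_, hv⟩
        rw [mem_Ioi, not_lt] at hv
        rw [hSχ, SS_zero hN hψ _ hv]; simp
      have e3 : ∫ t in Ioi a, Sχ t / (t:ℂ)^2 = (∫ t in Ioc a X, Sχ t / (t:ℂ)^2) + ∫ t in Ioi X, Sχ t / (t:ℂ)^2 := by
        rw [← Ioc_union_Ioi_eq_Ioi hXa]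
        apply setIntegral_union (Ioc_disjoint_Ioi le_rfl) measurableSet_Ioi (hinteg.mono_set hsub)
          (hinteg.mono_set (Ioi_subset_Ioi hX0.le))
      rw [hz', e3] at e2
      exact eq_neg_of_add_eq_zero_left e2.symm
    rw [e1, norm_mul, norm_neg, norm_mul, Complex.norm_real, Real.norm_eq_abs, abs_of_pos hx0]
    have e4 : ‖∫ v in Ioi X, Sχ v / (v:ℂ)^2‖ ≤ Cχ * (1 / X) := by
      have hI : IntegrableOn (fun v : ℝ => v ^ (-2:ℝ)) (Ioi X) := integrableOn_Ioi_rpow_of_lt (by norm_num) hX0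
      have hv : ∫ v in Ioi X, v ^ (-2:ℝ) = 1 / X := by
        rw [integral_Ioi_rpow_of_lt (by norm_num) hX0]
        norm_num
        rw [Real.rpow_neg_one]
      rw [← hv, ← integral_const_mul]
      apply norm_integral_le_of_norm_le (hI.const_mul _)
      rw [ae_restrict_iff' measurableSet_Ioi]
      refine Eventually.of_forall fun v hv => ?_
      have hv0 : 0 < v := hX0.trans hv
      rw [norm_div, norm_pow, Complex.norm_real, Real.norm_eq_abs, abs_of_pos hv0, Real.rpow_neg hv0.le,
        div_eq_mul_inv]
      norm_num
      gcongr
      exact hCχ v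
    calc ‖κ‖ * x * ‖∫ v in Ioi X, Sχ v / (v:ℂ)^2‖ ≤ ‖κ‖ * x * (Cχ * (1 / X)) := by gcongr
      _ = ‖κ‖ * Cχ * a := by rw [hX]; field_simp
  have hb2 : ‖∫ v in Ioc a X, (S1 (x / v) - κ * ((x / v : ℝ) : ℂ)) * (Sχ v / v)‖ ≤ C1 * Cχ * Real.log (X / a) := by
    have hI : IntegrableOn (fun v : ℝ => v⁻¹) (Ioc a X) := by
      apply IntegrableOn.mono_set _ Ioc_subset_Icc_self
      apply ContinuousOn.integrableOn_compact isCompact_Icc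
      exact continuousOn_id.inv₀ fun v hv => (lt_of_lt_of_le ha hv.1).ne'
    have hv : ∫ v in Ioc a X, v⁻¹ = Real.log (X / a) := by
      rw [← intervalIntegral.integral_of_le hXa, integral_inv_of_pos ha hX0]
    rw [← hv, ← integral_const_mul]
    apply norm_integral_le_of_norm_le (hI.const_mul _)
    rw [ae_restrict_iff' measurableSet_Ioc]
    refine Eventually.of_forall fun v hv => ?_
    have hv0 : 0 < v := ha.trans hv.1
    rw [norm_mul, norm_div, Complex.norm_real, Real.norm_eq_abs, abs_of_pos hv0, mul_assoc, ← div_eq_mul_inv]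
    have := hC1 (x / v) (by positivity)
    have := hCχ v
    gcongr
  have hlog : Real.log (X / a) = Real.log (1 / a / a) + Real.log x := by
    rw [← Real.log_mul (by positivity) (by positivity)]
    congr 1; rw [hX]; ring
  refine (norm_add_le _ _).trans ?_
  rw [hlog] at hb2
  linarith

include hN hfin hψ in
lemma TT_lower (w : (ι →₀ ℕ) → ℝ) (hpm : ∀ m, w m = 1 ∨ w m = -1) (hw0 : w 0 = 1)
    (hmul : ∀ m n, w (m + n) = w m * w n)
    {ψ0 : ℝ → ℝ} {a0 b0 : ℝ} (hψ0 : TestFn ψ0 a0 b0) {c : ℝ} (hc : 0 < c)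
    (hΦ : ∀ u : ℝ, 0 < u → c * ψ0 u ≤ Phi ψ (u ^ 2)) {y : ℝ} (hy : 0 < y) :
    c * ‖SS N ψ0 (fun _ => 1) y‖ ≤ ‖TT N ψ w (y ^ 2)‖ := by
  classical
  have hx : 0 < y ^ 2 := by positivity
  rw [TT_eq hN hfin hψ w hx, Complex.norm_real, SS_eq_sum hN hfin hψ0 _ (le_refl y)]
  set F := (hfin (y ^ 2 / a / a)).toFinset with hF
  set F0 := (hfin (y / a0)).toFinset with hF0
  have ha := hψ.a_pos
  have e1 : ∑ m ∈ F0, 1 * (ψ0 (y / nm N m) : ℂ) = ((∑ m ∈ F0, ψ0 (y / nm N m) : ℝ) : ℂ) := by push_cast; simp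
  rw [e1, Complex.norm_real, Real.norm_eq_abs, abs_of_nonneg (Finset.sum_nonneg fun m _ => hψ0.nonneg _)]
  refine le_trans ?_ (le_abs_self _)
  rw [Finset.mul_sum]
  have hpos := fun K => conv_pos w hpm hw0 hmul K
  have hPhi : ∀ L, c * ψ0 (y / nm N L) ≤ Phi ψ (y ^ 2 / nm N (2 • L)) := by
    intro L
    refine (hΦ _ (div_pos hy (nm_pos hN L))).trans (le_of_eq ?_)
    rw [two_nsmul, nm_add]; congr 1; have := (nm_pos hN L).ne'; field_simp
  have hinj : Function.Injective fun L : ι →₀ ℕ => 2 • L := by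
    intro L L' h
    ext p
    have := DFunLike.congr_fun h p
    simpa using this
  calc ∑ L ∈ F0, c * ψ0 (y / nm N L) = ∑ L ∈ F0.filter (fun L => 2 • L ∈ F), c * ψ0 (y / nm N L) := by
        refine (Finset.sum_filter_of_ne ?_).symm
        intro L _ hL
        by_contra hn
        rw [hF, Set.Finite.mem_toFinset, mem_ofPred_eq] at hn
        push Not at hn
        have h3 := hPhi L
        rw [Phi_zero hψ] at h3
        · exact hL (le_antisymm h3 (mul_nonneg hc.le (hψ0.nonneg _)))
        rw [div_le_iff₀ (nm_pos hN _)]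
        rw [div_div, div_lt_iff₀ (by positivity)] at hn
        linarith
    _ ≤ ∑ L ∈ F0.filter (fun L => 2 • L ∈ F), Phi ψ (y ^ 2 / nm N (2 • L)) * ∑ J ∈ Finset.Icc 0 (2 • L), w J := by
        refine Finset.sum_le_sum fun L _ => (hPhi L).trans ?_
        refine le_mul_of_one_le_right (Phi_nonneg hψ _) ((hpos _).2 fun p => ?_)
        simp
    _ = ∑ K ∈ (F0.filter (fun L => 2 • L ∈ F)).image (fun L => 2 • L), Phi ψ (y ^ 2 / nm N K) * ∑ J ∈ Finset.Icc 0 K, w J := by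
        rw [Finset.sum_image hinj.injOn]
    _ ≤ _ := by
        refine Finset.sum_le_sum_of_subset_of_nonneg ?_ fun K _ _ => mul_nonneg (Phi_nonneg hψ _) (hpos K).1
        intro K hK
        obtain ⟨L, hL, rfl⟩ := Finset.mem_image.1 hK
        exact (Finset.mem_filter.1 hL).2

include hN hfin hψ in
lemma quad_nonvanish (w : (ι →₀ ℕ) → ℝ) (hpm : ∀ m, w m = 1 ∨ w m = -1) (hw0 : w 0 = 1)
    (hmul : ∀ m n, w (m + n) = w m * w n) (κ : ℂ)
    (h1 : ∃ C, ∀ x : ℝ, 1 ≤ x → ‖SS N ψ (fun _ => 1) x - κ * x‖ ≤ C)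
    (hχ : ∃ C, ∀ x : ℝ, 1 ≤ x → ‖SS N ψ (fun m => (w m : ℂ)) x - 0 * x‖ ≤ C)
    {ψ0 : ℝ → ℝ} {a0 b0 : ℝ} (hψ0 : TestFn ψ0 a0 b0) {c : ℝ} (hc : 0 < c)
    (hΦ : ∀ u : ℝ, 0 < u → c * ψ0 u ≤ Phi ψ (u ^ 2)) (κ0 : ℂ) (hκ0 : κ0 ≠ 0)
    (h0 : ∃ C, ∀ x : ℝ, 1 ≤ x → ‖SS N ψ0 (fun _ => 1) x - κ0 * x‖ ≤ C) :
    mellin (EE N ψ (fun m => (w m : ℂ)) 0) (-1) ≠ 0 := by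
  intro hz
  obtain ⟨A, B, hA, hB, hAB⟩ := TT_upper hN hfin hψ w κ h1 hχ hz
  obtain ⟨C0, hC0⟩ := h0
  have hC00 : 0 ≤ C0 := (norm_nonneg _).trans (hC0 1 le_rfl)
  have hk : 0 < ‖κ0‖ := norm_pos_iff.2 hκ0
  have key : ∀ y : ℝ, 1 ≤ y → c * (‖κ0‖ * y ^ 2 - C0) ≤ A + B * (4 * y) := by
    intro y hy
    have hy2 : 1 ≤ y ^ 2 := one_le_pow₀ hy
    have l := TT_lower hN hfin hψ w hpm hw0 hmul hψ0 hc hΦ (y := y ^ 2) (by positivity)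
    have u := hAB ((y ^ 2) ^ 2) (one_le_pow₀ hy2)
    have e := hC0 (y ^ 2) hy2
    have hn : ‖κ0‖ * y ^ 2 - C0 ≤ ‖SS N ψ0 (fun _ => 1) (y ^ 2)‖ := by
      have : ‖κ0 * ((y ^ 2 : ℝ) : ℂ)‖ = ‖κ0‖ * y ^ 2 := by
        rw [norm_mul, Complex.norm_real, Real.norm_eq_abs, abs_of_nonneg (by positivity)]
      rw [← this]
      have := norm_sub_norm_le (κ0 * ((y ^ 2 : ℝ) : ℂ)) (SS N ψ0 (fun _ => 1) (y ^ 2))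
      rw [norm_sub_rev] at e
      linarith
    have hl : Real.log ((y ^ 2) ^ 2) ≤ 4 * y := by
      rw [Real.log_pow, Real.log_pow]; push_cast
      have := Real.log_le_sub_one_of_pos (show 0 < y by linarith)
      linarith
    calc _ ≤ c * ‖SS N ψ0 (fun _ => 1) (y ^ 2)‖ := by gcongr
      _ ≤ _ := l
      _ ≤ _ := u
      _ ≤ _ := by gcongr
  set y := 1 + (A + c * C0 + 4 * B) / (c * ‖κ0‖) with hy
  have hy1 : 1 ≤ y := by rw [hy]; simp; positivity
  have h2 := key y hy1
  have h3 : c * ‖κ0‖ * y = c * ‖κ0‖ + (A + c * C0 + 4 * B) := by rw [hy]; field_simp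
  have h4 : c * ‖κ0‖ * y ^ 2 = (c * ‖κ0‖ + (A + c * C0 + 4 * B)) * y := by rw [← h3]; ring
  have h5 : 0 < c * ‖κ0‖ := by positivity
  have h6 : 0 ≤ c * C0 := by positivity
  nlinarith [mul_le_mul_of_nonneg_left hy1 (show 0 ≤ A + c * C0 by positivity)]

end PartA6
end OrdPf

namespace OrdPf
open Filter Topology MeasureTheory Set

section PartA7

lemma exists_bumps : ∃ (ψ ψ0 : ℝ → ℝ) (a b a0 b0 c : ℝ), TestFn ψ a b ∧ TestFn ψ0 a0 b0 ∧
    ContDiff ℝ ((⊤ : ℕ∞) : WithTop ℕ∞) ψ ∧ ContDiff ℝ ((⊤ : ℕ∞) : WithTop ℕ∞) ψ0 ∧ 0 < c ∧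
    ∀ u : ℝ, 0 < u → c * ψ0 u ≤ Phi ψ (u ^ 2) := by
  let f : ContDiffBump (1:ℝ) := ⟨1/4, 1/2, by norm_num, by norm_num⟩
  let f0 : ContDiffBump (1:ℝ) := ⟨1/16, 1/8, by norm_num, by norm_num⟩
  have h1 : TestFn f (1/2) (3/2) := by
    refine ⟨f.continuous, fun x => f.nonneg, by norm_num, by norm_num, fun x hx => ?_, fun x hx => ?_, ?_⟩
    · apply f.zero_of_le_dist
      show (1/2:ℝ) ≤ _
      rw [Real.dist_eq, abs_of_nonpos] <;> linarith
    · apply f.zero_of_le_dist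
      show (1/2:ℝ) ≤ _
      rw [Real.dist_eq, abs_of_nonneg] <;> linarith
    · apply f.pos_of_mem_ball
      show dist (1:ℝ) 1 < 1/2
      simp
  have h0z : ∀ x, ¬ (7/8 < x ∧ x < 9/8) → f0 x = 0 := by
    intro x hx
    apply f0.zero_of_le_dist
    show (1/8:ℝ) ≤ _
    rw [Real.dist_eq]
    by_contra h
    push Not at h
    rw [abs_lt] at h
    exact hx ⟨by linarith, by linarith⟩
  have h2 : TestFn f0 (7/8) (9/8) := by
    refine ⟨f0.continuous, fun x => f0.nonneg, by norm_num, by norm_num, fun x hx => ?_, fun x hx => ?_, ?_⟩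
    · exact h0z x (by rintro ⟨h, -⟩; linarith)
    · exact h0z x (by rintro ⟨-, h⟩; linarith)
    · apply f0.pos_of_mem_ball
      show dist (1:ℝ) 1 < 1/8
      simp
  refine ⟨f, f0, _, _, _, _, 7/90, h1, h2, f.contDiff, f0.contDiff, by norm_num, fun u hu => ?_⟩
  by_cases hu2 : 7/8 < u ∧ u < 9/8
  swap
  · rw [h0z u hu2, mul_zero]; exact Phi_nonneg h1 _
  obtain ⟨hu3, hu4⟩ := hu2
  have hle : f0 u ≤ 1 := f0.le_one
  have hI := (conv_int h1 (u ^ 2) 1 1 one_pos one_pos).1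
  simp only [div_one] at hI
  have hsub : Icc u (10/9*u) ⊆ Ioi (0:ℝ) := fun v hv => lt_of_lt_of_le hu hv.1
  have hf1 : ∀ v, 3/4 ≤ v → v ≤ 5/4 → f v = 1 := by
    intro v h1 h2
    apply f.one_of_mem_closedBall
    show dist v 1 ≤ 1/4
    rw [Real.dist_eq, abs_le]; constructor <;> linarith
  have hone : ∀ v ∈ Icc u (10/9*u), (4/5:ℝ) ≤ f (u^2 / v) * f v / v := by
    intro v hv
    have hv0 : 0 < v := hsub hv
    have hv1 := hv.1
    have hv2 := hv.2
    rw [hf1 v (by linarith) (by linarith), hf1 (u^2/v)]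
    · rw [one_mul, div_le_div_iff₀ (by norm_num) hv0]; linarith
    · rw [le_div_iff₀ hv0]; nlinarith
    · rw [div_le_iff₀ hv0]; nlinarith
  calc 7/90 * f0 u ≤ 7/90 := by linarith
    _ ≤ ∫ v in Icc u (10/9*u), (4/5:ℝ) := by
      rw [setIntegral_const]
      simp only [Measure.real, Real.volume_Icc, smul_eq_mul]
      rw [ENNReal.toReal_ofReal (by linarith)]
      linarith
    _ ≤ ∫ v in Icc u (10/9*u), f (u^2 / v) * f v / v := by
      apply setIntegral_mono_on _ (hI.mono_set hsub) measurableSet_Icc hone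
      exact integrableOn_const (by simp)
    _ ≤ Phi f (u^2) := by
      unfold Phi
      apply setIntegral_mono_set hI
      · rw [EventuallyLE, ae_restrict_iff' measurableSet_Ioi]
        refine Eventually.of_forall fun v hv => ?_
        have hv : 0 < v := hv
        have := h1.nonneg v; have := h1.nonneg (u^2 / v)
        simp only [Pi.zero_apply]; positivity
      · exact Eventually.of_forall hsub

variable {ι : Type*}
variable {N : ι → ℕ} (hN : ∀ p, 2 ≤ N p) (hfin : ∀ X : ℝ, {m | nm N m ≤ X}.Finite)

lemma pp_inj : Function.Injective (pp : ι × ℕ → (ι →₀ ℕ)) := by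
  rintro ⟨p, k⟩ ⟨p', k'⟩ h
  unfold pp at h
  simp only at h
  rw [Finsupp.single_eq_single_iff] at h
  simp at h
  ext <;> simp [h]

include hN in
lemma pp_summable (hsum : ∀ σ : ℝ, 1 < σ → Summable fun m => (nm N m) ^ (-σ)) {σ : ℝ} (hσ : 1 < σ) :
    Summable fun q : ι × ℕ => Real.log (N q.1) * (nm N (pp q)) ^ (-σ) := by
  refine Summable.of_nonneg_of_le (fun q => ?_) (fun q => ?_) ((log_summable hN hsum hσ).comp_injective pp_inj)
  · have : (1:ℝ) ≤ N q.1 := by exact_mod_cast (by have := hN q.1; omega)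
    exact mul_nonneg (Real.log_nonneg this) (Real.rpow_nonneg (nm_pos hN _).le _)
  · have : (1:ℝ) ≤ N q.1 := by exact_mod_cast (by have := hN q.1; omega)
    simp only [Function.comp]
    have h2 := Real.rpow_nonneg (nm_pos hN (pp q)).le (-σ)
    gcongr
    unfold pp; rw [nm_single, pow_succ]
    exact le_mul_of_one_le_left (by linarith) (one_le_pow₀ this)

noncomputable def DD {G : Type*} [DecidableEq G] (N : ι → ℕ) (cl : (ι →₀ ℕ) → G) (g : G) (x : ℝ) : ℝ :=
  ∑' q : ι × ℕ, if cl (pp q) = g then Real.log (N q.1) * (nm N (pp q)) ^ (-x) else 0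

include hN in
lemma DD_nonneg {G : Type*} [DecidableEq G] (cl : (ι →₀ ℕ) → G) (g : G) (x : ℝ) : 0 ≤ DD N cl g x := by
  apply tsum_nonneg
  intro q
  split_ifs
  · have : (1:ℝ) ≤ N q.1 := by exact_mod_cast (by have := hN q.1; omega)
    exact mul_nonneg (Real.log_nonneg this) (Real.rpow_nonneg (nm_pos hN _).le _)
  · exact le_rfl

include hN in
lemma DD_bound (hsum : ∀ σ : ℝ, 1 < σ → Summable fun m => (nm N m) ^ (-σ))
    {G : Type*} [DecidableEq G] (cl : (ι →₀ ℕ) → G) (g : G) (hg : ∀ p, cl (Finsupp.single p 1) ≠ g) :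
    ∃ M, ∀ x : ℝ, 1 < x → DD N cl g x ≤ M := by
  have hs1 : Summable fun p : ι => Real.log (N p) * (N p : ℝ) ^ (-(2:ℝ)) := by
    have := (log_summable hN hsum (σ := 2) (by norm_num)).comp_injective (i := fun p : ι => Finsupp.single p 1)
      (Finsupp.single_left_injective one_ne_zero)
    refine this.congr fun p => ?_
    simp [Function.comp, nm_single]
  have hs2 : Summable fun k : ℕ => 2 * (1/2:ℝ) ^ k := (summable_geometric_two).mul_left 2
  have hN1 : ∀ p, (2:ℝ) ≤ N p := fun p => by exact_mod_cast hN p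
  have hlog : ∀ p, 0 ≤ Real.log (N p) := fun p => Real.log_nonneg (by linarith [hN1 p])
  have hs3 := hs1.mul_of_nonneg hs2 (fun p => mul_nonneg (hlog p) (Real.rpow_nonneg (by positivity) _))
    (fun k => by simp)
  refine ⟨∑' q : ι × ℕ, Real.log (N q.1) * (N q.1 : ℝ) ^ (-(2:ℝ)) * (2 * (1/2:ℝ) ^ q.2), fun x hx => ?_⟩
  have hterm : ∀ q : ι × ℕ, (if cl (pp q) = g then Real.log (N q.1) * (nm N (pp q)) ^ (-x) else 0) ≤
      Real.log (N q.1) * (N q.1 : ℝ) ^ (-(2:ℝ)) * (2 * (1/2:ℝ) ^ q.2) := by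
    rintro ⟨p, k⟩
    simp only
    have hn : 0 ≤ Real.log (N p) * (N p : ℝ) ^ (-(2:ℝ)) * (2 * (1/2:ℝ) ^ k) :=
      mul_nonneg (mul_nonneg (hlog p) (Real.rpow_nonneg (by positivity) _)) (by positivity)
    split_ifs with h
    · have hk : k ≠ 0 := by rintro rfl; exact hg p h
      obtain ⟨j, rfl⟩ := Nat.exists_eq_succ_of_ne_zero hk
      have hp0 : (0:ℝ) < N p := by linarith [hN1 p]
      rw [mul_assoc]
      apply mul_le_mul_of_nonneg_left _ (hlog p)
      calc nm N (pp (p, j + 1)) ^ (-x) ≤ nm N (pp (p, j + 1)) ^ (-(1:ℝ)) :=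
            Real.rpow_le_rpow_of_exponent_le (one_le_nm hN _) (by linarith)
        _ = ((N p : ℝ) ^ 2)⁻¹ * ((N p : ℝ) ^ j)⁻¹ := by
            rw [Real.rpow_neg_one]; unfold pp; rw [nm_single, ← mul_inv, ← pow_add]; congr 2; simp only; omega
        _ ≤ ((N p : ℝ) ^ 2)⁻¹ * (2 ^ j)⁻¹ := by gcongr; exact hN1 p
        _ = (N p : ℝ) ^ (-(2:ℝ)) * (2 * (1/2:ℝ) ^ (j+1)) := by
            rw [Real.rpow_neg hp0.le, Real.rpow_two, one_div, inv_pow, pow_succ 2 j]; field_simp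
    · exact hn
  unfold DD
  refine Summable.tsum_le_tsum hterm (Summable.of_nonneg_of_le (fun q => ?_) hterm hs3) hs3
  split_ifs
  · exact mul_nonneg (hlog _) (Real.rpow_nonneg (nm_pos hN _).le _)
  · exact le_rfl

end PartA7
end OrdPf

namespace OrdPf
open Filter Topology MeasureTheory Set

section PartA8
variable {ι : Type*}
variable {N : ι → ℕ} (hN : ∀ p, 2 ≤ N p) (hfin : ∀ X : ℝ, {m | nm N m ≤ X}.Finite)

include hN hfin in
lemma SS_char {ψ : ℝ → ℝ} {a b : ℝ} (hψ : TestFn ψ a b) {G : Type*} [Fintype G] [DecidableEq G]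
    (cl : (ι →₀ ℕ) → G) (χ : G → ℂ) (hχ : ∀ g, ‖χ g‖ ≤ 1)
    (κ C : ℝ) (h : ∀ g : G, ∀ x : ℝ, 1 ≤ x → |(∑' m, if cl m = g then ψ (x / nm N m) else 0) - κ * x| ≤ C) :
    ∃ C, ∀ x : ℝ, 1 ≤ x → ‖SS N ψ (fun m => χ (cl m)) x - (κ * ∑ g, χ g) * x‖ ≤ C := by
  refine ⟨∑ g : G, C, fun x hx => ?_⟩
  have e1 : SS N ψ (fun m => χ (cl m)) x = ∑ g, χ g * ((∑' m, if cl m = g then ψ (x / nm N m) else 0 : ℝ) : ℂ) := by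
    rw [SS_eq_sum hN hfin hψ _ (le_refl x)]
    set F := (hfin (x / a)).toFinset with hF
    have e2 : ∀ g : G, (∑' m, if cl m = g then ψ (x / nm N m) else 0) = ∑ m ∈ F, if cl m = g then ψ (x / nm N m) else 0 := by
      intro g
      apply tsum_eq_sum
      intro m hm
      rw [hF, Set.Finite.mem_toFinset, mem_ofPred_eq] at hm
      rw [psi_zero hN hψ (le_refl x) hm]; simp
    simp_rw [e2]
    push_cast
    simp_rw [Finset.mul_sum]
    rw [Finset.sum_comm]
    refine Finset.sum_congr rfl fun m _ => ?_
    rw [Finset.sum_eq_single (cl m)]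
    · simp
    · intro g _ hg; simp [Ne.symm hg]
    · simp
  rw [e1, Finset.mul_sum, Finset.sum_mul, ← Finset.sum_sub_distrib]
  refine (norm_sum_le _ _).trans (Finset.sum_le_sum fun g _ => ?_)
  have : χ g * ((∑' m, if cl m = g then ψ (x / nm N m) else 0 : ℝ) : ℂ) - κ * χ g * x =
     χ g * (((∑' m, if cl m = g then ψ (x / nm N m) else 0) - κ * x : ℝ) : ℂ) := by push_cast; ring
  rw [this, norm_mul, Complex.norm_real, Real.norm_eq_abs]
  have h1 := h g x hx
  have := abs_nonneg ((∑' m, if cl m = g then ψ (x / nm N m) else 0) - κ * x)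
  exact (mul_le_of_le_one_left this (hχ g)).trans h1

include hN in
lemma Lam_summable (hsum : ∀ σ : ℝ, 1 < σ → Summable fun m => (nm N m) ^ (-σ))
    (w : (ι →₀ ℕ) → ℂ) (hw : ∀ m, ‖w m‖ ≤ 1) {x : ℝ} (hx : 1 < x) :
    Summable fun q : ι × ℕ => (Real.log (N q.1) : ℂ) * (w (pp q) * (nm N (pp q) : ℂ) ^ (-(x:ℂ))) := by
  refine Summable.of_norm_bounded (pp_summable hN hsum hx) fun q => ?_
  have : (1:ℝ) ≤ N q.1 := by exact_mod_cast (by have := hN q.1; omega)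
  rw [norm_mul, norm_mul, norm_nm_cpow hN, Complex.norm_real, Real.norm_eq_abs, abs_of_nonneg (Real.log_nonneg this)]
  simp only [Complex.ofReal_re]
  apply mul_le_mul_of_nonneg_left _ (Real.log_nonneg this)
  exact mul_le_of_le_one_left (Real.rpow_nonneg (nm_pos hN _).le _) (hw _)

include hN in
lemma sum_Lam (hsum : ∀ σ : ℝ, 1 < σ → Summable fun m => (nm N m) ^ (-σ))
    {G : Type*} [AddCommGroup G] [Fintype G] [DecidableEq G] (cl : (ι →₀ ℕ) → G) (g : G) {x : ℝ} (hx : 1 < x) :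
    ∑ χ : AddChar G ℂ, χ (-g) * Lam N (fun m => χ (cl m)) x = (Fintype.card G : ℂ) * (DD N cl g x : ℂ) := by
  unfold Lam DD
  simp_rw [← tsum_mul_left]
  rw [← Summable.tsum_finsetSum (fun χ _ => ((Lam_summable hN hsum (fun m => χ (cl m)) (fun m => (χ.norm_apply _).le) hx).mul_left _)),
    Complex.ofReal_tsum, ← tsum_mul_left]
  refine tsum_congr fun q => ?_
  have e : ∀ χ : AddChar G ℂ, χ (-g) * ((Real.log (N q.1) : ℂ) * (χ (cl (pp q)) * (nm N (pp q) : ℂ) ^ (-(x:ℂ)))) =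
      χ (cl (pp q) - g) * ((Real.log (N q.1) : ℂ) * (nm N (pp q) : ℂ) ^ (-(x:ℂ))) := by
    intro χ
    rw [sub_eq_add_neg, AddChar.map_add_eq_mul]; ring
  simp_rw [e]
  rw [← Finset.sum_mul, AddChar.sum_apply_eq_ite]
  simp only [sub_eq_zero]
  split_ifs with h
  · rw [Complex.ofReal_mul, Complex.ofReal_cpow (nm_pos hN _).le]; push_cast; rfl
  · simp

include hN hfin in
theorem primes_in_classes {G : Type*} [AddCommGroup G] [Finite G] [DecidableEq G] (cl : (ι →₀ ℕ) →+ G)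
    (hcount : ∀ (ψ : ℝ → ℝ) (a b : ℝ), TestFn ψ a b → ContDiff ℝ ((⊤ : ℕ∞) : WithTop ℕ∞) ψ →
      ∃ κ C : ℝ, 0 < κ ∧ ∀ g : G, ∀ x : ℝ, 1 ≤ x →
        |(∑' m, if cl m = g then ψ (x / nm N m) else 0) - κ * x| ≤ C) (g : G) :
    ∃ p, cl (Finsupp.single p 1) = g := by
  classical
  have := Fintype.ofFinite G
  obtain ⟨ψ, ψ0, a, b, a0, b0, c, hψ, hψ0, hs, hs0, hc, hΦ⟩ := exists_bumps
  obtain ⟨κ, C, hκ, hC⟩ := hcount ψ a b hψ hs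
  obtain ⟨κ0, C0, hκ0, hC0⟩ := hcount ψ0 a0 b0 hψ0 hs0
  have hcard : (Fintype.card G : ℂ) ≠ 0 := Nat.cast_ne_zero.2 Fintype.card_ne_zero
  have hS : ∀ χ : AddChar G ℂ, ∃ C, ∀ x : ℝ, 1 ≤ x →
      ‖SS N ψ (fun m => χ (cl m)) x - (if χ = 0 then (κ * Fintype.card G : ℂ) else 0) * x‖ ≤ C := by
    intro χ
    have := SS_char hN hfin hψ cl χ (fun g => (χ.norm_apply g).le) κ C hC
    rw [AddChar.sum_eq_ite] at this
    simpa only [mul_ite, mul_zero] using this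
  have h1 : ∃ C, ∀ x : ℝ, 1 ≤ x → ‖SS N ψ (fun _ => 1) x - (κ * Fintype.card G : ℂ) * x‖ ≤ C := by
    simpa using hS 0
  have h10 : ∃ C, ∀ x : ℝ, 1 ≤ x → ‖SS N ψ0 (fun _ => 1) x - (κ0 * Fintype.card G : ℂ) * x‖ ≤ C := by
    have := SS_char hN hfin hψ0 cl (fun _ => 1) (fun g => by simp) κ0 C0 hC0
    simpa using this
  have hsum : ∀ σ : ℝ, 1 < σ → Summable fun m => (nm N m) ^ (-σ) := fun σ hσ =>
    nm_summable hN hfin hψ _ h1 hσ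
  have hL := fun χ : AddChar G ℂ => Lam_lim hN hfin hψ hsum (fun m => χ (cl m)) (fun m => (χ.norm_apply _).le)
    (by simp) (fun m n => by simp [AddChar.map_add_eq_mul]) _ (hS χ)
  choose k hk hk1 hk2 hk3 using hL
  have hk0 : k 0 = 0 := hk1 0 (by simp [hκ.ne'])
  have hk1' : ∀ χ ≠ 0, 1 ≤ k χ := fun χ hχ => hk2 χ (by simp [hχ])
  have hlim : ∀ g : G, Tendsto (fun x : ℝ => ((x:ℂ) - 1) * ((Fintype.card G : ℂ) * (DD N cl g x : ℂ))) (𝓝[>] 1)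
      (𝓝 (∑ χ : AddChar G ℂ, χ (-g) * (1 - (k χ : ℂ)))) := by
    intro g
    have := tendsto_finsetSum Finset.univ fun χ _ => ((hk χ).const_mul (χ (-g)))
    refine this.congr' ?_
    filter_upwards [self_mem_nhdsWithin] with x hx
    rw [← sum_Lam hN hsum cl g hx, Finset.mul_sum]
    refine Finset.sum_congr rfl fun χ _ => ?_
    ring
  -- positivity
  have hpos : (0:ℝ) ≤ ∑ χ : AddChar G ℂ, (1 - (k χ : ℝ)) := by
    have h2 := (Complex.continuous_re.tendsto _).comp (hlim 0)
    have h3 : (∑ χ : AddChar G ℂ, χ (-0) * (1 - (k χ : ℂ))).re = ∑ χ : AddChar G ℂ, (1 - (k χ : ℝ)) := by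
      simp
    rw [h3] at h2
    refine ge_of_tendsto h2 ?_
    filter_upwards [self_mem_nhdsWithin] with x hx
    have hx : 1 < x := hx
    have e : ((x:ℂ) - 1) * ((Fintype.card G : ℂ) * (DD N cl 0 x : ℂ)) =
      (((x - 1) * (Fintype.card G * DD N cl 0 x) : ℝ) : ℂ) := by push_cast; rfl
    simp only [Function.comp]
    rw [e, Complex.ofReal_re]
    have := DD_nonneg hN cl 0 x
    have : 0 ≤ x - 1 := by linarith
    positivity
  have hposN : ∑ χ ∈ Finset.univ.erase (0 : AddChar G ℂ), ((k χ : ℤ) - 1) ≤ 1 := by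
    have h4 : (0:ℤ) ≤ ∑ χ : AddChar G ℂ, (1 - (k χ : ℤ)) := by exact_mod_cast hpos
    rw [← Finset.add_sum_erase _ _ (Finset.mem_univ (0 : AddChar G ℂ)), hk0] at h4
    have h5 : ∑ χ ∈ Finset.univ.erase (0 : AddChar G ℂ), (1 - (k χ : ℤ)) =
        - ∑ χ ∈ Finset.univ.erase (0 : AddChar G ℂ), ((k χ : ℤ) - 1) := by
      rw [← Finset.sum_neg_distrib]; exact Finset.sum_congr rfl fun _ _ => by ring
    rw [h5] at h4; push_cast at h4; linarith
  have hconj : ∀ χ : AddChar G ℂ, k (-χ) = k χ := by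
    intro χ
    have h2 := (Complex.continuous_conj.tendsto _).comp (hk χ)
    have h3 : (fun x : ℝ => ((x:ℂ) - 1) * Lam N (fun m => (-χ) (cl m)) x) =
        (starRingEnd ℂ) ∘ (fun x : ℝ => ((x:ℂ) - 1) * Lam N (fun m => χ (cl m)) x) := by
      ext x
      simp only [Function.comp, map_mul, map_sub, Complex.conj_ofReal, map_one]
      congr 1
      unfold Lam
      rw [Complex.conj_tsum]
      refine tsum_congr fun q => ?_
      rw [map_mul, map_mul, Complex.conj_ofReal]
      simp only
      rw [AddChar.neg_apply, AddChar.map_neg_eq_conj]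
      congr 2
      have : (nm N (pp q) : ℂ) ^ (-(x:ℂ)) = ((nm N (pp q) ^ (-x) : ℝ) : ℂ) := by
        rw [Complex.ofReal_cpow (nm_pos hN _).le]; push_cast; rfl
      rw [this, Complex.conj_ofReal]
    have h4 := hk (-χ)
    rw [h3] at h4
    have h5 := tendsto_nhds_unique h4 h2
    simp only [map_sub, map_one, Complex.conj_natCast, sub_right_inj] at h5
    exact_mod_cast h5
  have hone : ∀ χ : AddChar G ℂ, χ ≠ 0 → k χ = 1 := by
    intro χ hχ
    by_contra hne
    have hk2' : 2 ≤ k χ := by have := hk1' χ hχ; omega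
    by_cases hreal : -χ = χ
    · have hcj : ∀ g, (starRingEnd ℂ) (χ g) = χ g := by
        intro g
        rw [← AddChar.map_neg_eq_conj, ← AddChar.neg_apply, hreal]
      have hre : ∀ g, (((χ g).re : ℝ) : ℂ) = χ g := fun g => Complex.conj_eq_iff_re.1 (hcj g)
      have hq := quad_nonvanish hN hfin hψ (fun m => (χ (cl m)).re) ?_ ?_ ?_ _ h1 ?_ hψ0 hc hΦ
        (κ0 * Fintype.card G : ℂ) (mul_ne_zero (by exact_mod_cast hκ0.ne') hcard) h10
      · simp only [hre] at hq
        have := hk3 χ (by simp [hχ])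
        simp only [hχ, if_false] at this
        exact hne (this hq)
      · intro m
        have h6 := χ.norm_apply (cl m)
        rw [← hre, Complex.norm_real, Real.norm_eq_abs] at h6
        exact eq_or_eq_neg_of_abs_eq h6
      · simp
      · intro m n
        have h7 : χ (cl (m + n)) = χ (cl m) * χ (cl n) := by simp [AddChar.map_add_eq_mul]
        rw [h7, ← hre (cl m), ← hre (cl n)]; norm_cast
      · simp only [hre]
        have := hS χ
        simpa only [hχ, if_false] using this
    · have hm1 : χ ∈ Finset.univ.erase (0 : AddChar G ℂ) := by simp [hχ]
      have hm2 : -χ ∈ Finset.univ.erase (0 : AddChar G ℂ) := by simp [hχ]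
      have hsub : ({χ, -χ} : Finset (AddChar G ℂ)) ⊆ Finset.univ.erase 0 := by
        intro y hy
        simp only [Finset.mem_insert, Finset.mem_singleton] at hy
        rcases hy with rfl | rfl <;> assumption
      have h8 := Finset.sum_le_sum_of_subset_of_nonneg hsub (f := fun χ => (k χ : ℤ) - 1) (by
        intro y hy _
        have := hk1' y (Finset.ne_of_mem_erase hy)
        omega)
      rw [Finset.sum_pair (Ne.symm hreal), hconj] at h8
      have := h8.trans hposN
      omega
  by_contra hno
  push Not at hno
  have hg := hlim g
  have hval : ∑ χ : AddChar G ℂ, χ (-g) * (1 - (k χ : ℂ)) = 1 := by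
    rw [Finset.sum_eq_single 0]
    · simp [hk0]
    · intro χ _ hχ; simp [hone χ hχ]
    · simp
  rw [hval] at hg
  obtain ⟨M, hM⟩ := DD_bound hN hsum cl g hno
  have hz : Tendsto (fun x : ℝ => ((x:ℂ) - 1) * ((Fintype.card G : ℂ) * (DD N cl g x : ℂ))) (𝓝[>] 1) (𝓝 0) := by
    rw [tendsto_zero_iff_norm_tendsto_zero]
    have hb : Tendsto (fun x : ℝ => (x - 1) * (Fintype.card G * M)) (𝓝[>] 1) (𝓝 0) := by
      have : Tendsto (fun x : ℝ => (x - 1) * (Fintype.card G * M)) (𝓝 1) (𝓝 ((1 - 1) * (Fintype.card G * M))) :=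
        Continuous.tendsto (by fun_prop) 1
      simp only [sub_self, zero_mul] at this
      exact this.mono_left nhdsWithin_le_nhds
    refine tendsto_of_tendsto_of_tendsto_of_le_of_le' tendsto_const_nhds hb (Eventually.of_forall fun _ => norm_nonneg _) ?_
    filter_upwards [self_mem_nhdsWithin] with x hx
    have hx : 1 < x := hx
    have e : ((x:ℂ) - 1) * ((Fintype.card G : ℂ) * (DD N cl g x : ℂ)) =
      (((x - 1) * (Fintype.card G * DD N cl g x) : ℝ) : ℂ) := by push_cast; rfl
    have h0 := DD_nonneg hN cl g x
    have h1 : 0 ≤ x - 1 := by linarith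
    rw [e, Complex.norm_real, Real.norm_eq_abs, abs_of_nonneg (by positivity)]
    have := hM x hx
    gcongr
  exact one_ne_zero (tendsto_nhds_unique hg hz)

end PartA8
end OrdPf

namespace OrdPf
open Filter Topology MeasureTheory Set

section PartL
variable {E : Type*} [NormedAddCommGroup E] [NormedSpace ℝ E] [FiniteDimensional ℝ E]
  [MeasurableSpace E] [BorelSpace E] (μ : Measure E) [μ.IsAddHaarMeasure]
  {ι : Type*} [Fintype ι] (b : Module.Basis ι ℝ E)

/-- Averaging operator over a scaled fundamental domain. -/
noncomputable def Av (h : ℝ) (g : E → ℝ) (x : E) : ℝ :=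
  (μ.real (ZSpan.fundamentalDomain b))⁻¹ * ∫ y in ZSpan.fundamentalDomain b, g (x + h • y) ∂μ

/-- Identity minus averaging. -/
noncomputable def Bo (h : ℝ) (g : E → ℝ) (x : E) : ℝ := g x - Av μ b h g x

/-- Continuous, vanishing outside a ball. -/
structure Cc (g : E → ℝ) (R : ℝ) : Prop where
  cont : Continuous g
  zero : ∀ x, R < ‖x‖ → g x = 0

omit [MeasurableSpace E] [BorelSpace E] in
lemma Cc.hcs {g : E → ℝ} {R : ℝ} (hg : Cc g R) : HasCompactSupport g :=
  HasCompactSupport.intro (isCompact_closedBall 0 R) fun x hx => hg.zero x (by simpa using hx)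

lemma Cc.integrable {g : E → ℝ} {R : ℝ} (hg : Cc g R) : Integrable g μ :=
  hg.cont.integrable_of_hasCompactSupport hg.hcs

omit [FiniteDimensional ℝ E] [MeasurableSpace E] [BorelSpace E] in
lemma FD_bdd : ∃ ρ : ℝ, 0 ≤ ρ ∧ ∀ y ∈ ZSpan.fundamentalDomain b, ‖y‖ ≤ ρ := by
  obtain ⟨ρ, hρ⟩ := (ZSpan.fundamentalDomain_isBounded b).exists_norm_le
  exact ⟨max ρ 0, le_max_right _ _, fun y hy => (hρ y hy).trans (le_max_left _ _)⟩

lemma FD_fin : μ (ZSpan.fundamentalDomain b) ≠ ⊤ :=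
  (ZSpan.fundamentalDomain_isBounded b).measure_lt_top.ne

lemma FD_pos : 0 < μ.real (ZSpan.fundamentalDomain b) :=
  ENNReal.toReal_pos (ZSpan.measure_fundamentalDomain_ne_zero b) (FD_fin μ b)

lemma FD_int {g : E → ℝ} (hg : Continuous g) : IntegrableOn g (ZSpan.fundamentalDomain b) μ := by
  obtain ⟨ρ, -, hρ⟩ := FD_bdd b
  refine (hg.continuousOn.integrableOn_compact (isCompact_closedBall (0 : E) ρ)).mono_set ?_
  intro y hy; simpa using hρ y hy

lemma Av_cont {g : E → ℝ} {R h : ℝ} (hg : Cc g R) : Continuous (Av μ b h g) := by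
  obtain ⟨C, hC⟩ := hg.hcs.exists_bound_of_continuous hg.cont
  have := hg.cont
  haveI : IsFiniteMeasure (μ.restrict (ZSpan.fundamentalDomain b)) :=
    ⟨by simpa using (FD_fin μ b).lt_top⟩
  refine continuous_const.mul (continuous_of_dominated (bound := fun _ => C) ?_ ?_ ?_ ?_)
  · exact fun x => (by fun_prop : Continuous fun y => g (x + h • y)).aestronglyMeasurable
  · exact fun x => Eventually.of_forall fun y => hC _
  · exact integrable_const _
  · exact Eventually.of_forall fun y => by fun_prop

lemma Av_zero {g : E → ℝ} {R h ρ : ℝ} (hg : Cc g R) (h0 : 0 ≤ h)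
    (hρ : ∀ y ∈ ZSpan.fundamentalDomain b, ‖y‖ ≤ ρ) (x : E) (hx : R + h * ρ < ‖x‖) :
    Av μ b h g x = 0 := by
  unfold Av
  rw [setIntegral_congr_fun (g := fun _ => 0) (ZSpan.fundamentalDomain_measurableSet b), integral_zero, mul_zero]
  intro y hy
  refine hg.zero _ ?_
  have h1 : ‖x‖ ≤ ‖x + h • y‖ + ‖h • y‖ := by
    have := norm_sub_le (x + h • y) (h • y); simpa using this
  have h2 : ‖h • y‖ ≤ h * ρ := by
    rw [norm_smul, Real.norm_of_nonneg h0]; exact mul_le_mul_of_nonneg_left (hρ y hy) h0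
  linarith

lemma Av_Cc {g : E → ℝ} {R h ρ : ℝ} (hg : Cc g R) (h0 : 0 ≤ h)
    (hρ : ∀ y ∈ ZSpan.fundamentalDomain b, ‖y‖ ≤ ρ) : Cc (Av μ b h g) (R + h * ρ) :=
  ⟨Av_cont μ b hg, Av_zero μ b hg h0 hρ⟩

lemma Bo_Cc {g : E → ℝ} {R h ρ : ℝ} (hg : Cc g R) (h0 : 0 ≤ h) (hρ0 : 0 ≤ ρ)
    (hρ : ∀ y ∈ ZSpan.fundamentalDomain b, ‖y‖ ≤ ρ) : Cc (Bo μ b h g) (R + h * ρ) :=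
  ⟨hg.cont.sub (Av_cont μ b hg), fun x hx => by
    have := mul_nonneg h0 hρ0
    rw [Bo, hg.zero x (by linarith), Av_zero μ b hg h0 hρ x hx, sub_zero]⟩

lemma Bo_iter_Cc {R h ρ : ℝ} (h0 : 0 ≤ h) (hρ0 : 0 ≤ ρ)
    (hρ : ∀ y ∈ ZSpan.fundamentalDomain b, ‖y‖ ≤ ρ) (k : ℕ) {g : E → ℝ} (hg : Cc g R) :
    Cc ((Bo μ b h)^[k] g) (R + k * (h * ρ)) := by
  induction k with
  | zero => simpa using hg
  | succ k ih =>
    rw [Function.iterate_succ_apply']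
    have := Bo_Cc μ b ih h0 hρ0 hρ
    convert this using 1
    push_cast; ring

lemma Av_int {g : E → ℝ} {R h : ℝ} (hg : Cc g R) : ∫ x, Av μ b h g x ∂μ = ∫ x, g x ∂μ := by
  unfold Av
  have := hg.cont
  haveI : IsFiniteMeasure (μ.restrict (ZSpan.fundamentalDomain b)) :=
    ⟨by simpa using (FD_fin μ b).lt_top⟩
  rw [integral_const_mul, integral_integral_swap (f := fun x y => g (x + h • y))]
  · simp_rw [integral_add_right_eq_self (μ := μ) g]
    rw [setIntegral_const, smul_eq_mul, ← mul_assoc, inv_mul_cancel₀ (FD_pos μ b).ne', one_mul]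
  · have hc : Continuous (Function.uncurry fun (x y : E) => g (x + h • y)) := by
      unfold Function.uncurry; fun_prop
    rw [integrable_prod_iff' hc.aestronglyMeasurable]
    refine ⟨Eventually.of_forall fun y => (hg.integrable μ).comp_add_right (h • y), ?_⟩
    simp only [Function.uncurry_apply_pair]
    simp_rw [integral_add_right_eq_self (μ := μ) (fun x => ‖g x‖)]
    exact integrable_const _

lemma Bo_int {g : E → ℝ} {R h ρ : ℝ} (hg : Cc g R) (h0 : 0 ≤ h)
    (hρ : ∀ y ∈ ZSpan.fundamentalDomain b, ‖y‖ ≤ ρ) : ∫ x, Bo μ b h g x ∂μ = 0 := by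
  unfold Bo
  rw [integral_sub (hg.integrable μ) ((Av_Cc μ b hg h0 hρ).integrable μ), Av_int μ b hg, sub_self]

omit [MeasurableSpace E] [BorelSpace E] in
lemma lat_fin (R h : ℝ) (hh : 0 < h) (a : E) :
    {l : Submodule.span ℤ (Set.range b) | ‖h • (a + (l : E))‖ ≤ R}.Finite := by
  have := ZSpan.setFinite_inter b (s := Metric.closedBall (-a) (R / h)) Metric.isBounded_closedBall
  refine (this.preimage (f := ((↑) : Submodule.span ℤ (Set.range b) → E)) Subtype.val_injective.injOn).subset ?_
  intro l hl
  refine ⟨?_, l.2⟩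
  simp only [mem_ofPred_eq, norm_smul, Real.norm_of_nonneg hh.le] at hl
  rw [mem_closedBall_iff_norm, le_div_iff₀ hh]
  rw [sub_neg_eq_add, add_comm (l : E), mul_comm]; exact hl

omit [MeasurableSpace E] [BorelSpace E] in
lemma lat_summable {g : E → ℝ} {R h : ℝ} (hg : Cc g R) (hh : 0 < h) (a : E) :
    Summable fun l : Submodule.span ℤ (Set.range b) => g (h • (a + (l : E))) := by
  refine summable_of_hasFiniteSupport ?_
  refine (lat_fin b R h hh a).subset fun l hl => ?_
  by_contra hn
  exact hl (hg.zero _ (not_le.1 hn))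

lemma lat_Av {g : E → ℝ} {R h : ℝ} (hg : Cc g R) (hh : 0 < h) (a : E) :
    ∑' l : Submodule.span ℤ (Set.range b), Av μ b h g (h • (a + (l : E))) =
      (μ.real (ZSpan.fundamentalDomain b))⁻¹ * ((h ^ Module.finrank ℝ E)⁻¹ * ∫ x, g x ∂μ) := by
  unfold Av
  rw [tsum_mul_left]
  congr 1
  have hc := hg.cont
  have hi : Integrable (fun x => g (h • (a + x))) μ := by
    have h1 : Integrable (fun x => g (h • x)) μ := (integrable_comp_smul_iff μ g hh.ne').2 (hg.integrable μ)
    exact h1.comp_add_left a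
  haveI : MeasurableVAdd (Submodule.span ℤ (Set.range b)) E :=
    (inferInstance : MeasurableVAdd (Submodule.span ℤ (Set.range b)).toAddSubgroup E)
  haveI : VAddInvariantMeasure (Submodule.span ℤ (Set.range b)) E μ :=
    (inferInstance : VAddInvariantMeasure (Submodule.span ℤ (Set.range b)).toAddSubgroup E μ)
  have h2 := (ZSpan.isAddFundamentalDomain b μ).integral_eq_tsum'' (fun x => g (h • (a + x))) hi
  rw [integral_add_left_eq_self (μ := μ) (fun x => g (h • x)), Measure.integral_comp_smul_of_nonneg μ g h (hR := hh.le)] at h2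
  rw [← smul_eq_mul, h2]
  refine tsum_congr fun l => ?_
  refine integral_congr_ae (Eventually.of_forall fun y => ?_)
  simp only
  congr 1
  rw [← smul_add, add_assoc]; rfl

lemma lat_Bo {g : E → ℝ} {R h ρ : ℝ} (hg : Cc g R) (hh : 0 < h)
    (hρ : ∀ y ∈ ZSpan.fundamentalDomain b, ‖y‖ ≤ ρ) (a : E) :
    ∑' l : Submodule.span ℤ (Set.range b), Bo μ b h g (h • (a + (l : E))) =
      ∑' l : Submodule.span ℤ (Set.range b), g (h • (a + (l : E))) -
      (μ.real (ZSpan.fundamentalDomain b))⁻¹ * ((h ^ Module.finrank ℝ E)⁻¹ * ∫ x, g x ∂μ) := by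
  rw [← lat_Av μ b hg hh a]
  exact (lat_summable b hg hh a).tsum_sub (lat_summable b (Av_Cc μ b hg hh.le hρ) hh a)

lemma lat_Bo_iter {R h ρ : ℝ} (hh : 0 < h) (hρ0 : 0 ≤ ρ)
    (hρ : ∀ y ∈ ZSpan.fundamentalDomain b, ‖y‖ ≤ ρ) (a : E) (k : ℕ) {g : E → ℝ} (hg : Cc g R) :
    ∑' l : Submodule.span ℤ (Set.range b), (Bo μ b h)^[k+1] g (h • (a + (l : E))) =
      ∑' l : Submodule.span ℤ (Set.range b), g (h • (a + (l : E))) -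
      (μ.real (ZSpan.fundamentalDomain b))⁻¹ * ((h ^ Module.finrank ℝ E)⁻¹ * ∫ x, g x ∂μ) := by
  induction k with
  | zero => exact lat_Bo μ b hg hh hρ a
  | succ k ih =>
    rw [← ih, Function.iterate_succ_apply', lat_Bo μ b (Bo_iter_Cc μ b hh.le hρ0 hρ (k+1) hg) hh hρ a]
    rw [Function.iterate_succ_apply', Bo_int μ b (Bo_iter_Cc μ b hh.le hρ0 hρ k hg) hh.le hρ]
    ring

/-- Iterated difference bounds. -/
def Sm : ℕ → ℝ → (E → ℝ) → Prop
  | 0, M, f => ∀ x, |f x| ≤ M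
  | k+1, M, f => ∀ v : E, Sm k (M * ‖v‖) (fun x => f x - f (x + v))

omit [FiniteDimensional ℝ E] [MeasurableSpace E] [BorelSpace E] in
lemma Sm_of_contDiff (k : ℕ) : ∀ (M : ℝ) (f : E → ℝ), ContDiff ℝ ((⊤ : ℕ∞) : WithTop ℕ∞) f →
    (∀ x, ‖iteratedFDeriv ℝ k f x‖ ≤ M) → Sm k M f := by
  induction k with
  | zero => 
    intro M f hf h x
    simpa using h x
  | succ k ih =>
    intro M f hf h v
    have hf2 : ContDiff ℝ ((⊤ : ℕ∞) : WithTop ℕ∞) (fun x => f (x + v)) := hf.comp (by fun_prop)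
    refine ih _ _ (hf.sub hf2) fun x => ?_
    have hk : ((k : ℕ) : WithTop ℕ∞) ≤ ((⊤ : ℕ∞) : WithTop ℕ∞) := by exact_mod_cast le_top
    rw [fun_iteratedFDeriv_sub_apply (hf.of_le hk).contDiffAt (hf2.of_le hk).contDiffAt, iteratedFDeriv_comp_add_right]
    have hd : Differentiable ℝ (iteratedFDeriv ℝ k f) :=
      hf.differentiable_iteratedFDeriv (by exact_mod_cast (ENat.coe_lt_top k))
    have := Convex.norm_image_sub_le_of_norm_fderiv_le (𝕜 := ℝ) (f := iteratedFDeriv ℝ k f) (s := univ) (x := x + v) (y := x) (C := M)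
      (fun y _ => hd y) (fun y _ => by rw [norm_fderiv_iteratedFDeriv]; exact h y) convex_univ trivial trivial
    simpa using this

lemma Bo_bound {M h ρ : ℝ} (hM : 0 ≤ M) (h0 : 0 ≤ h) (hρ : ∀ y ∈ ZSpan.fundamentalDomain b, ‖y‖ ≤ ρ)
    (f : E → ℝ) (hf : Continuous f) (hS : ∀ v x, |f x - f (x + v)| ≤ M * ‖v‖) (x : E) :
    |Bo μ b h f x| ≤ M * (h * ρ) := by
  have hV := FD_pos μ b
  have e : Bo μ b h f x = (μ.real (ZSpan.fundamentalDomain b))⁻¹ *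
      ∫ y in ZSpan.fundamentalDomain b, (f x - f (x + h • y)) ∂μ := by
    rw [integral_sub (FD_int μ b continuous_const) (FD_int μ b (by fun_prop)), setIntegral_const, smul_eq_mul, mul_sub,
      ← mul_assoc, inv_mul_cancel₀ hV.ne', one_mul]; rfl
  rw [e, abs_mul, abs_of_pos (inv_pos.2 hV), inv_mul_le_iff₀ hV, mul_comm]
  refine norm_setIntegral_le_of_norm_le_const (f := fun y : E => f x - f (x + h • y)) (FD_fin μ b).lt_top fun y hy => ?_
  refine (hS _ _).trans (mul_le_mul_of_nonneg_left ?_ hM)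
  rw [norm_smul, Real.norm_of_nonneg h0]; exact mul_le_mul_of_nonneg_left (hρ y hy) h0

lemma Bo_diff {h : ℝ} (f : E → ℝ) (hf : Continuous f) (v : E) :
    Bo μ b h (fun x => f x - f (x + v)) = fun x => Bo μ b h f x - Bo μ b h f (x + v) := by
  funext x
  unfold Bo Av
  rw [integral_sub (FD_int μ b (by fun_prop)) (FD_int μ b (by fun_prop))]
  have : ∀ y, f (x + h • y + v) = f (x + v + h • y) := fun y => by congr 1; abel
  simp_rw [this]
  ring

lemma Bo_Sm {h ρ : ℝ} (h0 : 0 ≤ h) (hρ : ∀ y ∈ ZSpan.fundamentalDomain b, ‖y‖ ≤ ρ)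
    (k : ℕ) : ∀ (M : ℝ) (f : E → ℝ), 0 ≤ M → Continuous f → Sm (k+1) M f → Sm k (M * (h * ρ)) (Bo μ b h f) := by
  induction k with
  | zero => exact fun M f hM hf hS => Bo_bound μ b hM h0 hρ f hf hS
  | succ k ih =>
    intro M f hM hf hS v
    have := ih (M * ‖v‖) _ (mul_nonneg hM (norm_nonneg _)) (by fun_prop) (hS v)
    rw [Bo_diff μ b f hf v] at this
    rw [mul_right_comm]; exact this

lemma Bo_iter_Sm {h ρ : ℝ} (h0 : 0 ≤ h) (hρ0 : 0 ≤ ρ) (hρ : ∀ y ∈ ZSpan.fundamentalDomain b, ‖y‖ ≤ ρ)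
    (k : ℕ) : ∀ (M R : ℝ) (f : E → ℝ), 0 ≤ M → Cc f R → Sm k M f →
      ∀ x, |(Bo μ b h)^[k] f x| ≤ M * (h * ρ) ^ k := by
  induction k with
  | zero => intro M R f hM hf hS x; simpa using hS x
  | succ k ih =>
    intro M R f hM hf hS x
    rw [Function.iterate_succ_apply]
    have := ih (M * (h * ρ)) _ (Bo μ b h f) (by positivity) (Bo_Cc μ b hf h0 hρ0 hρ) (Bo_Sm μ b h0 hρ k M f hM hf.cont hS) x
    rw [pow_succ']
    linarith

include μ in
lemma lat_card (R ρ : ℝ) (hρ : ∀ y ∈ ZSpan.fundamentalDomain b, ‖y‖ ≤ ρ) (a : E) :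
    ∃ A : ℝ, 0 ≤ A ∧ ∀ h : ℝ, 0 < h → h ≤ 1 → ∀ s : Finset (Submodule.span ℤ (Set.range b)),
      (∀ l ∈ s, ‖h • (a + (l : E))‖ ≤ R) → (s.card : ℝ) ≤ A * (h ^ Module.finrank ℝ E)⁻¹ := by
  set g : E → ℝ := fun x => max 0 (min 1 (R + ρ + 1 - ‖x‖)) with hgd
  have hg : Cc g (R + ρ + 1) := ⟨by fun_prop, fun x hx => by
    simp only [hgd]
    exact max_eq_left ((min_le_right _ _).trans (by linarith))⟩
  have hg0 : ∀ x, 0 ≤ g x := fun x => le_max_left _ _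
  have hV := FD_pos μ b
  refine ⟨(μ.real (ZSpan.fundamentalDomain b))⁻¹ * ∫ x, g x ∂μ, mul_nonneg (inv_nonneg.2 hV.le) (integral_nonneg hg0), ?_⟩
  intro h hh h1 s hs
  have e := lat_Av μ b hg hh a
  have hAv0 : ∀ x, 0 ≤ Av μ b h g x := fun x =>
    mul_nonneg (inv_nonneg.2 hV.le) (integral_nonneg fun y => hg0 _)
  have hs2 := (lat_summable b (Av_Cc μ b hg hh.le hρ) hh a).sum_le_tsum s (fun l _ => hAv0 _)
  have hs3 : (s.card : ℝ) ≤ ∑ l ∈ s, Av μ b h g (h • (a + (l : E))) := by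
    rw [← nsmul_one, ← Finset.sum_const]
    refine Finset.sum_le_sum fun l hl => ?_
    unfold Av
    rw [setIntegral_congr_fun (g := fun _ => 1) (ZSpan.fundamentalDomain_measurableSet b), setIntegral_const, smul_eq_mul, mul_one,
      inv_mul_cancel₀ hV.ne']
    intro y hy
    have h3 : ‖h • (a + (l : E)) + h • y‖ ≤ R + ρ := by
      refine (norm_add_le _ _).trans (add_le_add (hs l hl) ?_)
      rw [norm_smul, Real.norm_of_nonneg hh.le]
      exact (mul_le_of_le_one_left (norm_nonneg _) h1).trans (hρ y hy)
    simp only [hgd]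
    rw [min_eq_left (by linarith), max_eq_right zero_le_one]
  rw [mul_assoc, mul_comm (∫ x, g x ∂μ), ← e]
  exact hs3.trans hs2

theorem lattice_sum (f : E → ℝ) (hf : ContDiff ℝ ((⊤ : ℕ∞) : WithTop ℕ∞) f) (hfc : HasCompactSupport f) (a : E) :
    ∃ C : ℝ, ∀ t : ℝ, 1 ≤ t →
      |∑' l : Submodule.span ℤ (Set.range b), f (t⁻¹ • (a + (l : E))) -
        t ^ Module.finrank ℝ E * ((∫ x, f x ∂μ) / μ.real (ZSpan.fundamentalDomain b))| ≤ C := by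
  obtain ⟨ρ, hρ0, hρ⟩ := FD_bdd b
  obtain ⟨R, hR⟩ : ∃ R, Cc f R := by
    obtain ⟨R, hR⟩ := hfc.isCompact.isBounded.exists_norm_le
    exact ⟨R, hf.continuous, fun x hx => by
      by_contra hn
      exact absurd (hR x (subset_tsupport f hn)) (not_le.2 hx)⟩
  set n := Module.finrank ℝ E with hn
  obtain ⟨M, hM⟩ := (hfc.iteratedFDeriv (𝕜 := ℝ) (n+1)).exists_bound_of_continuous
    (hf.continuous_iteratedFDeriv (by exact_mod_cast le_top))
  have hM0 : 0 ≤ M := (norm_nonneg _).trans (hM 0)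
  have hS := Sm_of_contDiff (n+1) M f hf hM
  obtain ⟨A, hA0, hA⟩ := lat_card μ b (R + (n + 1 : ℕ) * ρ) ρ hρ a
  refine ⟨A * (M * ρ ^ (n+1)), fun t ht => ?_⟩
  have ht0 : 0 < t := by linarith
  set h := t⁻¹ with hh
  have hh0 : 0 < h := inv_pos.2 ht0
  have hh1 : h ≤ 1 := inv_le_one_of_one_le₀ ht
  have e := lat_Bo_iter μ b hh0 hρ0 hρ a n hR
  have e2 : t ^ n * ((∫ x, f x ∂μ) / μ.real (ZSpan.fundamentalDomain b)) =
    (μ.real (ZSpan.fundamentalDomain b))⁻¹ * ((h ^ n)⁻¹ * ∫ x, f x ∂μ) := by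
    rw [hh, inv_pow, inv_inv]; ring
  rw [e2, ← e]
  have hC := Bo_iter_Cc μ b hh0.le hρ0 hρ (n+1) hR
  have hb := Bo_iter_Sm μ b hh0.le hρ0 hρ (n+1) M R f hM0 hR hS
  set s := (lat_fin b (R + (n + 1 : ℕ) * ρ) h hh0 a).toFinset with hs
  rw [tsum_eq_sum (s := s)]
  · refine (Finset.abs_sum_le_sum_abs _ _).trans ((Finset.sum_le_card_nsmul _ _ (M * (h * ρ) ^ (n+1)) fun l _ => hb _).trans ?_)
    rw [nsmul_eq_mul]
    refine (mul_le_mul_of_nonneg_right (hA h hh0 hh1 s ?_) (by positivity)).trans ?_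
    · intro l hl; simpa [hs] using hl
    · have : A * (h ^ n)⁻¹ * (M * (h * ρ) ^ (n + 1)) = A * (M * ρ ^ (n+1)) * h := by
        rw [mul_pow, pow_succ h]
        field_simp
      rw [this]
      exact mul_le_of_le_one_right (by positivity) hh1
  · intro l hl
    refine hC.zero _ ?_
    have : R + (n + 1 : ℕ) * ρ < ‖h • (a + (l : E))‖ := by
      simpa [hs] using hl
    refine lt_of_le_of_lt ?_ this
    gcongr
    exact mul_le_of_le_one_left hρ0 hh1

end PartL
end OrdPf

namespace OrdPf
open Filter Topology MeasureTheory Set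

section PartF

/-- A smooth bump with integer translates summing to one. -/
noncomputable def BB (y : ℝ) : ℝ := Real.smoothTransition (y + 1) - Real.smoothTransition y

lemma BB_smooth : ContDiff ℝ ((⊤ : ℕ∞) : WithTop ℕ∞) BB := by
  unfold BB
  exact (Real.smoothTransition.contDiff.comp (by fun_prop)).sub Real.smoothTransition.contDiff

lemma BB_zero_left {y : ℝ} (h : y ≤ -1) : BB y = 0 := by
  unfold BB
  rw [Real.smoothTransition.zero_of_nonpos (by linarith), Real.smoothTransition.zero_of_nonpos (by linarith), sub_zero]

lemma BB_zero_right {y : ℝ} (h : 1 ≤ y) : BB y = 0 := by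
  unfold BB
  rw [Real.smoothTransition.one_of_one_le (by linarith), Real.smoothTransition.one_of_one_le (by linarith), sub_self]

lemma BB_abs {y : ℝ} (h : BB y ≠ 0) : |y| ≤ 1 := by
  rw [abs_le]
  constructor
  · by_contra h1; exact h (BB_zero_left (by linarith))
  · by_contra h1; exact h (BB_zero_right (by linarith))

lemma BB_zero : BB 0 = 1 := by
  unfold BB
  rw [zero_add, Real.smoothTransition.one_of_one_le le_rfl, Real.smoothTransition.zero_of_nonpos le_rfl, sub_zero]

lemma sT_mono {x y : ℝ} (h : x ≤ y) : Real.smoothTransition x ≤ Real.smoothTransition y := by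
  unfold Real.smoothTransition
  have hx := Real.smoothTransition.pos_denom x
  have hy := Real.smoothTransition.pos_denom y
  have h1 : expNegInvGlue x ≤ expNegInvGlue y := expNegInvGlue.monotone h
  have h2 : expNegInvGlue (1 - y) ≤ expNegInvGlue (1 - x) := expNegInvGlue.monotone (by linarith)
  rw [div_le_div_iff₀ hx hy]
  nlinarith [expNegInvGlue.nonneg x, expNegInvGlue.nonneg y, expNegInvGlue.nonneg (1-x), expNegInvGlue.nonneg (1-y),
    mul_le_mul h1 h2 (expNegInvGlue.nonneg (1-y)) (expNegInvGlue.nonneg y)]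

lemma BB_nonneg (y : ℝ) : 0 ≤ BB y := sub_nonneg.2 (sT_mono (by linarith))

/-- finite set of integers that matters. -/
noncomputable def SB (y : ℝ) : Finset ℤ := Finset.Ico (⌊-y⌋) (⌊-y⌋ + 2)

lemma SB_out {y : ℝ} {n : ℤ} (h : n ∉ SB y) : BB (n + y) = 0 := by
  unfold SB at h
  rw [Finset.mem_Ico, not_and_or, not_le, not_lt] at h
  have h1 := Int.floor_le (-y)
  have h2 := Int.lt_floor_add_one (-y)
  rcases h with h | h
  · apply BB_zero_left
    have : ((n + 1 : ℤ) : ℝ) ≤ (⌊-y⌋ : ℤ) := by exact_mod_cast h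
    push_cast at this; linarith
  · apply BB_zero_right
    have : ((⌊-y⌋ + 2 : ℤ) : ℝ) ≤ (n : ℤ) := by exact_mod_cast h
    push_cast at this; linarith

lemma SB_sum (y : ℝ) : ∑ n ∈ SB y, BB (n + y) = 1 := by
  unfold SB
  have h1 := Int.floor_le (-y)
  have h2 := Int.lt_floor_add_one (-y)
  have e : Finset.Ico (⌊-y⌋) (⌊-y⌋ + 2) = {⌊-y⌋, ⌊-y⌋ + 1} := by
    ext n; simp only [Finset.mem_Ico, Finset.mem_insert, Finset.mem_singleton]; omega
  rw [e, Finset.sum_pair (by omega)]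
  unfold BB
  push_cast
  rw [Real.smoothTransition.one_of_one_le (x := (⌊-y⌋ : ℝ) + 1 + y + 1) (by linarith),
    Real.smoothTransition.zero_of_nonpos (x := (⌊-y⌋ : ℝ) + y) (by linarith),
    show (⌊-y⌋ : ℝ) + 1 + y = ⌊-y⌋ + y + 1 by ring]
  ring

lemma hasSum_BB {r : ℕ} (y : Fin r → ℝ) : HasSum (fun n : Fin r → ℤ => ∏ i, BB (n i + y i)) 1 := by
  have h := hasSum_sum_of_ne_finset_zero (L := SummationFilter.unconditional _) (f := fun n : Fin r → ℤ => ∏ i, BB (n i + y i))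
    (s := Fintype.piFinset fun i => SB (y i)) ?_
  · rwa [← Finset.prod_univ_sum (fun i => SB (y i)) (fun i (n : ℤ) => BB (n + y i)),
      Finset.prod_congr rfl (fun i _ => SB_sum (y i)), Finset.prod_const_one] at h
  · intro n hn
    rw [Fintype.mem_piFinset, not_forall] at hn
    obtain ⟨i, hi⟩ := hn
    exact Finset.prod_eq_zero (Finset.mem_univ i) (SB_out hi)

lemma hasSum_BB2 (T : Type*) [Finite T] {r : ℕ} (y : Fin r → ℝ) (c : ℝ) :
    HasSum (fun p : T × (Fin r → ℤ) => c * ∏ i, BB (p.2 i + y i)) (Nat.card T * c) := by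
  cases nonempty_fintype T
  have h0 : HasSum (fun _ : T => (1 : ℝ)) (Nat.card T) := by
    have := hasSum_fintype (fun _ : T => (1 : ℝ))
    rw [Finset.sum_const, nsmul_one] at this
    rwa [Nat.card_eq_fintype_card]
  have h1 := hasSum_BB y
  have hG1 : ∀ n : Fin r → ℤ, 0 ≤ ∏ i, BB (n i + y i) := fun n => Finset.prod_nonneg fun i _ => BB_nonneg _
  generalize hG : (fun n : Fin r → ℤ => ∏ i, BB (n i + y i)) = G at h1
  have hG0 : 0 ≤ G := by
    intro n
    rw [← hG]
    exact hG1 n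
  have hs : Summable (fun p : T × (Fin r → ℤ) => (fun _ : T => (1 : ℝ)) p.1 * G p.2) :=
    Summable.mul_of_nonneg h0.summable h1.summable (fun _ => zero_le_one) hG0
  have h2 := (h0.mul h1 hs).mul_left c
  rw [mul_one, mul_comm c] at h2
  subst hG
  simp only [one_mul] at h2
  exact h2

open scoped Classical
open NumberField.Units NumberField.Units.dirichletUnitTheorem NumberField.mixedEmbedding NumberField.InfinitePlace
variable (K : Type*) [Field K] [NumberField K]

/-- unit equivalence -/
noncomputable def uEquiv : torsion K × (Fin (rank K) → ℤ) ≃ (𝓞 K)ˣ :=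
  Equiv.ofBijective (fun p => p.1 * ∏ i, fundSystem K i ^ p.2 i) (by
    constructor
    · intro p q h
      obtain ⟨z, -, hz⟩ := exist_unique_eq_mul_prod K (p.1 * ∏ i, fundSystem K i ^ p.2 i)
      rw [hz p rfl, hz q h]
    · intro x
      obtain ⟨z, hz, -⟩ := exist_unique_eq_mul_prod K x
      exact ⟨z, hz.symm⟩)

/-- the real basis of log space -/
noncomputable def bL : Module.Basis (Fin (rank K)) ℝ (logSpace K) :=
  (basisUnitLattice K).ofZLatticeBasis ℝ (unitLattice K)

lemma log_uEquiv (p : torsion K × (Fin (rank K) → ℤ)) :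
    logEmbedding K (Additive.ofMul (uEquiv K p)) = ∑ i, (p.2 i : ℝ) • bL K i := by
  have h1 : logEmbedding K (Additive.ofMul (p.1 : (𝓞 K)ˣ)) = 0 := (logEmbedding_eq_zero_iff).2 p.1.2
  have h2 : uEquiv K p = p.1 * ∏ i, fundSystem K i ^ p.2 i := rfl
  rw [h2, ofMul_mul, map_add, h1, zero_add, ofMul_prod, map_sum]
  refine Finset.sum_congr rfl fun i _ => ?_
  rw [ofMul_zpow, map_zsmul, logEmbedding_fundSystem, bL, Module.Basis.ofZLatticeBasis_apply, Int.cast_smul_eq_zsmul]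

variable {K}
/-- log coordinates -/
noncomputable def YY (v : mixedSpace K) (i : Fin (rank K)) : ℝ := (bL K).repr (logMap v) i

lemma YY_unit (p : torsion K × (Fin (rank K) → ℤ)) (v : mixedSpace K) (hv : mixedEmbedding.norm v ≠ 0) (i) :
    YY (uEquiv K p • v) i = p.2 i + YY v i := by
  classical
  unfold YY
  rw [logMap_unit_smul _ hv, log_uEquiv, map_add, Finsupp.add_apply]
  simp [Finsupp.single_apply]

/-- weight function -/
noncomputable def FF (ψ : ℝ → ℝ) (v : mixedSpace K) : ℝ :=
  ψ (1 / mixedEmbedding.norm v) * ∏ i, BB (YY v i)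

lemma FF_hasSum (ψ : ℝ → ℝ) (v : mixedSpace K) (hv : mixedEmbedding.norm v ≠ 0) :
    HasSum (fun u : (𝓞 K)ˣ => FF ψ (u • v)) (torsionOrder K * ψ (1 / mixedEmbedding.norm v)) := by
  rw [← (uEquiv K).hasSum_iff]
  have e : ((fun u : (𝓞 K)ˣ => FF ψ (u • v)) ∘ uEquiv K) =
      fun p => ψ (1 / mixedEmbedding.norm v) * ∏ i, BB (p.2 i + YY v i) := by
    funext p
    simp only [Function.comp, FF, norm_unit_smul, YY_unit p v hv]
  rw [e]
  exact hasSum_BB2 (torsion K) (fun i => YY v i) _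

lemma nap_smooth (w : InfinitePlace K) (v : mixedSpace K) (hv : normAtPlace w v ≠ 0) :
    ContDiffAt ℝ ((⊤ : ℕ∞) : WithTop ℕ∞) (normAtPlace w) v := by
  rcases w.isReal_or_isComplex with h | h
  · have e : (normAtPlace w : mixedSpace K → ℝ) = fun x => ‖x.1 ⟨w, h⟩‖ := funext fun x => normAtPlace_apply_of_isReal h x
    rw [normAtPlace_apply_of_isReal h] at hv
    rw [e]
    exact ContDiffAt.norm ℝ (by fun_prop) (norm_ne_zero_iff.1 hv)
  · have e : (normAtPlace w : mixedSpace K → ℝ) = fun x => ‖x.2 ⟨w, h⟩‖ := funext fun x => normAtPlace_apply_of_isComplex h x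
    rw [normAtPlace_apply_of_isComplex h] at hv
    rw [e]
    exact ContDiffAt.norm ℝ (by fun_prop) (norm_ne_zero_iff.1 hv)

lemma norm_smooth (v : mixedSpace K) (hv : mixedEmbedding.norm v ≠ 0) :
    ContDiffAt ℝ ((⊤ : ℕ∞) : WithTop ℕ∞) (mixedEmbedding.norm : mixedSpace K → ℝ) v := by
  have e : (mixedEmbedding.norm : mixedSpace K → ℝ) = fun x => ∏ w, (normAtPlace w x) ^ (mult w) := rfl
  rw [e]
  exact contDiffAt_prod fun w _ => (nap_smooth w v (mixedEmbedding.norm_ne_zero_iff.1 hv w)).pow _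

lemma YY_smooth (v : mixedSpace K) (hv : mixedEmbedding.norm v ≠ 0) (i) :
    ContDiffAt ℝ ((⊤ : ℕ∞) : WithTop ℕ∞) (fun v : mixedSpace K => YY v i) v := by
  have h1 : ContDiffAt ℝ ((⊤ : ℕ∞) : WithTop ℕ∞) (logMap : mixedSpace K → logSpace K) v := by
    rw [contDiffAt_pi]
    intro w
    simp only [logMap_apply]
    have h3 : ContDiffAt ℝ ((⊤ : ℕ∞) : WithTop ℕ∞) (fun v : mixedSpace K => Real.log (normAtPlace w.1 v)) v :=
      (nap_smooth w.1 v (mixedEmbedding.norm_ne_zero_iff.1 hv w.1)).log (mixedEmbedding.norm_ne_zero_iff.1 hv w.1)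
    have h4 : ContDiffAt ℝ ((⊤ : ℕ∞) : WithTop ℕ∞) (fun v : mixedSpace K => Real.log (mixedEmbedding.norm v)) v :=
      (norm_smooth v hv).log hv
    have h5 := h3.sub (h4.mul (contDiffAt_const (c := (Module.finrank ℚ K : ℝ)⁻¹)))
    exact (contDiffAt_const (c := (mult w.1 : ℝ))).mul h5
  have h2 : ContDiff ℝ ((⊤ : ℕ∞) : WithTop ℕ∞) (fun x : logSpace K => (bL K).coord i x) :=
    (LinearMap.toContinuousLinearMap ((bL K).coord i)).contDiff
  exact h2.contDiffAt.comp v h1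

lemma norm_cont : Continuous (mixedEmbedding.norm : mixedSpace K → ℝ) := by
  have e : (mixedEmbedding.norm : mixedSpace K → ℝ) = fun x => ∏ w, (normAtPlace w x) ^ (mult w) := rfl
  rw [e]
  exact continuous_finsetProd _ fun w _ => (continuous_normAtPlace w).pow _

lemma TestFn.b_pos {ψ : ℝ → ℝ} {a b : ℝ} (hψ : TestFn ψ a b) : 0 < b := by
  by_contra h
  have := hψ.one_pos
  rw [hψ.zero_b 1 (by linarith)] at this
  exact lt_irrefl _ this

lemma FF_smooth {ψ : ℝ → ℝ} {a b : ℝ} (hψ : TestFn ψ a b) (hs : ContDiff ℝ ((⊤ : ℕ∞) : WithTop ℕ∞) ψ) :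
    ContDiff ℝ ((⊤ : ℕ∞) : WithTop ℕ∞) (FF ψ : mixedSpace K → ℝ) := by
  rw [contDiff_iff_contDiffAt]
  intro v
  by_cases hv : mixedEmbedding.norm v = 0
  · have hb := hψ.b_pos
    have : (FF ψ : mixedSpace K → ℝ) =ᶠ[𝓝 v] fun _ => 0 := by
      have h1 : ∀ᶠ x in 𝓝 v, mixedEmbedding.norm x < 1 / b :=
        norm_cont.continuousAt.eventually_lt continuousAt_const (by rw [hv]; positivity)
      filter_upwards [h1] with x hx
      rw [FF]
      rcases (mixedEmbedding.norm_nonneg x).eq_or_lt with h0 | h0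
      · rw [← h0, div_zero, hψ.zero_a 0 hψ.a_pos.le, zero_mul]
      · rw [hψ.zero_b _ ?_, zero_mul]
        rw [le_div_iff₀ h0]
        rw [lt_div_iff₀ hb] at hx; linarith
    exact contDiffAt_const.congr_of_eventuallyEq this
  · unfold FF
    have h1 : ContDiffAt ℝ ((⊤ : ℕ∞) : WithTop ℕ∞) (fun v : mixedSpace K => ∏ i, BB (YY v i)) v :=
      contDiffAt_prod fun i _ => BB_smooth.contDiffAt.comp v (YY_smooth v hv i)
    have h2 : ContDiffAt ℝ ((⊤ : ℕ∞) : WithTop ℕ∞) (fun v : mixedSpace K => 1 / mixedEmbedding.norm v) v :=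
      contDiffAt_const.div (norm_smooth v hv) hv
    have h3 : ContDiffAt ℝ ((⊤ : ℕ∞) : WithTop ℕ∞) (fun v : mixedSpace K => ψ (1 / mixedEmbedding.norm v)) v :=
      hs.contDiffAt.comp v h2
    exact h3.mul h1

lemma FF_supp {ψ : ℝ → ℝ} {a b : ℝ} (hψ : TestFn ψ a b) : ∃ C : ℝ, ∀ v : mixedSpace K, FF ψ v ≠ 0 → ‖v‖ ≤ C := by
  have ha := hψ.a_pos
  have hb := hψ.b_pos
  obtain ⟨D, hD⟩ : ∃ D : ℝ, D = |Real.log a| + |Real.log b| := ⟨_, rfl⟩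
  obtain ⟨A, hA⟩ : ∃ A : ℝ, A = ∑ i, ‖bL K i‖ := ⟨_, rfl⟩
  have hA0 : 0 ≤ A := hA ▸ Finset.sum_nonneg fun _ _ => norm_nonneg _
  have hD0 : 0 ≤ D := by rw [hD]; positivity
  obtain ⟨c, hc⟩ : ∃ c : ℝ, c = A + D := ⟨_, rfl⟩
  have hc0 : 0 ≤ c := by linarith
  obtain ⟨n, hn⟩ : ∃ n : ℝ, n = (Fintype.card (InfinitePlace K) : ℝ) * (2 * c) := ⟨_, rfl⟩
  have hcn : 0 ≤ n := by rw [hn]; positivity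
  have hfr : 1 ≤ (Module.finrank ℚ K : ℝ) := by exact_mod_cast (Module.finrank_pos : 0 < Module.finrank ℚ K)
  refine ⟨Real.exp (D + n + c), fun v hv => ?_⟩
  unfold FF at hv
  have hψv := left_ne_zero_of_mul hv
  have hB := right_ne_zero_of_mul hv
  have hN0 : 0 < mixedEmbedding.norm v := by
    rcases (mixedEmbedding.norm_nonneg v).eq_or_lt with h0 | h0
    · exfalso; apply hψv; rw [← h0, div_zero, hψ.zero_a 0 ha.le]
    · exact h0
  have hNl : |Real.log (mixedEmbedding.norm v)| ≤ D := by
    have h1 : a < 1 / mixedEmbedding.norm v := by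
      by_contra h; exact hψv (hψ.zero_a _ (not_lt.1 h))
    have h2 : 1 / mixedEmbedding.norm v < b := by
      by_contra h; exact hψv (hψ.zero_b _ (not_lt.1 h))
    have h3 := Real.log_le_log ha h1.le
    have h4 := Real.log_le_log (by positivity) h2.le
    rw [one_div, Real.log_inv] at h3 h4
    rw [abs_le]
    constructor
    · have := le_abs_self (Real.log b); have := abs_nonneg (Real.log a); linarith
    · have := neg_abs_le (Real.log a); have := abs_nonneg (Real.log b); linarith
  have hYY : ∀ i, |YY v i| ≤ 1 := fun i => BB_abs (Finset.prod_ne_zero_iff.1 hB i (Finset.mem_univ i))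
  have hlog : ‖logMap v‖ ≤ A := by
    rw [← (bL K).sum_repr (logMap v), hA]
    refine (norm_sum_le _ _).trans (Finset.sum_le_sum fun i _ => ?_)
    rw [_root_.norm_smul]
    exact mul_le_of_le_one_left (norm_nonneg _) (hYY i)
  have hne : ∀ w, normAtPlace w v ≠ 0 := mixedEmbedding.norm_ne_zero_iff.1 hN0.ne'
  have hw : ∀ w : InfinitePlace K, w ≠ w₀ → |Real.log (normAtPlace w v)| ≤ c := by
    intro w hww
    have h1 : |logMap v ⟨w, hww⟩| ≤ A := (norm_le_pi_norm (logMap v) ⟨w, hww⟩).trans hlog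
    rw [logMap_apply, abs_mul] at h1
    have h2 : 1 ≤ |((mult w : ℕ) : ℝ)| := by
      rw [Nat.abs_cast]; exact_mod_cast mult_pos
    have h3 : |Real.log (normAtPlace w v) - Real.log (mixedEmbedding.norm v) * (Module.finrank ℚ K : ℝ)⁻¹| ≤ A :=
      (le_mul_of_one_le_left (abs_nonneg _) h2).trans h1
    have h4 : |Real.log (mixedEmbedding.norm v) * (Module.finrank ℚ K : ℝ)⁻¹| ≤ D := by
      rw [abs_mul, abs_of_nonneg (by positivity : 0 ≤ (Module.finrank ℚ K : ℝ)⁻¹)]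
      exact (mul_le_of_le_one_right (abs_nonneg _) (inv_le_one_of_one_le₀ hfr)).trans hNl
    have h5 := abs_add_le (Real.log (normAtPlace w v) - Real.log (mixedEmbedding.norm v) * (Module.finrank ℚ K : ℝ)⁻¹)
      (Real.log (mixedEmbedding.norm v) * (Module.finrank ℚ K : ℝ)⁻¹)
    rw [sub_add_cancel] at h5
    linarith
  have hlogN : Real.log (mixedEmbedding.norm v) = ∑ w, (mult w : ℝ) * Real.log (normAtPlace w v) := by
    rw [mixedEmbedding.norm_apply, Real.log_prod (fun w _ => pow_ne_zero _ (hne w))]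
    simp
  have hm2 : ∀ w : InfinitePlace K, (mult w : ℝ) ≤ 2 := by
    intro w; unfold mult; split_ifs <;> norm_num
  have hw0 : Real.log (normAtPlace w₀ v) ≤ D + n := by
    classical
    rw [← Finset.add_sum_erase _ _ (Finset.mem_univ (w₀ : InfinitePlace K))] at hlogN
    have h1 : |∑ w ∈ Finset.univ.erase (w₀ : InfinitePlace K), (mult w : ℝ) * Real.log (normAtPlace w v)| ≤ n := by
      refine (Finset.abs_sum_le_sum_abs _ _).trans ((Finset.sum_le_card_nsmul _ _ (2 * c) ?_).trans ?_)
      · intro w hww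
        rw [abs_mul, Nat.abs_cast]
        exact mul_le_mul (hm2 w) (hw w (Finset.ne_of_mem_erase hww)) (abs_nonneg _) (by norm_num)
      · rw [nsmul_eq_mul, hn]
        refine mul_le_mul_of_nonneg_right ?_ (by linarith)
        exact_mod_cast Finset.card_le_univ _
    have h2 := (abs_le.1 h1).1
    have h3 := (abs_le.1 hNl).2
    have h4 : (mult (w₀ : InfinitePlace K) : ℝ) * Real.log (normAtPlace w₀ v) ≤ D + n := by linarith
    have h5 : (1 : ℝ) ≤ mult (w₀ : InfinitePlace K) := by exact_mod_cast mult_pos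
    by_cases h6 : 0 ≤ Real.log (normAtPlace w₀ v)
    · exact (le_mul_of_one_le_left h6 h5).trans h4
    · exact (not_le.1 h6).le.trans (by linarith)
  rw [norm_eq_sup'_normAtPlace, Finset.sup'_le_iff]
  intro w _
  have hp : 0 < normAtPlace w v := lt_of_le_of_ne (normAtPlace_nonneg w v) (hne w).symm
  rw [← Real.log_le_iff_le_exp hp]
  by_cases h : w = w₀
  · subst h; linarith
  · have := (abs_le.1 (hw w h)).2; linarith

theorem weight {ψ : ℝ → ℝ} {a b : ℝ} (hψ : TestFn ψ a b) (hs : ContDiff ℝ ((⊤ : ℕ∞) : WithTop ℕ∞) ψ) :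
    HasCompactSupport (FF ψ : mixedSpace K → ℝ) ∧ 0 < ∫ v : mixedSpace K, FF ψ v := by
  obtain ⟨C, hC⟩ := FF_supp (K := K) hψ
  have hcs : HasCompactSupport (FF ψ : mixedSpace K → ℝ) :=
    HasCompactSupport.intro (isCompact_closedBall 0 C) fun x hx => by
      by_contra h; exact hx (by simpa using hC x h)
  refine ⟨hcs, ?_⟩
  refine (FF_smooth hψ hs).continuous.integral_pos_of_hasCompactSupport_nonneg_nonzero hcs
    (fun v => mul_nonneg (hψ.nonneg _) (Finset.prod_nonneg fun i _ => BB_nonneg _)) (x := 1) ?_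
  have : FF ψ (1 : mixedSpace K) = ψ 1 := by
    unfold FF YY
    simp [BB_zero]
  rw [this]; exact hψ.one_pos.ne'

end PartF
end OrdPf

namespace OrdPf
open Filter Topology MeasureTheory Set

section PartC
open scoped Classical nonZeroDivisors
open NumberField.mixedEmbedding
variable {K : Type*} [Field K] [NumberField K]

variable (K) in
/-- covolume of the ring of integers -/
noncomputable def V0 : ℝ := (volume : Measure (mixedSpace K)).real (ZSpan.fundamentalDomain (latticeBasis K))

lemma V0_pos : 0 < V0 K := FD_pos _ _

/-- coset as lattice translate -/
lemma coset_equiv (J : Ideal (𝓞 K)) (hJ : J ≠ ⊥) (c : 𝓞 K) :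
    ∃ (ι : Type) (_ : Fintype ι) (b : Module.Basis ι ℝ (mixedSpace K))
      (e : {ε : 𝓞 K // ε - c ∈ J} ≃ Submodule.span ℤ (Set.range b)),
      (volume : Measure (mixedSpace K)).real (ZSpan.fundamentalDomain b) = Ideal.absNorm J * V0 K ∧
      ∀ ε, mixedEmbedding K ε.1 = mixedEmbedding K c + (e ε : mixedSpace K) := by
  set I : (FractionalIdeal (𝓞 K)⁰ K)ˣ := FractionalIdeal.mk0 K ⟨J, mem_nonZeroDivisors_of_ne_zero hJ⟩ with hI
  set b0 := fractionalIdealLatticeBasis K I with hb0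
  obtain ⟨n, ⟨e0⟩⟩ := Finite.exists_equiv_fin (Module.Free.ChooseBasisIndex ℤ I)
  set b := b0.reindex e0 with hb
  have hrange : Set.range b = Set.range b0 := by
    rw [hb, Module.Basis.range_reindex]
  have hmem : ∀ x, x ∈ Submodule.span ℤ (Set.range b) ↔ ∃ y : 𝓞 K, y ∈ J ∧ mixedEmbedding K y = x := by
    intro x
    rw [hrange, mem_span_fractionalIdealLatticeBasis]
    constructor
    · rintro ⟨y, hy, rfl⟩
      have : y ∈ (J : FractionalIdeal (𝓞 K)⁰ K) := hy
      rw [FractionalIdeal.mem_coeIdeal] at this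
      obtain ⟨z, hz, rfl⟩ := this
      exact ⟨z, hz, rfl⟩
    · rintro ⟨y, hy, rfl⟩
      refine ⟨y, ?_, rfl⟩
      have : (algebraMap (𝓞 K) K y) ∈ (J : FractionalIdeal (𝓞 K)⁰ K) := FractionalIdeal.mem_coeIdeal_of_mem _ hy
      exact this
  have hinj : Function.Injective (fun y : 𝓞 K => mixedEmbedding K (y : K)) :=
    (mixedEmbedding_injective K).comp RingOfIntegers.coe_injective
  let ef : {ε : 𝓞 K // ε - c ∈ J} → Submodule.span ℤ (Set.range b) := fun ε =>
    ⟨mixedEmbedding K (ε.1 - c : 𝓞 K), (hmem _).2 ⟨_, ε.2, rfl⟩⟩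
  have hef : Function.Bijective ef := by
    constructor
    · intro ε ε' h
      have := hinj (congrArg Subtype.val h)
      exact Subtype.ext (sub_left_injective this)
    · rintro ⟨x, hx⟩
      obtain ⟨y, hy, rfl⟩ := (hmem x).1 hx
      exact ⟨⟨y + c, by simpa using hy⟩, Subtype.ext (by simp [ef])⟩
  refine ⟨Fin n, inferInstance, b, Equiv.ofBijective ef hef, ?_, ?_⟩
  · rw [hb, ZSpan.fundamentalDomain_reindex, measureReal_def, hb0,
      volume_fundamentalDomain_fractionalIdealLatticeBasis, ENNReal.toReal_mul, V0, measureReal_def, hI, FractionalIdeal.coe_mk0,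
      FractionalIdeal.coeIdeal_absNorm, ENNReal.toReal_ofReal (by positivity)]
    simp
  · intro ε
    simp [Equiv.ofBijective, ef]

theorem coset_sum (J : Ideal (𝓞 K)) (hJ : J ≠ ⊥) (c : 𝓞 K) (f : mixedSpace K → ℝ)
    (hf : ContDiff ℝ ((⊤ : ℕ∞) : WithTop ℕ∞) f) (hfc : HasCompactSupport f) :
    (∃ C : ℝ, ∀ t : ℝ, 1 ≤ t →
      |∑' ε : 𝓞 K, (if ε - c ∈ J then f (t⁻¹ • mixedEmbedding K ε) else 0) -
        t ^ Module.finrank ℚ K * ((∫ x, f x) / (Ideal.absNorm J * V0 K))| ≤ C) ∧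
    ∀ t : ℝ, 1 ≤ t → Summable fun ε : 𝓞 K => (if ε - c ∈ J then f (t⁻¹ • mixedEmbedding K ε) else 0) := by
  obtain ⟨ι, _, b, e, hv, he⟩ := coset_equiv J hJ c
  have key : ∀ t : ℝ, (fun l : Submodule.span ℤ (Set.range b) => f (t⁻¹ • (mixedEmbedding K c + (l : mixedSpace K)))) ∘ e =
      fun ε : {ε : 𝓞 K | ε - c ∈ J} => f (t⁻¹ • mixedEmbedding K (ε.1 : K)) := by
    intro t; funext ε; simp only [Function.comp]; rw [← he]
  have ind : ∀ t : ℝ, (fun ε : 𝓞 K => (if ε - c ∈ J then f (t⁻¹ • mixedEmbedding K ε) else 0)) =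
      indicator {ε : 𝓞 K | ε - c ∈ J} (fun ε => f (t⁻¹ • mixedEmbedding K ε)) := by
    intro t; funext ε; simp [indicator]
  refine ⟨?_, ?_⟩
  · obtain ⟨C, hC⟩ := lattice_sum volume b f hf hfc (mixedEmbedding K c)
    refine ⟨C, fun t ht => ?_⟩
    have := hC t ht
    rw [hv, mixedEmbedding.finrank, ← e.tsum_eq] at this
    rw [ind, ← tsum_subtype, ← key]
    exact this
  · intro t ht
    rw [ind, ← summable_subtype_iff_indicator]
    have : Summable ((fun l : Submodule.span ℤ (Set.range b) => f (t⁻¹ • (mixedEmbedding K c + (l : mixedSpace K)))) ∘ e) := by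
      rw [e.summable_iff]
      obtain ⟨R, hR⟩ := hfc.isCompact.isBounded.exists_norm_le
      exact lat_summable b (g := f) (R := R) ⟨hf.continuous, fun x hx => by
        by_contra hn
        exact absurd (hR x (subset_tsupport f hn)) (not_le.2 hx)⟩ (inv_pos.2 (by linarith)) _
    rw [key] at this
    exact this

theorem E_sum (I F : Ideal (𝓞 K)) (hI : I ≠ ⊥) (hF : F ≠ ⊥) (hco : IsCoprime I F) (A : Set (𝓞 K ⧸ F))
    (f : mixedSpace K → ℝ)
    (hf : ContDiff ℝ ((⊤ : ℕ∞) : WithTop ℕ∞) f) (hfc : HasCompactSupport f) :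
    (∃ C : ℝ, ∀ t : ℝ, 1 ≤ t →
      |∑' ε : 𝓞 K, (if ε ∈ I ∧ Ideal.Quotient.mk F ε ∈ A then f (t⁻¹ • mixedEmbedding K ε) else 0) -
        t ^ Module.finrank ℚ K * (Nat.card A * (∫ x, f x) / (Ideal.absNorm I * Ideal.absNorm F * V0 K))| ≤ C) ∧
    ∀ t : ℝ, 1 ≤ t → Summable fun ε : 𝓞 K => (if ε ∈ I ∧ Ideal.Quotient.mk F ε ∈ A then f (t⁻¹ • mixedEmbedding K ε) else 0) := by
  haveI : Finite (𝓞 K ⧸ F) := Ideal.finiteQuotientOfFreeOfNeBot F hF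
  haveI : Fintype A := Fintype.ofFinite _
  have hex : ∀ a : A, ∃ c : 𝓞 K, c ∈ I ∧ Ideal.Quotient.mk F c = a := by
    intro a
    obtain ⟨y, hy⟩ := Ideal.Quotient.mk_surjective (a : 𝓞 K ⧸ F)
    obtain ⟨i, hi, g, hg, h1⟩ := Ideal.isCoprime_iff_exists.1 hco
    refine ⟨y * i, I.mul_mem_left _ hi, ?_⟩
    rw [← hy, Ideal.Quotient.eq]
    have : y * i - y = - (y * g) := by linear_combination y * h1
    rw [this]
    exact F.neg_mem (F.mul_mem_left _ hg)
  choose c hc hca using hex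
  have hIF : I * F ≠ ⊥ := mul_ne_zero hI hF
  have hmem : ∀ (a : A) (ε : 𝓞 K), ε - c a ∈ I * F ↔ ε ∈ I ∧ Ideal.Quotient.mk F ε = a := by
    intro a ε
    rw [Ideal.mul_eq_inf_of_coprime (Ideal.isCoprime_iff_sup_eq.1 hco), Ideal.mem_inf, ← hca a, Ideal.Quotient.eq]
    rw [Submodule.sub_mem_iff_left _ (hc a)]
  have split : ∀ t : ℝ, (fun ε : 𝓞 K => (if ε ∈ I ∧ Ideal.Quotient.mk F ε ∈ A then f (t⁻¹ • mixedEmbedding K ε) else 0)) =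
      fun ε => ∑ a : A, (if ε - c a ∈ I * F then f (t⁻¹ • mixedEmbedding K ε) else 0) := by
    intro t; funext ε
    simp_rw [hmem]
    by_cases h1 : ε ∈ I
    · by_cases h2 : Ideal.Quotient.mk F ε ∈ A
      · rw [if_pos ⟨h1, h2⟩, Finset.sum_eq_single (⟨_, h2⟩ : A)]
        · rw [if_pos ⟨h1, rfl⟩]
        · intro a _ ha
          rw [if_neg]
          rintro ⟨-, h⟩
          exact ha (Subtype.ext h.symm)
        · simp
      · rw [if_neg (fun h => h2 h.2), Finset.sum_eq_zero]
        intro a _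
        rw [if_neg]
        rintro ⟨-, h⟩
        exact h2 (h ▸ a.2)
    · rw [if_neg (fun h => h1 h.1), Finset.sum_eq_zero]
      intro a _
      rw [if_neg (fun h => h1 h.1)]
  have H := fun a : A => coset_sum (I * F) hIF (c a) f hf hfc
  choose C hC using fun a => (H a).1
  refine ⟨⟨∑ a, C a, fun t ht => ?_⟩, fun t ht => ?_⟩
  · rw [split, Summable.tsum_finsetSum (fun a _ => (H a).2 t ht)]
    have e : t ^ Module.finrank ℚ K * (Nat.card A * (∫ x, f x) / (Ideal.absNorm I * Ideal.absNorm F * V0 K)) =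
        ∑ a : A, t ^ Module.finrank ℚ K * ((∫ x, f x) / (Ideal.absNorm (I * F) * V0 K)) := by
      rw [Finset.sum_const, Finset.card_univ, nsmul_eq_mul, Nat.card_eq_fintype_card, map_mul]
      push_cast; ring
    rw [e, ← Finset.sum_sub_distrib]
    exact (Finset.abs_sum_le_sum_abs _ _).trans (Finset.sum_le_sum fun a _ => hC a t ht)
  · rw [split]
    exact summable_sum fun a _ => (H a).2 t ht

end PartC
end OrdPf

namespace OrdPf
open Filter Topology MeasureTheory Set

section PartD
open scoped Classical
variable {K : Type*} [Field K] [NumberField K]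

/-- primes coprime to F -/
abbrev PI (F : Ideal (𝓞 K)) := {v : IsDedekindDomain.HeightOneSpectrum (𝓞 K) // IsCoprime v.asIdeal F}

/-- ideal attached to an exponent vector -/
noncomputable def Id (F : Ideal (𝓞 K)) (m : PI F →₀ ℕ) : Ideal (𝓞 K) := m.prod fun p k => p.1.asIdeal ^ k

variable (F : Ideal (𝓞 K))

lemma Id_zero : Id F 0 = 1 := Finsupp.prod_zero_index

lemma Id_add (m n : PI F →₀ ℕ) : Id F (m + n) = Id F m * Id F n :=
  Finsupp.prod_add_index' (by simp) (by intros; exact pow_add _ _ _)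

lemma Id_single (p : PI F) : Id F (Finsupp.single p 1) = p.1.asIdeal := by
  simp [Id]

lemma Id_nsmul (k : ℕ) (m : PI F →₀ ℕ) : Id F (k • m) = Id F m ^ k := by
  induction k with
  | zero => simp [Id_zero]
  | succ k ih => rw [succ_nsmul, Id_add, ih, pow_succ]

lemma Id_ne_bot (m : PI F →₀ ℕ) : Id F m ≠ ⊥ := by
  unfold Id Finsupp.prod
  exact Finset.prod_ne_zero_iff.2 fun p _ => pow_ne_zero _ p.1.ne_bot

lemma Id_coprime (m : PI F →₀ ℕ) : IsCoprime (Id F m) F := by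
  unfold Id Finsupp.prod
  exact IsCoprime.prod_left fun p _ => p.2.pow_left

lemma Id_multiset (m : PI F →₀ ℕ) :
    Id F m = ((Finsupp.toMultiset m).map fun p : PI F => p.1.asIdeal).prod := by
  rw [Finsupp.toMultiset_map, Finsupp.prod_toMultiset, Finsupp.prod_mapDomain_index]
  · rfl
  · simp
  · intros; exact pow_add _ _ _

lemma Id_factors (m : PI F →₀ ℕ) :
    UniqueFactorizationMonoid.normalizedFactors (Id F m) = (Finsupp.toMultiset m).map fun p : PI F => p.1.asIdeal := by
  rw [Id_multiset, UniqueFactorizationMonoid.normalizedFactors_prod_of_prime]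
  intro p hp
  obtain ⟨q, -, rfl⟩ := Multiset.mem_map.1 hp
  exact q.1.prime

lemma Id_injective : Function.Injective (Id F) := by
  intro m n h
  have := Id_factors F m
  rw [h, Id_factors] at this
  have hinj : Function.Injective fun p : PI F => p.1.asIdeal := by
    intro p q hpq
    exact Subtype.ext (IsDedekindDomain.HeightOneSpectrum.ext hpq)
  exact ((Multiset.toFinsupp (α := PI F)).symm.injective (Multiset.map_injective hinj this)).symm

lemma Id_surj (I : Ideal (𝓞 K)) (hI : I ≠ ⊥) (hco : IsCoprime I F) : ∃ m, Id F m = I := by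
  revert hI hco
  refine UniqueFactorizationMonoid.induction_on_prime
    (P := fun I => I ≠ ⊥ → IsCoprime I F → ∃ m, Id F m = I) I ?_ ?_ ?_
  · intro h; exact absurd rfl h
  · intro I hI _ _
    exact ⟨0, by rw [Id_zero, Ideal.one_eq_top]; exact (Ideal.isUnit_iff.1 hI).symm⟩
  · intro a p ha hp ih _ hco
    obtain ⟨m, hm⟩ := ih ha (IsCoprime.of_mul_left_right hco)
    refine ⟨Finsupp.single ⟨⟨p, Ideal.isPrime_of_prime hp, hp.ne_zero⟩, IsCoprime.of_mul_left_left hco⟩ 1 + m, ?_⟩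
    rw [Id_add, Id_single, hm]

/-- norm of prime -/
noncomputable def NP (p : PI F) : ℕ := Ideal.absNorm p.1.asIdeal

lemma NP_two (p : PI F) : 2 ≤ NP F p := by
  unfold NP
  have h0 : Ideal.absNorm p.1.asIdeal ≠ 0 := by
    rw [Ne, Ideal.absNorm_eq_zero_iff]; exact p.1.ne_bot
  have h1 : Ideal.absNorm p.1.asIdeal ≠ 1 := by
    rw [Ne, Ideal.absNorm_eq_one_iff]; exact p.1.isPrime.ne_top
  omega

lemma nm_Id (m : PI F →₀ ℕ) : nm (NP F) m = Ideal.absNorm (Id F m) := by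
  unfold nm Id Finsupp.prod NP
  rw [map_prod]; push_cast
  refine Finset.prod_congr rfl fun p _ => ?_
  rw [map_pow]; push_cast; rfl

lemma nm_fin (X : ℝ) : {m | nm (NP F) m ≤ X}.Finite := by
  have := Ideal.finite_setOf_absNorm_le (S := 𝓞 K) ⌊X⌋₊
  refine Set.Finite.subset (this.preimage (f := Id F) (Id_injective F).injOn) ?_
  intro m hm
  simp only [Set.mem_preimage, Set.mem_ofPred_eq] at hm ⊢
  rw [nm_Id] at hm
  exact Nat.le_floor hm

end PartD
end OrdPf

namespace OrdPf
open Filter Topology MeasureTheory Set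

section PartB
open scoped Classical nonZeroDivisors
variable {K : Type*} [Field K] [NumberField K]

/-- contraction to R -/
noncomputable def con (R : Subring (𝓞 K)) (I : Ideal (𝓞 K)) : Ideal R := I.comap R.subtype

lemma mem_con {R : Subring (𝓞 K)} {I : Ideal (𝓞 K)} {x : R} : x ∈ con R I ↔ (x : 𝓞 K) ∈ I := Iff.rfl

variable {R : Subring (𝓞 K)} {F : Ideal (𝓞 K)}

lemma con_mul (hFR : ∀ x ∈ F, x ∈ R) {I J : Ideal (𝓞 K)} (hI : IsCoprime I F) (hJ : IsCoprime J F) :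
    con R (I * J) = con R I * con R J := by
  obtain ⟨i, hi, f, hf, h1⟩ := Ideal.isCoprime_iff_exists.1 hI
  obtain ⟨j, hj, f', hf', h2⟩ := Ideal.isCoprime_iff_exists.1 hJ
  have iR : i ∈ R := by
    have : i = 1 - f := by linear_combination h1
    rw [this]; exact R.sub_mem R.one_mem (hFR _ hf)
  have jR : j ∈ R := by
    have : j = 1 - f' := by linear_combination h2
    rw [this]; exact R.sub_mem R.one_mem (hFR _ hf')
  apply le_antisymm
  · rintro x hx
    rw [mem_con] at hx
    have key : ∀ z ∈ I * J, ∃ y ∈ con R I * con R J, (y : 𝓞 K) = z * f * f' := by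
      intro z hz
      refine Submodule.mul_induction_on hz ?_ ?_
      · intro a ha b hb
        refine ⟨⟨a * f, hFR _ (F.mul_mem_left _ hf)⟩ * ⟨b * f', hFR _ (F.mul_mem_left _ hf')⟩,
          Ideal.mul_mem_mul (mem_con.2 (I.mul_mem_right f ha)) (mem_con.2 (J.mul_mem_right f' hb)), ?_⟩
        simp only [Subring.coe_mul]; ring
      · rintro a b ⟨y, hy, hy'⟩ ⟨z, hz, hz'⟩
        refine ⟨y + z, Ideal.add_mem _ hy hz, ?_⟩
        rw [Subring.coe_add, hy', hz']; ring
    obtain ⟨y, hy, hy'⟩ := key _ hx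
    have hx2 : (x : 𝓞 K) ∈ I ⊓ J := (Ideal.mul_le_inf : I * J ≤ I ⊓ J) hx
    have xI : x ∈ con R I := mem_con.2 hx2.1
    have xJ : x ∈ con R J := mem_con.2 hx2.2
    obtain ⟨i', hi'⟩ : ∃ z : R, (z : 𝓞 K) = i := ⟨⟨i, iR⟩, rfl⟩
    obtain ⟨j', hj'⟩ : ∃ z : R, (z : 𝓞 K) = j := ⟨⟨j, jR⟩, rfl⟩
    obtain ⟨g, hg⟩ : ∃ z : R, (z : 𝓞 K) = f := ⟨⟨f, hFR _ hf⟩, rfl⟩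
    obtain ⟨g', hg'⟩ : ∃ z : R, (z : 𝓞 K) = f' := ⟨⟨f', hFR _ hf'⟩, rfl⟩
    have iI : i' ∈ con R I := mem_con.2 (hi' ▸ hi)
    have jJ : j' ∈ con R J := mem_con.2 (hj' ▸ hj)
    have e : x = (x * i') * j' + i' * (x * g') + (x * g) * j' + y := by
      apply Subtype.ext
      simp only [Subring.coe_add, Subring.coe_mul, hy', hi', hj', hg, hg']
      linear_combination (- (x : 𝓞 K) * (j + f')) * h1 - (x : 𝓞 K) * h2
    rw [e]
    refine Ideal.add_mem _ (Ideal.add_mem _ (Ideal.add_mem _ ?_ ?_) ?_) hy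
    · exact Ideal.mul_mem_mul (Ideal.mul_mem_right _ _ xI) jJ
    · exact Ideal.mul_mem_mul iI (Ideal.mul_mem_right _ _ xJ)
    · exact Ideal.mul_mem_mul (Ideal.mul_mem_right _ _ xI) jJ
  · rw [Ideal.mul_le]
    intro a ha b hb
    rw [mem_con, Subring.coe_mul]
    exact Ideal.mul_mem_mul (mem_con.1 ha) (mem_con.1 hb)

lemma con_map (hFR : ∀ x ∈ F, x ∈ R) {I : Ideal (𝓞 K)} (hI : IsCoprime I F) :
    (con R I).map R.subtype = I := by
  apply le_antisymm
  · exact Ideal.map_comap_le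
  · intro x hx
    obtain ⟨i, hi, f, hf, h1⟩ := Ideal.isCoprime_iff_exists.1 hI
    have iR : i ∈ R := by
      have : i = 1 - f := by linear_combination h1
      rw [this]; exact R.sub_mem R.one_mem (hFR _ hf)
    have e : x = x * i + x * f := by linear_combination (-x) * h1
    rw [e]
    refine Ideal.add_mem _ ?_ ?_
    · exact Ideal.mul_mem_left _ _ (Ideal.mem_map_of_mem R.subtype (x := (⟨i, iR⟩ : R)) (mem_con.2 hi))
    · exact Ideal.mem_map_of_mem R.subtype (x := (⟨x * f, hFR _ (F.mul_mem_left _ hf)⟩ : R)) (mem_con.2 (I.mul_mem_right f hx))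

/-- exponent of the units modulo F -/
noncomputable def ee (F : Ideal (𝓞 K)) : ℕ := Nat.card (𝓞 K ⧸ F)ˣ

lemma ee_pos (hF : F ≠ ⊥) : 0 < ee F := by
  haveI : Finite (𝓞 K ⧸ F) := Ideal.finiteQuotientOfFreeOfNeBot F hF
  exact Nat.card_pos

lemma isUnit_mk {x : 𝓞 K} : IsUnit (Ideal.Quotient.mk F x) ↔ IsCoprime (Ideal.span {x}) F := by
  rw [Ideal.isCoprime_iff_exists]
  constructor
  · intro h
    obtain ⟨y, hy⟩ := h.exists_right_inv
    obtain ⟨y, rfl⟩ := Ideal.Quotient.mk_surjective y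
    rw [← map_mul, ← map_one (Ideal.Quotient.mk F), eq_comm, Ideal.Quotient.eq] at hy
    exact ⟨x * y, Ideal.mul_mem_right _ _ (Ideal.mem_span_singleton_self x), _, hy, by ring⟩
  · rintro ⟨i, hi, f, hf, h⟩
    obtain ⟨y, rfl⟩ := Ideal.mem_span_singleton'.1 hi
    refine IsUnit.of_mul_eq_one (Ideal.Quotient.mk F y) ?_
    rw [← map_mul, ← map_one (Ideal.Quotient.mk F), eq_comm, Ideal.Quotient.eq]
    have : 1 - x * y = f := by linear_combination -h
    rw [this]; exact hf

lemma pow_ee {x : 𝓞 K} (hF : F ≠ ⊥) (hx : IsCoprime (Ideal.span {x}) F) : x ^ ee F - 1 ∈ F := by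
  haveI : Finite (𝓞 K ⧸ F) := Ideal.finiteQuotientOfFreeOfNeBot F hF
  obtain ⟨u, hu⟩ := isUnit_mk.2 hx
  rw [← Ideal.Quotient.eq, map_pow, map_one, ← hu, ← Units.val_pow_eq_pow_val, ee, pow_card_eq_one', Units.val_one]

lemma mem_R_of_sub_one (hFR : ∀ x ∈ F, x ∈ R) {x : 𝓞 K} (hx : x - 1 ∈ F) : x ∈ R := by
  have : x = (x - 1) + 1 := by ring
  rw [this]; exact R.add_mem (hFR _ hx) R.one_mem

lemma con_span (hFR : ∀ x ∈ F, x ∈ R) (hF : F ≠ ⊥) (ε : R) (h : IsCoprime (Ideal.span {(ε : 𝓞 K)}) F) :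
    con R (Ideal.span {(ε : 𝓞 K)}) = Ideal.span {ε} := by
  apply le_antisymm
  · intro x hx
    rw [mem_con, Ideal.mem_span_singleton'] at hx
    obtain ⟨y, hy⟩ := hx
    have h1 := pow_ee hF h
    obtain ⟨k, hk⟩ := Nat.exists_eq_succ_of_ne_zero (ee_pos hF).ne'
    rw [hk, Nat.succ_eq_add_one] at h1
    have yR : y ∈ R := by
      have : y = (ε : 𝓞 K) ^ k * x - y * ((ε : 𝓞 K) ^ (k+1) - 1) := by rw [← hy]; ring
      rw [this]
      exact R.sub_mem (R.mul_mem (R.pow_mem ε.2 _) x.2) (hFR _ (F.mul_mem_left _ h1))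
    exact Ideal.mem_span_singleton'.2 ⟨⟨y, yR⟩, Subtype.ext hy⟩
  · rw [Ideal.span_singleton_le_iff_mem, mem_con]
    exact Ideal.mem_span_singleton_self _

lemma con_top : con R (1 : Ideal (𝓞 K)) = 1 := by
  simp [con, Ideal.one_eq_top]

lemma con_pow (hFR : ∀ x ∈ F, x ∈ R) {I : Ideal (𝓞 K)} (hI : IsCoprime I F) (n : ℕ) :
    con R (I ^ n) = con R I ^ n := by
  induction n with
  | zero => simp only [pow_zero, con_top]
  | succ n ih => rw [pow_succ, pow_succ, con_mul hFR hI.pow_left hI, ih]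

/-- a unit of the maximal order lying in R is a unit of R -/
lemma isUnit_R (hFR : ∀ x ∈ F, x ∈ R) (hF : F ≠ ⊥) (x : R) (hx : IsUnit (x : 𝓞 K)) : IsUnit x := by
  have h1 : Ideal.span {(x : 𝓞 K)} = 1 := by rw [Ideal.span_singleton_eq_top.2 hx, Ideal.one_eq_top]
  have := con_span hFR hF x (by rw [h1]; exact isCoprime_one_left)
  rw [h1, con_top] at this
  rw [← Ideal.span_singleton_eq_top, ← this, Ideal.one_eq_top]

lemma exists_pow_principal (I : Ideal (𝓞 K)) (hI : I ≠ ⊥) : ∃ n, 0 < n ∧ ∃ δ, I ^ n = Ideal.span {δ} := by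
  refine ⟨Fintype.card (ClassGroup (𝓞 K)), Fintype.card_pos, ?_⟩
  have hI0 : I ∈ (Ideal (𝓞 K))⁰ := mem_nonZeroDivisors_of_ne_zero hI
  have : ClassGroup.mk0 (⟨I, hI0⟩ ^ Fintype.card (ClassGroup (𝓞 K))) = 1 := by
    rw [map_pow, pow_card_eq_one]
  rw [ClassGroup.mk0_eq_one_iff] at this
  obtain ⟨δ, h⟩ := this
  exact ⟨δ, by simpa using h⟩

lemma con_unit (hFR : ∀ x ∈ F, x ∈ R) (hF : F ≠ ⊥) {I : Ideal (𝓞 K)} (hI0 : I ≠ ⊥) (hI : IsCoprime I F) :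
    IsUnit ((con R I : Ideal R) : FractionalIdeal R⁰ (FractionRing R)) := by
  obtain ⟨n, hn, δ, hδ⟩ := exists_pow_principal I hI0
  have hco : IsCoprime (Ideal.span {δ}) F := by rw [← hδ]; exact hI.pow_left
  have h1 := pow_ee hF hco
  have hδR := mem_R_of_sub_one hFR h1
  have h0 : δ ≠ 0 := by
    rintro rfl
    exact pow_ne_zero n hI0 (by rw [hδ]; simp)
  have e : con R I ^ (n * ee F) = Ideal.span {(⟨δ ^ ee F, hδR⟩ : R)} := by
    rw [← con_pow hFR hI, pow_mul, hδ, Ideal.span_singleton_pow]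
    refine con_span hFR hF ⟨δ ^ ee F, hδR⟩ ?_
    rw [← Ideal.span_singleton_pow]
    exact hco.pow_left
  rw [← isUnit_pow_iff (n := n * ee F) (Nat.mul_pos hn (ee_pos hF)).ne', ← FractionalIdeal.coeIdeal_pow, e,
    FractionalIdeal.coeIdeal_span_singleton]
  refine IsUnit.of_mul_eq_one (FractionalIdeal.spanSingleton R⁰ (algebraMap R (FractionRing R) ⟨δ ^ ee F, hδR⟩)⁻¹) ?_
  rw [FractionalIdeal.spanSingleton_mul_spanSingleton, mul_inv_cancel₀, FractionalIdeal.spanSingleton_one]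
  rw [Ne, FaithfulSMul.algebraMap_eq_zero_iff]
  intro h
  exact pow_ne_zero (ee F) h0 (congrArg Subtype.val h)

end PartB
end OrdPf

namespace OrdPf
open Filter Topology MeasureTheory Set

section Semi
open scoped nonZeroDivisors
variable {R : Type*} [CommRing R] [IsDomain R]

/-- invertible ideals can be moved away from finitely many maximal ideals -/
lemma move_ideal (s : Finset (Ideal R)) (hs : ∀ M ∈ s, M.IsMaximal) (hne : s.Nonempty)
    (I : (FractionalIdeal R⁰ (FractionRing R))ˣ) :
    ∃ x : FractionRing R, x ≠ 0 ∧ ∃ B : Ideal R,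
      (B : FractionalIdeal R⁰ (FractionRing R)) = FractionalIdeal.spanSingleton R⁰ x * I ∧
      ∀ M ∈ s, ¬ B ≤ M := by
  classical
  obtain ⟨I0, hI0⟩ : ∃ I0 : FractionalIdeal R⁰ (FractionRing R), I0 = I := ⟨_, rfl⟩
  obtain ⟨I', hI'⟩ : ∃ I' : FractionalIdeal R⁰ (FractionRing R), I' = (I⁻¹ : (FractionalIdeal R⁰ (FractionRing R))ˣ) := ⟨_, rfl⟩
  have hinv0 : I0 * I' = 1 := by rw [hI0, hI', Units.mul_inv]
  have hinv := hinv0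
  rw [FractionalIdeal.coe_ext_iff, FractionalIdeal.coe_mul] at hinv
  have coprime : ∀ M ∈ s, ∀ M' ∈ s.erase M, M ⊔ M' = ⊤ := by
    rintro M hM M' hM'
    exact Ideal.IsMaximal.coprime_of_ne (hs M hM) (hs M' (Finset.mem_of_mem_erase hM')) (Finset.ne_of_mem_erase hM').symm
  have nle : ∀ M ∈ s, ¬⨅ M' ∈ s.erase M, M' ≤ M := fun M hM =>
    left_lt_sup.1
      ((hs M hM).lt_top.trans_eq (Ideal.sup_iInf_eq_top <| coprime M hM).symm)
  have : ∀ M ∈ s, ∃ a ∈ I0, ∃ b ∈ I', a * b ∉ IsLocalization.coeSubmodule (FractionRing R) M := by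
    intro M hM; by_contra! h
    obtain ⟨x, hx, hxM⟩ :=
      SetLike.exists_of_lt
        ((IsLocalization.coeSubmodule_strictMono (S := FractionRing R) le_rfl (hs M hM).lt_top).trans_eq
          hinv.symm)
    exact hxM (Submodule.mul_le.2 h hx)
  choose! a ha b hb hm using this
  choose! u hu hum using fun M hM => SetLike.not_le_iff_exists.1 (nle M hM)
  obtain ⟨v, hvdef⟩ : ∃ v, v = ∑ M ∈ s, u M • b M := ⟨_, rfl⟩
  have hv : v ∈ I' := by
    rw [hvdef]; exact Submodule.sum_mem _ fun M hM => Submodule.smul_mem _ _ <| hb M hM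
  have this : ∀ a ∈ I0, ∀ b ∈ I', ∃ c, algebraMap R (FractionRing R) c = a * b := by
    intro a ha b hb; have hi := hinv.le
    obtain ⟨c, -, hc⟩ := hi (Submodule.mul_mem_mul ha hb)
    exact ⟨c, hc⟩
  have H : ∀ M ∈ s, a M * v ∉ IsLocalization.coeSubmodule (FractionRing R) M := by
    intro M hM hmem
    simp_rw [hvdef, Finset.mul_sum, mul_smul_comm] at hmem
    rw [← s.add_sum_erase _ hM, Submodule.add_mem_iff_left] at hmem
    · refine hm M hM ?_
      obtain ⟨c, hc : algebraMap R (FractionRing R) c = a M * b M⟩ := this _ (ha M hM) _ (hb M hM)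
      rw [← hc] at hmem ⊢
      rw [Algebra.smul_def, ← map_mul] at hmem
      obtain ⟨d, hdM, he⟩ := hmem
      have he2 : algebraMap R (FractionRing R) d = algebraMap R (FractionRing R) (u M * c) := he
      rw [IsFractionRing.injective R (FractionRing R) he2] at hdM
      exact Submodule.mem_map_of_mem <|
          ((hs M hM).isPrime.mem_or_mem hdM).resolve_left <| hum M hM
    · refine Submodule.sum_mem _ fun M' hM' => ?_
      rw [Finset.mem_erase] at hM'
      obtain ⟨c, hc⟩ := this _ (ha M hM) _ (hb M' hM'.2)
      rw [← hc, Algebra.smul_def, ← map_mul]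
      specialize hu M' hM'.2
      simp_rw [Ideal.mem_iInf, Finset.mem_erase] at hu
      exact Submodule.mem_map_of_mem <| M.mul_mem_right _ <| hu M ⟨hM'.1.symm, hM⟩
  refine ⟨v, ?_, ?_⟩
  · rintro rfl
    obtain ⟨M, hM⟩ := hne
    exact H M hM (by rw [mul_zero]; exact Submodule.zero_mem _)
  · have hle : FractionalIdeal.spanSingleton R⁰ v * I0 ≤ 1 := by
      rw [← hinv0, mul_comm]
      exact mul_le_mul_right (FractionalIdeal.spanSingleton_le_iff_mem.2 hv) _
    obtain ⟨B, hB⟩ := FractionalIdeal.le_one_iff_exists_coeIdeal.1 hle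
    refine ⟨B, by rw [hB, hI0], fun M hM hBM => H M hM ?_⟩
    have h1 : v * a M ∈ FractionalIdeal.spanSingleton R⁰ v * I0 :=
      FractionalIdeal.mul_mem_mul (FractionalIdeal.mem_spanSingleton_self _ _) (ha M hM)
    rw [← hB, FractionalIdeal.mem_coeIdeal] at h1
    obtain ⟨c, hc, hc'⟩ := h1
    rw [mul_comm, ← hc']
    exact Submodule.mem_map_of_mem (hBM hc)

end Semi

section PartB2
open scoped Classical nonZeroDivisors
variable {K : Type*} [Field K] [NumberField K]
variable {R : Subring (𝓞 K)} {F : Ideal (𝓞 K)}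

/-- unit fractional ideal -/
noncomputable def UU (hFR : ∀ x ∈ F, x ∈ R) (hF : F ≠ ⊥) (m : PI F →₀ ℕ) : (FractionalIdeal R⁰ (FractionRing R))ˣ :=
  (con_unit hFR hF (Id_ne_bot F m) (Id_coprime F m)).unit

lemma UU_val (hFR : ∀ x ∈ F, x ∈ R) (hF : F ≠ ⊥) (m : PI F →₀ ℕ) :
    (UU hFR hF m : FractionalIdeal R⁰ (FractionRing R)) = (con R (Id F m) : Ideal R) := rfl

/-- class map -/
noncomputable def cl (hFR : ∀ x ∈ F, x ∈ R) (hF : F ≠ ⊥) : (PI F →₀ ℕ) →+ Additive (ClassGroup R) where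
  toFun m := Additive.ofMul (ClassGroup.mk (FractionRing R) (UU hFR hF m))
  map_zero' := by
    have : UU hFR hF 0 = 1 := by
      apply Units.ext
      rw [UU_val, Id_zero, con_top, Units.val_one, Ideal.one_eq_top, FractionalIdeal.coeIdeal_top]
    rw [this, map_one, ofMul_one]
  map_add' m n := by
    have : UU hFR hF (m + n) = UU hFR hF m * UU hFR hF n := by
      apply Units.ext
      rw [UU_val, Id_add, con_mul hFR (Id_coprime F m) (Id_coprime F n), Units.val_mul, UU_val, UU_val, FractionalIdeal.coeIdeal_mul]
    rw [this, map_mul, ofMul_mul]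

lemma cl_eq_zero (hFR : ∀ x ∈ F, x ∈ R) (hF : F ≠ ⊥) (m : PI F →₀ ℕ) :
    cl hFR hF m = 0 ↔ ∃ ε : R, Ideal.span {(ε : 𝓞 K)} = Id F m := by
  have h1 : cl hFR hF m = 0 ↔ ClassGroup.mk (FractionRing R) (UU hFR hF m) = 1 := Iff.rfl
  rw [h1, ClassGroup.mk_eq_one_of_coe_ideal (UU_val hFR hF m)]
  constructor
  · rintro ⟨x, hx, h⟩
    refine ⟨x, ?_⟩
    rw [← con_map hFR (Id_coprime F m), h, Ideal.map_span, Set.image_singleton]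
    rfl
  · rintro ⟨ε, h⟩
    refine ⟨ε, ?_, ?_⟩
    · rintro rfl
      exact Id_ne_bot F m (by rw [← h]; simp)
    · rw [← h]
      exact con_span hFR hF ε (by rw [h]; exact Id_coprime F m)

lemma finite_over (hF : F ≠ ⊥) : {M : Ideal R | con R F ≤ M}.Finite := by
  haveI : Finite (𝓞 K ⧸ F) := Ideal.finiteQuotientOfFreeOfNeBot F hF
  haveI : Finite (R ⧸ con R F) :=
    Finite.of_injective _ (Ideal.quotientMap_injective (I := F) (f := R.subtype))
  haveI : Finite (Ideal (R ⧸ con R F)) := Finite.of_injective _ SetLike.coe_injective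
  refine Set.Finite.of_finite_image (f := Ideal.map (Ideal.Quotient.mk (con R F))) (Set.toFinite _) ?_
  intro M hM N hN h
  have e : ∀ M : Ideal R, con R F ≤ M → Ideal.comap (Ideal.Quotient.mk (con R F)) (Ideal.map (Ideal.Quotient.mk (con R F)) M) = M := by
    intro M hM
    rw [Ideal.comap_map_of_surjective _ Ideal.Quotient.mk_surjective, ← RingHom.ker_eq_comap_bot, Ideal.mk_ker, sup_eq_left]
    exact hM
  rw [← e M hM, ← e N hN, h]

lemma con_map' (hFR : ∀ x ∈ F, x ∈ R) (B : Ideal R) (hB : B ⊔ con R F = ⊤) :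
    con R (B.map R.subtype) = B ∧ IsCoprime (B.map R.subtype) F := by
  obtain ⟨b, hb, f, hf, h1⟩ := Submodule.mem_sup.1 ((Ideal.eq_top_iff_one _).1 hB)
  constructor
  · apply le_antisymm
    · intro y hy
      rw [mem_con] at hy
      have key : ∀ z ∈ B.map R.subtype, ∃ w ∈ B, (w : 𝓞 K) = z * (f : 𝓞 K) := by
        intro z hz
        refine Submodule.span_induction ?_ ?_ ?_ ?_ hz
          (p := fun z _ => ∀ f : R, f ∈ con R F → ∃ w ∈ B, (w : 𝓞 K) = z * (f : 𝓞 K)) f hf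
        · rintro _ ⟨w, hw, rfl⟩ f hf
          exact ⟨w * f, B.mul_mem_right _ hw, rfl⟩
        · intro f hf
          exact ⟨0, B.zero_mem, by simp⟩
        · rintro x y - - hx hy f hf
          obtain ⟨w, hw, e⟩ := hx f hf
          obtain ⟨w', hw', e'⟩ := hy f hf
          exact ⟨w + w', B.add_mem hw hw', by rw [Subring.coe_add, e, e']; ring⟩
        · rintro a x - hx f hf
          have hm : a * (f : 𝓞 K) ∈ F := F.mul_mem_left _ (mem_con.1 hf)
          obtain ⟨w, hw, e⟩ := hx ⟨a * f, hFR _ hm⟩ (mem_con.2 hm)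
          exact ⟨w, hw, by rw [e, smul_eq_mul]; ring⟩
      obtain ⟨w, hw, e⟩ := key _ hy
      have : y = y * b + w := by
        have h2 : (b : 𝓞 K) + f = 1 := congrArg Subtype.val h1
        apply Subtype.ext
        rw [Subring.coe_add, e, Subring.coe_mul]
        linear_combination (-(y : 𝓞 K)) * h2
      rw [this]
      exact B.add_mem (B.mul_mem_left _ hb) hw
    · exact Ideal.le_comap_map
  · rw [Ideal.isCoprime_iff_exists]
    exact ⟨b, Ideal.mem_map_of_mem R.subtype hb, f, mem_con.1 hf, congrArg Subtype.val h1⟩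

theorem cl_surj (hFR : ∀ x ∈ F, x ∈ R) (hF : F ≠ ⊥) : Function.Surjective (cl hFR hF) := by
  intro g
  obtain ⟨I, hI⟩ : ∃ I : (FractionalIdeal R⁰ (FractionRing R))ˣ, Additive.ofMul (ClassGroup.mk (FractionRing R) I) = g := by
    refine ClassGroup.induction (FractionRing R) (P := fun g => ∃ I : (FractionalIdeal R⁰ (FractionRing R))ˣ, Additive.ofMul (ClassGroup.mk (FractionRing R) I) = Additive.ofMul g) ?_ g.toMul
    intro I; exact ⟨I, rfl⟩
  obtain ⟨M0, hM0⟩ := Ideal.exists_maximal R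
  have hfin : {M : Ideal R | con R F ≤ M ∧ M.IsMaximal}.Finite := (finite_over hF).subset fun M h => h.1
  obtain ⟨x, hx, B, hB, hBM⟩ := move_ideal (insert M0 hfin.toFinset) (by
    intro M hM
    rcases Finset.mem_insert.1 hM with rfl | h
    · exact hM0
    · exact (hfin.mem_toFinset.1 h).2) (Finset.insert_nonempty _ _) I
  have hsup : B ⊔ con R F = ⊤ := by
    by_contra h
    obtain ⟨M, hM, hle⟩ := Ideal.exists_le_maximal _ h
    exact hBM M (Finset.mem_insert_of_mem (hfin.mem_toFinset.2 ⟨le_sup_right.trans hle, hM⟩)) (le_sup_left.trans hle)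
  obtain ⟨h1, h2⟩ := con_map' hFR B hsup
  have hne : B.map R.subtype ≠ ⊥ := by
    intro h
    rw [h] at h1
    have : B = ⊥ := by
      rw [← h1]
      refine (Submodule.eq_bot_iff _).2 fun y hy => ?_
      exact Subtype.ext (by simpa using mem_con.1 hy)
    exact hBM M0 (Finset.mem_insert_self _ _) (by rw [this]; exact bot_le)
  obtain ⟨m, hm⟩ := Id_surj F _ hne h2
  refine ⟨m, ?_⟩
  rw [← hI]
  change Additive.ofMul (ClassGroup.mk (FractionRing R) (UU hFR hF m)) = _
  congr 1
  symm
  rw [ClassGroup.mk_eq_mk]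
  refine ⟨Units.mk0 x hx, Units.ext ?_⟩
  rw [UU_val, hm, h1, hB, Units.val_mul, coe_toPrincipalIdeal, mul_comm]
  rfl

end PartB2
end OrdPf

namespace OrdPf
open Filter Topology MeasureTheory Set

section PartB3
open scoped Classical nonZeroDivisors
variable {K : Type*} [Field K] [NumberField K]
variable {R : Subring (𝓞 K)} {F : Ideal (𝓞 K)}

lemma cl_eq_of_cong (hFR : ∀ x ∈ F, x ∈ R) (hF : F ≠ ⊥) {a a' : PI F →₀ ℕ} {ε ε' : 𝓞 K}
    (h : Ideal.span {ε} = Id F a) (h' : Ideal.span {ε'} = Id F a') (hc : ε - ε' ∈ F) :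
    cl hFR hF a = cl hFR hF a' := by
  obtain ⟨k, hk⟩ := Nat.exists_eq_succ_of_ne_zero (ee_pos hF).ne'
  have h1 := pow_ee (x := ε') hF (by rw [h']; exact Id_coprime F a')
  rw [hk, Nat.succ_eq_add_one] at h1
  have e1 : cl hFR hF (k • a' + a) = 0 := by
    have hm : ε' ^ k * ε - 1 ∈ F := by
      have : ε' ^ k * ε - 1 = ε' ^ k * (ε - ε') + (ε' ^ (k+1) - 1) := by ring
      rw [this]; exact F.add_mem (F.mul_mem_left _ hc) h1
    refine (cl_eq_zero hFR hF _).2 ⟨⟨_, mem_R_of_sub_one hFR hm⟩, ?_⟩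
    rw [Id_add, Id_nsmul, ← h, ← h', Ideal.span_singleton_pow, Ideal.span_singleton_mul_span_singleton]
  have e2 : cl hFR hF (k • a' + a') = 0 := by
    have hm : ε' ^ k * ε' - 1 ∈ F := by rw [← pow_succ]; exact h1
    refine (cl_eq_zero hFR hF _).2 ⟨⟨_, mem_R_of_sub_one hFR hm⟩, ?_⟩
    rw [Id_add, Id_nsmul, ← h', Ideal.span_singleton_pow, Ideal.span_singleton_mul_span_singleton]
  rw [map_add] at e1 e2
  exact add_left_cancel (e1.trans e2.symm)

theorem cl_finite (hFR : ∀ x ∈ F, x ∈ R) (hF : F ≠ ⊥) : Finite (Additive (ClassGroup R)) := by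
  haveI : Finite (𝓞 K ⧸ F) := Ideal.finiteQuotientOfFreeOfNeBot F hF
  choose m hm using cl_surj hFR hF
  let c : (PI F →₀ ℕ) → ClassGroup (𝓞 K) := fun m => ClassGroup.mk0 ⟨Id F m, mem_nonZeroDivisors_of_ne_zero (Id_ne_bot F m)⟩
  have cadd : ∀ a b, c (a + b) = c a * c b := by
    intro a b
    simp only [c]
    rw [← map_mul]
    congr 1
    exact Subtype.ext (Id_add F a b)
  have hn : ∀ C, ∃ n, ∀ m, c m = C → c (m + n) = 1 := by
    intro C
    by_cases h : ∃ m, c m = C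
    · obtain ⟨m0, h0⟩ := h
      obtain ⟨k, hk, δ, hδ⟩ := exists_pow_principal (Id F m0) (Id_ne_bot F m0)
      obtain ⟨j, rfl⟩ := Nat.exists_eq_succ_of_ne_zero hk.ne'
      refine ⟨j • m0, fun m hm => ?_⟩
      rw [cadd, hm, ← h0, ← cadd, ClassGroup.mk0_eq_one_iff, Id_add, Id_nsmul, ← pow_succ', ← Nat.succ_eq_add_one, hδ]
      exact ⟨δ, rfl⟩
    · exact ⟨0, fun m hm => absurd ⟨m, hm⟩ h⟩
  choose n hn using hn
  have he : ∀ g, ∃ ε, Ideal.span {ε} = Id F (m g + n (c (m g))) := by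
    intro g
    have := hn _ (m g) rfl
    rw [ClassGroup.mk0_eq_one_iff] at this
    obtain ⟨ε, h⟩ := this
    exact ⟨ε, h.symm⟩
  choose ε hε using he
  refine Finite.of_injective (fun g => (c (m g), Ideal.Quotient.mk F (ε g))) ?_
  intro g g' h
  simp only [Prod.mk.injEq] at h
  have h1 := cl_eq_of_cong hFR hF (hε g) (hε g') (Ideal.Quotient.eq.1 h.2)
  rw [h.1, map_add, map_add, hm, hm] at h1
  exact add_right_cancel h1

/-- residue classes of associates of elements of R -/
def AA (R : Subring (𝓞 K)) (F : Ideal (𝓞 K)) : Set (𝓞 K ⧸ F) :=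
  {a | ∃ (u : (𝓞 K)ˣ) (r : R), IsUnit (Ideal.Quotient.mk F (r : 𝓞 K)) ∧ a = Ideal.Quotient.mk F ((u : 𝓞 K) * r)}

lemma AA_one : (1 : 𝓞 K ⧸ F) ∈ AA R F := ⟨1, 1, by simp, by simp⟩

lemma AA_unit {a : 𝓞 K ⧸ F} (h : a ∈ AA R F) : IsUnit a := by
  obtain ⟨u, r, hr, rfl⟩ := h
  rw [map_mul]
  exact (u.isUnit.map _).mul hr

lemma AA_cl (hFR : ∀ x ∈ F, x ∈ R) (hF : F ≠ ⊥) {n : PI F →₀ ℕ} {ε : 𝓞 K} (h : Ideal.span {ε} = Id F n) :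
    Ideal.Quotient.mk F ε ∈ AA R F ↔ cl hFR hF n = 0 := by
  rw [cl_eq_zero]
  constructor
  · rintro ⟨u, r, hr, e⟩
    rw [Ideal.Quotient.eq] at e
    have hm : ((u⁻¹ : (𝓞 K)ˣ) : 𝓞 K) * ε ∈ R := by
      have e2 : ((u⁻¹ : (𝓞 K)ˣ) : 𝓞 K) * ε = ((u⁻¹ : (𝓞 K)ˣ) : 𝓞 K) * (ε - u * r) + r := by
        have := u.inv_mul
        linear_combination (r : 𝓞 K) * this
      rw [e2]
      exact R.add_mem (hFR _ (F.mul_mem_left _ e)) r.2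
    refine ⟨⟨_, hm⟩, ?_⟩
    rw [← h]
    exact Ideal.span_singleton_mul_left_unit (u⁻¹).isUnit ε
  · rintro ⟨r, hr⟩
    have has : Associated (r : 𝓞 K) ε := by rw [← Ideal.span_singleton_eq_span_singleton, hr, h]
    obtain ⟨u, hu⟩ := has
    refine ⟨u, r, isUnit_mk.2 ?_, ?_⟩
    · rw [hr]; exact Id_coprime F n
    · rw [← hu, mul_comm]

/-- parametrisation of the elements counted -/
lemma param (hFR : ∀ x ∈ F, x ∈ R) (hF : F ≠ ⊥) (g : Additive (ClassGroup R)) (m' : PI F →₀ ℕ)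
    (hm' : cl hFR hF m' = - g) :
    ∃ (ε : {m // cl hFR hF m = g} → 𝓞 K), (∀ m, Ideal.span {ε m} = Id F (m.1 + m')) ∧
      ∃ e : {m // cl hFR hF m = g} × (𝓞 K)ˣ ≃ {x : 𝓞 K | (x ∈ Id F m' ∧ Ideal.Quotient.mk F x ∈ AA R F) ∧ x ≠ 0},
        ∀ m u, ((e (m, u) : 𝓞 K)) = u * ε m := by
  have hex : ∀ m : {m // cl hFR hF m = g}, ∃ ε : 𝓞 K, Ideal.span {ε} = Id F (m.1 + m') := by
    intro m
    have : cl hFR hF (m.1 + m') = 0 := by rw [map_add, m.2, hm', add_neg_cancel]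
    obtain ⟨ε, h⟩ := (cl_eq_zero hFR hF _).1 this
    exact ⟨ε, h⟩
  choose ε hε using hex
  refine ⟨ε, hε, ?_⟩
  have h0 : ∀ m, ε m ≠ 0 := by
    intro m h
    refine Id_ne_bot F (m.1 + m') ?_
    rw [← hε, h]; simp
  have hsp : ∀ m (u : (𝓞 K)ˣ), Ideal.span {(u : 𝓞 K) * ε m} = Id F (m.1 + m') := by
    intro m u
    rw [← hε]
    exact Ideal.span_singleton_mul_left_unit u.isUnit _
  let ef : {m // cl hFR hF m = g} × (𝓞 K)ˣ → {x : 𝓞 K | (x ∈ Id F m' ∧ Ideal.Quotient.mk F x ∈ AA R F) ∧ x ≠ 0} :=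
    fun q => ⟨q.2 * ε q.1, by
      refine ⟨⟨?_, ?_⟩, mul_ne_zero q.2.ne_zero (h0 _)⟩
      · have : (q.2 : 𝓞 K) * ε q.1 ∈ Id F q.1.1 * Id F m' := by
          rw [← Id_add, ← hsp q.1 q.2]; exact Ideal.mem_span_singleton_self _
        exact ((Ideal.mul_le_inf : Id F q.1.1 * Id F m' ≤ _) this).2
      · rw [AA_cl hFR hF (hsp q.1 q.2), map_add, q.1.2, hm', add_neg_cancel]⟩
  have hef : Function.Bijective ef := by
    constructor
    · rintro ⟨m, u⟩ ⟨n, v⟩ h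
      have h1 : (u : 𝓞 K) * ε m = v * ε n := congrArg Subtype.val h
      have h2 := hsp m u
      rw [h1, hsp n v] at h2
      have h3 : n = m := Subtype.ext (add_right_cancel (Id_injective F h2))
      subst h3
      have := mul_right_cancel₀ (h0 _) h1
      rw [Units.ext this]
    · rintro ⟨x, ⟨hx1, hx2⟩, hx0⟩
      have hco := isUnit_mk.1 (AA_unit hx2)
      obtain ⟨J, hJ⟩ := Ideal.dvd_iff_le.2 ((Ideal.span_singleton_le_iff_mem (I := Id F m')).2 hx1)
      have hJ0 : J ≠ ⊥ := by
        rintro rfl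
        rw [Ideal.mul_bot, Ideal.span_singleton_eq_bot] at hJ
        exact hx0 hJ
      rw [hJ] at hco
      obtain ⟨m, rfl⟩ := Id_surj F J hJ0 (IsCoprime.of_mul_left_right hco)
      rw [mul_comm, ← Id_add] at hJ
      have h1 := (AA_cl hFR hF hJ).1 hx2
      rw [map_add, hm', add_neg_eq_zero] at h1
      have has : Associated (ε ⟨m, h1⟩) x := by
        rw [← Ideal.span_singleton_eq_span_singleton, hε, hJ]
      obtain ⟨u, hu⟩ := has
      refine ⟨(⟨m, h1⟩, u), Subtype.ext ?_⟩
      simp only [ef]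
      rw [← hu, mul_comm]
  exact ⟨Equiv.ofBijective ef hef, fun m u => rfl⟩

end PartB3
end OrdPf

namespace OrdPf
open Filter Topology MeasureTheory Set

section PartB4
open scoped Classical nonZeroDivisors
open NumberField.mixedEmbedding
variable {K : Type*} [Field K] [NumberField K]
variable {R : Subring (𝓞 K)} {F : Ideal (𝓞 K)}

lemma norm_emb (t : ℝ) (ht : 0 < t) (ε : 𝓞 K) :
    1 / mixedEmbedding.norm (t⁻¹ • mixedEmbedding K (ε : K)) =
      t ^ Module.finrank ℚ K / (Ideal.absNorm (Ideal.span {ε}) : ℝ) := by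
  rw [mixedEmbedding.norm_smul, norm_eq_norm, abs_of_pos (inv_pos.2 ht), inv_pow, Ideal.absNorm_span_singleton,
    ← Algebra.coe_norm_int, Nat.cast_natAbs]
  push_cast
  rw [one_div, mul_inv, inv_inv, div_eq_mul_inv]

lemma unit_emb (t : ℝ) (u : (𝓞 K)ˣ) (ε : 𝓞 K) :
    t⁻¹ • mixedEmbedding K (((u : 𝓞 K) * ε : 𝓞 K) : K) = u • (t⁻¹ • mixedEmbedding K (ε : K)) := by
  have h : (((u : 𝓞 K) * ε : 𝓞 K) : K) = algebraMap (𝓞 K) K u * (ε : K) := map_mul (algebraMap (𝓞 K) K) _ _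
  rw [unitSMul_smul, mul_smul_comm, h, map_mul]

lemma tsum_if_subtype {α : Type*} (p : α → Prop) (f : α → ℝ) :
    ∑' m : {m // p m}, f m.1 = ∑' m, if p m then f m else 0 := by
  have := tsum_subtype {m | p m} f
  refine Eq.trans this ?_
  refine tsum_congr fun m => ?_
  simp [indicator]

lemma count_ind (m' : PI F →₀ ℕ) {ψ : ℝ → ℝ} {a b : ℝ} (hψ : TestFn ψ a b) (t : ℝ) :
    (fun ε : 𝓞 K => (if ε ∈ Id F m' ∧ Ideal.Quotient.mk F ε ∈ AA R F then
      FF ψ (t⁻¹ • mixedEmbedding K ε) else 0)) =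
      indicator {x : 𝓞 K | (x ∈ Id F m' ∧ Ideal.Quotient.mk F x ∈ AA R F) ∧ x ≠ 0}
      (fun ε => FF ψ (t⁻¹ • mixedEmbedding K (ε : K))) := by
  funext x
  by_cases hx : x = 0
  · rw [indicator_of_notMem (by simp [hx])]
    split_ifs with h
    · unfold FF
      have : mixedEmbedding.norm (t⁻¹ • mixedEmbedding K (x : K)) = 0 := by
        rw [hx]; simp
      rw [this, div_zero, hψ.zero_a 0 hψ.a_pos.le, zero_mul]
    · rfl
  · by_cases h : x ∈ Id F m' ∧ Ideal.Quotient.mk F x ∈ AA R F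
    · rw [if_pos h, indicator_of_mem (show x ∈ {x : 𝓞 K | (x ∈ Id F m' ∧ Ideal.Quotient.mk F x ∈ AA R F) ∧ x ≠ 0} from ⟨h, hx⟩)]
    · rw [if_neg h, indicator_of_notMem]
      intro h'; exact h h'.1

set_option maxHeartbeats 100000 in
theorem count_eq (hFR : ∀ x ∈ F, x ∈ R) (hF : F ≠ ⊥) (g : Additive (ClassGroup R)) (m' : PI F →₀ ℕ)
    (hm' : cl hFR hF m' = - g) {ψ : ℝ → ℝ} {a b : ℝ} (hψ : TestFn ψ a b) (t : ℝ) (ht : 0 < t)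
    (hsum : Summable fun ε : 𝓞 K => (if ε ∈ Id F m' ∧ Ideal.Quotient.mk F ε ∈ AA R F then
      FF ψ (t⁻¹ • mixedEmbedding K ε) else 0)) :
    ∑' ε : 𝓞 K, (if ε ∈ Id F m' ∧ Ideal.Quotient.mk F ε ∈ AA R F then FF ψ (t⁻¹ • mixedEmbedding K ε) else 0) =
    Units.torsionOrder K * ∑' m, if cl hFR hF m = g then
      ψ (t ^ Module.finrank ℚ K / (nm (NP F) m * Ideal.absNorm (Id F m'))) else 0 := by
  obtain ⟨ε, hε, e, he⟩ := param hFR hF g m' hm'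
  have h0 : ∀ m, ε m ≠ 0 := by
    intro m h
    refine Id_ne_bot F (m.1 + m') ?_
    rw [← hε, h]; simp
  have ind := count_ind (F := F) (R := R) m' hψ t
  have hs := hsum.hasSum
  rw [ind] at hs ⊢
  rw [← hasSum_subtype_iff_indicator, ← e.hasSum_iff] at hs
  have key : ((fun ε : 𝓞 K => FF ψ (t⁻¹ • mixedEmbedding K (ε : K))) ∘ (Subtype.val : {x : 𝓞 K | (x ∈ Id F m' ∧ Ideal.Quotient.mk F x ∈ AA R F) ∧ x ≠ 0} → 𝓞 K)) ∘ e =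
      fun q => FF ψ (q.2 • (t⁻¹ • mixedEmbedding K (ε q.1 : K))) := by
    funext ⟨m, u⟩
    simp only [Function.comp]
    rw [he, unit_emb]
  rw [key] at hs
  have hn : ∀ m : {m // cl hFR hF m = g}, mixedEmbedding.norm (t⁻¹ • mixedEmbedding K (ε m : K)) ≠ 0 := by
    intro m
    rw [mixedEmbedding.norm_smul, norm_eq_norm]
    refine mul_ne_zero (pow_ne_zero _ (abs_ne_zero.2 (inv_pos.2 ht).ne')) ?_
    have : (ε m : K) ≠ 0 := by simpa using h0 m
    have := (Algebra.norm_ne_zero_iff (R := ℚ)).2 this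
    simpa using this
  have hfib : ∀ m : {m // cl hFR hF m = g}, HasSum (fun u : (𝓞 K)ˣ => FF ψ (u • (t⁻¹ • mixedEmbedding K (ε m : K))))
      (Units.torsionOrder K * ψ (t ^ Module.finrank ℚ K / (nm (NP F) m.1 * Ideal.absNorm (Id F m')))) := by
    intro m
    have h3 := FF_hasSum ψ _ (hn m)
    rw [norm_emb t ht, hε, Id_add, map_mul, Nat.cast_mul, ← nm_Id] at h3
    exact h3
  have h2 := hs.prod_fiberwise hfib
  rw [← h2.tsum_eq, tsum_mul_left]
  congr 1
  exact tsum_if_subtype (fun m => cl hFR hF m = g) (fun m => ψ (t ^ Module.finrank ℚ K / (nm (NP F) m * Ideal.absNorm (Id F m'))))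

theorem hcount (hFR : ∀ x ∈ F, x ∈ R) (hF : F ≠ ⊥) (ψ : ℝ → ℝ) (a b : ℝ) (hψ : TestFn ψ a b)
    (hs : ContDiff ℝ ((⊤ : ℕ∞) : WithTop ℕ∞) ψ) :
    ∃ κ C : ℝ, 0 < κ ∧ ∀ g : Additive (ClassGroup R), ∀ x : ℝ, 1 ≤ x →
        |(∑' m, if cl hFR hF m = g then ψ (x / nm (NP F) m) else 0) - κ * x| ≤ C := by
  haveI := cl_finite hFR hF
  haveI : Finite (𝓞 K ⧸ F) := Ideal.finiteQuotientOfFreeOfNeBot F hF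
  obtain ⟨hc, hpos⟩ := weight (K := K) hψ hs
  have hsm := FF_smooth (K := K) hψ hs
  obtain ⟨W, hW⟩ : ∃ W : ℝ, W = Units.torsionOrder K := ⟨_, rfl⟩
  have hWpos : 0 < W := by
    rw [hW]; exact_mod_cast Units.torsionOrder_pos K
  have hV := V0_pos (K := K)
  have hNF : (0 : ℝ) < Ideal.absNorm F := by
    rw [Nat.cast_pos, Nat.pos_iff_ne_zero, Ne, Ideal.absNorm_eq_zero_iff]; exact hF
  have hA : (0 : ℝ) < Nat.card (AA R F) := by
    haveI : Nonempty (AA R F) := ⟨⟨1, AA_one⟩⟩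
    exact_mod_cast Nat.card_pos
  obtain ⟨κ, hκ⟩ : ∃ κ : ℝ, κ = Nat.card (AA R F) * (∫ v : mixedSpace K, FF ψ v) / (Ideal.absNorm F * V0 K) / W := ⟨_, rfl⟩
  have hκpos : 0 < κ := by
    rw [hκ]; exact div_pos (div_pos (mul_pos hA hpos) (mul_pos hNF hV)) hWpos
  have each : ∀ g : Additive (ClassGroup R), ∃ C : ℝ, ∀ x : ℝ, 1 ≤ x →
        |(∑' m, if cl hFR hF m = g then ψ (x / nm (NP F) m) else 0) - κ * x| ≤ C := by
    intro g
    obtain ⟨m', hm'⟩ := cl_surj hFR hF (-g)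
    obtain ⟨⟨C, hC⟩, hsum⟩ := E_sum (Id F m') F (Id_ne_bot F m') hF (Id_coprime F m') (AA R F) (FF ψ) hsm hc
    refine ⟨C / W, fun x hx => ?_⟩
    obtain ⟨N, hN⟩ : ∃ N : ℝ, N = Ideal.absNorm (Id F m') := ⟨_, rfl⟩
    have hN1 : 1 ≤ N := by
      rw [hN, Nat.one_le_cast, Nat.one_le_iff_ne_zero, Ne, Ideal.absNorm_eq_zero_iff]; exact Id_ne_bot F m'
    have hn : Module.finrank ℚ K ≠ 0 := Module.finrank_pos.ne'
    obtain ⟨t, ht⟩ : ∃ t : ℝ, t = (N * x) ^ ((Module.finrank ℚ K : ℝ)⁻¹) := ⟨_, rfl⟩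
    have hNx : 1 ≤ N * x := one_le_mul_of_one_le_of_one_le hN1 hx
    have ht1 : 1 ≤ t := by rw [ht]; exact Real.one_le_rpow hNx (by positivity)
    have htn : t ^ Module.finrank ℚ K = N * x := by
      rw [ht]; exact Real.rpow_inv_natCast_pow (by linarith) hn
    have h1 := hC t ht1
    rw [count_eq hFR hF g m' hm' hψ t (by linarith) (hsum t ht1), htn, ← hN, ← hW] at h1
    have h2 : ∀ m, N * x / (nm (NP F) m * N) = x / nm (NP F) m := by
      intro m
      rw [mul_comm N x, mul_div_mul_right _ _ (by linarith)]
    simp_rw [h2] at h1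
    have h3 : N * x * (Nat.card (AA R F) * (∫ v : mixedSpace K, FF ψ v) / (N * Ideal.absNorm F * V0 K)) = W * (κ * x) := by
      rw [hκ]
      have : N ≠ 0 := by linarith
      field_simp
    rw [h3, ← mul_sub, abs_mul, abs_of_pos hWpos] at h1
    rw [le_div_iff₀ hWpos, mul_comm]
    exact h1
  choose C hC using each
  obtain ⟨D, hD⟩ := (Set.finite_range C).bddAbove
  exact ⟨κ, D, hκpos, fun g x hx => (hC g x hx).trans (hD ⟨g, rfl⟩)⟩

theorem prime_in_class (hFR : ∀ x ∈ F, x ∈ R) (hF : F ≠ ⊥) (g : Additive (ClassGroup R)) :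
    ∃ p : PI F, cl hFR hF (Finsupp.single p 1) = g := by
  haveI := cl_finite hFR hF
  exact primes_in_classes (NP_two F) (nm_fin F) (cl hFR hF) (hcount hFR hF) g

end PartB4
end OrdPf

namespace OrdPf
open Filter Topology MeasureTheory Set

section PartE
open scoped Classical nonZeroDivisors
variable {K : Type*} [Field K] [NumberField K]
variable {R : Subring (𝓞 K)} {F : Ideal (𝓞 K)}

lemma conductor_sub (x : 𝓞 K) (hx : x ∈ conductorIdeal R) : x ∈ R := by
  have h : ∀ y : 𝓞 K, x * y ∈ R := hx
  simpa using h 1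

lemma conductor_ne_bot (hR : Finite ((𝓞 K) ⧸ R.toAddSubgroup)) : conductorIdeal R ≠ ⊥ := by
  intro h
  have hn : R.toAddSubgroup.index ≠ 0 := AddSubgroup.index_ne_zero_of_finite
  have : (R.toAddSubgroup.index : 𝓞 K) ∈ conductorIdeal R := by
    change ∀ y : 𝓞 K, _ * y ∈ R
    intro y
    have := AddSubgroup.nsmul_index_mem R.toAddSubgroup y
    rw [nsmul_eq_mul] at this
    exact this
  rw [h, Ideal.mem_bot] at this
  exact hn (by exact_mod_cast this)

lemma Id_sum {ι : Type*} (p : ι → PI F) (s : Finset ι) :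
    Id F (∑ i ∈ s, Finsupp.single (p i) 1) = ∏ i ∈ s, (p i).1.asIdeal := by
  induction s using Finset.induction_on with
  | empty => simp [Id_zero]
  | insert a s ha ih => rw [Finset.sum_insert ha, Finset.prod_insert ha, Id_add, Id_single, ih]

lemma irred (hFR : ∀ x ∈ F, x ∈ R) (hF : F ≠ ⊥) {ι : Type*} [Fintype ι] [Nonempty ι] (p : ι → PI F)
    (hmin : ∀ s : Finset ι, s.Nonempty → s ≠ Finset.univ → ∑ i ∈ s, cl hFR hF (Finsupp.single (p i) 1) ≠ 0)
    (α : R) (hα : Ideal.span {(α : 𝓞 K)} = Id F (∑ i, Finsupp.single (p i) 1)) : Irreducible α := by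
  rw [Id_sum] at hα
  have unit_of : ∀ x : R, Ideal.span {(x : 𝓞 K)} = 1 → IsUnit x := by
    intro x hx
    rw [Ideal.one_eq_top, Ideal.span_singleton_eq_top] at hx
    exact isUnit_R hFR hF x hx
  refine ⟨fun hu => ?_, fun x y hxy => ?_⟩
  · have h1 : IsUnit (∏ i, (p i).1.asIdeal) := by
      rw [← hα, Ideal.isUnit_iff, Ideal.span_singleton_eq_top]
      exact hu.map R.subtype
    obtain ⟨i⟩ := (inferInstance : Nonempty ι)
    exact (p i).1.prime.not_isUnit (isUnit_of_dvd_unit (Finset.dvd_prod_of_mem (fun i => (p i).1.asIdeal) (Finset.mem_univ i)) h1)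
  · have h1 : Ideal.span {(x : 𝓞 K)} * Ideal.span {(y : 𝓞 K)} = 1 * ∏ i, (p i).1.asIdeal := by
      rw [one_mul, ← hα, Ideal.span_singleton_mul_span_singleton, hxy, Subring.coe_mul]
    obtain ⟨t, u, b, c, htu, hdis, hbc, hx, hy⟩ := mul_eq_mul_prime_prod (fun i _ => (p i).1.prime) h1
    have hb : b = 1 := by
      rw [Ideal.one_eq_top, ← Ideal.isUnit_iff]; exact IsUnit.of_mul_eq_one _ hbc.symm
    have hc : c = 1 := by
      rw [Ideal.one_eq_top, ← Ideal.isUnit_iff]; exact IsUnit.of_mul_eq_one _ ((mul_comm _ _).trans hbc.symm)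
    rw [hb, one_mul] at hx
    rw [hc, one_mul] at hy
    have hz : ∑ i ∈ t, cl hFR hF (Finsupp.single (p i) 1) = 0 := by
      rw [← map_sum, cl_eq_zero]
      exact ⟨x, by rw [Id_sum, hx]⟩
    by_cases ht : t.Nonempty
    · by_cases ht' : t = Finset.univ
      · right
        have : u = ∅ := by
          rw [ht'] at hdis
          exact Finset.eq_empty_of_forall_notMem fun i hi => Finset.disjoint_left.1 hdis (Finset.mem_univ i) hi
        rw [this, Finset.prod_empty] at hy
        exact unit_of y hy
      · exact absurd hz (hmin t ht ht')
    · left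
      rw [Finset.not_nonempty_iff_eq_empty] at ht
      rw [ht, Finset.prod_empty] at hx
      exact unit_of x hx

lemma bool_sub (s : Finset Bool) (h : s.Nonempty) (h' : s ≠ Finset.univ) : s = {true} ∨ s = {false} := by
  revert s; decide

theorem main_thm (hFR : ∀ x ∈ F, x ∈ R) (hF : F ≠ ⊥) (d : ℕ) (hd : 2 ≤ d) (g : Fin d → Additive (ClassGroup R))
    (hsum : ∑ i, g i = 0)
    (hmin : ∀ s : Finset (Fin d), s.Nonempty → s ≠ Finset.univ → ∑ i ∈ s, g i ≠ 0) :
    ∃ (α β : R) (π : Fin d → R),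
      Irreducible α ∧ Irreducible β ∧ (∀ i, Irreducible (π i)) ∧
      α * β = ∏ i, π i := by
  choose p hp using fun i => prime_in_class hFR hF (g i)
  choose q hq using fun i => prime_in_class hFR hF (-g i)
  haveI : Nonempty (Fin d) := ⟨⟨0, by omega⟩⟩
  obtain ⟨α, hα⟩ := (cl_eq_zero hFR hF (∑ i, Finsupp.single (p i) 1)).1 (by
    rw [map_sum, ← hsum]; exact Finset.sum_congr rfl fun i _ => hp i)
  obtain ⟨β, hβ⟩ := (cl_eq_zero hFR hF (∑ i, Finsupp.single (q i) 1)).1 (by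
    rw [map_sum, ← neg_zero, ← hsum, ← Finset.sum_neg_distrib]; exact Finset.sum_congr rfl fun i _ => hq i)
  have hπ : ∀ i, ∃ π : R, Ideal.span {(π : 𝓞 K)} = Id F (Finsupp.single (p i) 1 + Finsupp.single (q i) 1) := by
    intro i
    exact (cl_eq_zero hFR hF _).1 (by rw [map_add, hp, hq, add_neg_cancel])
  choose π hπ using hπ
  have hg0 : ∀ i, g i ≠ 0 := by
    intro i
    have := hmin {i} (Finset.singleton_nonempty i) (by
      intro h
      have := congrArg Finset.card h
      rw [Finset.card_singleton, Finset.card_univ, Fintype.card_fin] at this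
      omega)
    simpa using this
  have iα : Irreducible α := irred hFR hF p (by
    intro s h1 h2
    rw [Finset.sum_congr rfl fun i _ => hp i]
    exact hmin s h1 h2) α hα
  have iβ : Irreducible β := irred hFR hF q (by
    intro s h1 h2
    rw [Finset.sum_congr rfl fun i _ => hq i, Finset.sum_neg_distrib, neg_ne_zero]
    exact hmin s h1 h2) β hβ
  have iπ : ∀ i, Irreducible (π i) := by
    intro i
    refine irred hFR hF (fun b : Bool => if b then p i else q i) ?_ (π i) ?_
    · intro s h1 h2
      rcases bool_sub s h1 h2 with rfl | rfl
      · simpa [hp] using hg0 i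
      · simpa [hq] using hg0 i
    · rw [hπ i]; simp
  have h1 : Ideal.span {((α * β : R) : 𝓞 K)} = Ideal.span {((∏ i, π i : R) : 𝓞 K)} := by
    rw [Subring.coe_mul, ← Ideal.span_singleton_mul_span_singleton, hα, hβ, SubmonoidClass.coe_finsetProd,
      ← Ideal.prod_span_singleton, Finset.prod_congr rfl fun i _ => hπ i, Id_sum, Id_sum, ← Finset.prod_mul_distrib]
    exact Finset.prod_congr rfl fun i _ => by rw [Id_add, Id_single, Id_single]
  have hco : IsCoprime (Ideal.span {((α * β : R) : 𝓞 K)}) F := by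
    rw [Subring.coe_mul, ← Ideal.span_singleton_mul_span_singleton, hα, hβ]
    exact (Id_coprime F _).mul_left (Id_coprime F _)
  have h2 := con_span hFR hF (α * β) hco
  rw [h1, con_span hFR hF _ (h1 ▸ hco), Ideal.span_singleton_eq_span_singleton] at h2
  obtain ⟨u, hu⟩ := h2.symm
  refine ⟨α * u, β, π, ?_, iβ, iπ, ?_⟩
  · exact (irreducible_mul_units u).2 iα
  · rw [← hu]; ring

end PartE
end OrdPf

theorem stmt_3 {K : Type*} [Field K] [NumberField K] (R : Subring (𝓞 K))
    (hR : Finite ((𝓞 K) ⧸ R.toAddSubgroup))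
    (d : ℕ) (hd : 2 ≤ d) (g : Fin d → ClassGroup R)
    (hsum : ∏ i, g i = 1)
    (hmin : ∀ s : Finset (Fin d), s.Nonempty → s ≠ Finset.univ → ∏ i ∈ s, g i ≠ 1) :
    ∃ (α β : R) (π : Fin d → R),
      Irreducible α ∧ Irreducible β ∧ (∀ i, Irreducible (π i)) ∧
      α * β = ∏ i, π i :=
  OrdPf.main_thm (F := conductorIdeal R) OrdPf.conductor_sub (OrdPf.conductor_ne_bot hR) d hd
    (fun i => Additive.ofMul (g i)) hsum hmin
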